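/- arXiv:1510.04613 — 4 statements merged into one kernel-verified Lean document; each statement's English description precedes it below -/
import Mathlib

section
/- Suppose supp ρ₀ and supp u₀ are contained in {x : |x| ≤ M}, and that q₀(l) > 0 and q₁(l) ≥ 0 hold for all l ∈ (M₀, M), where M₀ is a fixed constant with 0 ≤ M₀ < M. If μ > 0 and λ > 1, then there exists ε₀ > 0 such that for every 0 < ε ≤ ε₀ the lifespan T_ε of the smooth solution (ρ, u) is finite; equivalently, for such ε there exists no global C^∞ solution (ρ,u) on [0,∞)×ℝ³. -/
noncomputable section
open MeasureTheory Real Set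

/-- Euclidean space ℝ³. -/
abbrev E3 : Type := EuclideanSpace ℝ (Fin 3)
/-- A space-time point (t, x) ∈ ℝ × ℝ³. -/
abbrev Pt : Type := ℝ × E3

/-- Time derivative ∂ₜ. -/
def dt (f : Pt → ℝ) (p : Pt) : ℝ := fderiv ℝ f p (1, 0)
/-- Spatial derivative ∂ᵢ. -/
def dxi (i : Fin 3) (f : Pt → ℝ) (p : Pt) : ℝ := fderiv ℝ f p (0, EuclideanSpace.single i 1)
/-- Spatial derivative for a function of x only. -/
def pd (i : Fin 3) (f : E3 → ℝ) (x : E3) : ℝ := fderiv ℝ f x (EuclideanSpace.single i 1)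

/-- The 3-D compressible Euler equations with time-dependent damping
`∂ₜρ + div(ρu) = 0`, `∂ₜ(ρu) + div(ρ u ⊗ u + p I₃) = -(μ/(1+t)^λ) ρ u`,
with pressure `p(ρ) = A ρ^γ`, at the space-time point `q`. -/
def eulerDamped (A γ μ lam : ℝ) (ρ : Pt → ℝ) (u : Pt → Fin 3 → ℝ) (q : Pt) : Prop :=
  (dt ρ q + ∑ i, dxi i (fun z => ρ z * u z i) q = 0) ∧
  (∀ j : Fin 3,
    dt (fun z => ρ z * u z j) q
      + ∑ i, dxi i (fun z => ρ z * u z i * u z j + (if i = j then A * ρ z ^ γ else 0)) q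
      = -(μ / (1 + q.1) ^ lam) * (ρ q * u q j))

/-- power series with given coefficients -/
def psum (c : ℕ → ℝ) (z : ℝ) : ℝ := ∑' n, c n * z ^ n

lemma psum_summable (c : ℕ → ℝ) (hc : ∀ n, |c n| ≤ 1 / (n.factorial : ℝ)) (z : ℝ) :
    Summable (fun n => c n * z ^ n) := by
  refine Summable.of_norm_bounded (Real.summable_pow_div_factorial |z|) (fun n => ?_)
  rw [norm_mul, norm_pow, Real.norm_eq_abs, Real.norm_eq_abs]
  calc |c n| * |z| ^ n ≤ 1 / (n.factorial : ℝ) * |z| ^ n := by gcongr; exact hc n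
    _ = _ := by ring

lemma psum_hasDerivAt (c : ℕ → ℝ) (hc : ∀ n, |c n| ≤ 1 / (n.factorial : ℝ)) (z : ℝ) :
    HasDerivAt (psum c) (psum (fun n => (n + 1) * c (n + 1)) z) z := by
  have key := hasDerivAt_tsum_of_isPreconnected (𝕜 := ℝ)
    (u := fun n : ℕ => (n : ℝ) * (1 / (n.factorial : ℝ)) * (|z| + 1) ^ (n - 1))
    (g := fun n z => c n * z ^ n)
    (g' := fun n z => c n * (n * z ^ (n - 1))) (t := Metric.ball (0:ℝ) (|z| + 1)) (y₀ := 0) (y := z)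
    ?_ Metric.isOpen_ball (convex_ball _ _).isPreconnected ?_ ?_ ?_ ?_ ?_
  · convert! key using 1
    unfold psum
    rw [Summable.tsum_eq_zero_add (f := fun n : ℕ => c n * (n * z ^ (n - 1)))]
    · simp only [Nat.cast_zero, zero_mul, mul_zero, zero_add, Nat.add_sub_cancel]
      refine tsum_congr (fun n => ?_)
      push_cast; ring
    · rw [← summable_nat_add_iff 1]
      have := psum_summable (fun n => (n + 1) * c (n + 1)) ?_ z
      · refine this.congr (fun n => ?_)
        simp only [Nat.add_sub_cancel]; push_cast; ring
      · intro n
        rw [abs_mul, abs_of_nonneg (by positivity)]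
        calc ((n:ℝ) + 1) * |c (n+1)| ≤ (n + 1) * (1 / ((n+1).factorial : ℝ)) := by gcongr; exact hc _
          _ = 1 / (n.factorial : ℝ) := by
            rw [Nat.factorial_succ]; push_cast; field_simp
  · rw [← summable_nat_add_iff 1]
    refine (Real.summable_pow_div_factorial (|z| + 1)).congr (fun n => ?_)
    simp only [Nat.add_sub_cancel]
    rw [Nat.factorial_succ]; push_cast; field_simp
  · intro n y _
    simpa using (hasDerivAt_pow n y).const_mul (c n)
  · intro n y hy
    rw [mem_ball_zero_iff] at hy
    rw [norm_mul, norm_mul, norm_pow, Real.norm_natCast, Real.norm_eq_abs]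
    calc |c n| * (n * ‖y‖ ^ (n - 1)) ≤ (1 / (n.factorial : ℝ)) * (n * (|z| + 1) ^ (n - 1)) := by
          gcongr; exact hc n
      _ = _ := by ring
  · simp; positivity
  · exact psum_summable c hc 0
  · rw [mem_ball_zero_iff]; simp

lemma deriv_coeff (c : ℕ → ℝ) (hc : ∀ n, |c n| ≤ 1 / (n.factorial : ℝ)) (n : ℕ) :
    |((n:ℝ) + 1) * c (n + 1)| ≤ 1 / (n.factorial : ℝ) := by
  rw [abs_mul, abs_of_nonneg (by positivity)]
  calc ((n:ℝ) + 1) * |c (n+1)| ≤ (n + 1) * (1 / ((n+1).factorial : ℝ)) := by gcongr; exact hc _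
    _ = 1 / (n.factorial : ℝ) := by
      rw [Nat.factorial_succ]; push_cast; field_simp

/-- coefficients of `sinh √z / √z` -/
def cS (n : ℕ) : ℝ := 1 / ((2 * n + 1).factorial : ℝ)

lemma cS_bound (n : ℕ) : |cS n| ≤ 1 / (n.factorial : ℝ) := by
  unfold cS
  rw [abs_of_nonneg (by positivity)]
  gcongr
  omega

lemma exists_S : ∃ g0 g1 g2 : ℝ → ℝ, (∀ z, HasDerivAt g0 (g1 z) z) ∧ (∀ z, HasDerivAt g1 (g2 z) z) ∧
    Continuous g2 ∧ (∀ z, 0 ≤ z → 0 ≤ g1 z) ∧ (∀ z, 0 ≤ z → 0 ≤ g2 z) ∧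
    (∀ y, y * g0 (y ^ 2) = sinh y) ∧ (∀ z, 0 ≤ z → 6 * g1 z + 4 * z * g2 z = g0 z) ∧ g0 0 = 1 := by
  set c1 : ℕ → ℝ := fun n => (n + 1) * cS (n + 1) with hc1
  set c2 : ℕ → ℝ := fun n => (n + 1) * c1 (n + 1) with hc2
  have b0 := cS_bound
  have b1 : ∀ n, |c1 n| ≤ 1 / (n.factorial : ℝ) := deriv_coeff cS b0
  have b2 : ∀ n, |c2 n| ≤ 1 / (n.factorial : ℝ) := deriv_coeff c1 b1
  have p0 : ∀ n, 0 ≤ cS n := fun n => by unfold cS; positivity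
  have p1 : ∀ n, 0 ≤ c1 n := fun n => mul_nonneg (by positivity) (p0 _)
  have p2 : ∀ n, 0 ≤ c2 n := fun n => mul_nonneg (by positivity) (p1 _)
  refine ⟨psum cS, psum c1, psum c2, psum_hasDerivAt cS b0, psum_hasDerivAt c1 b1, ?_, ?_, ?_, ?_, ?_, ?_⟩
  · exact continuous_iff_continuousAt.2 fun z => (psum_hasDerivAt c2 b2 z).continuousAt
  · intro z hz
    exact tsum_nonneg fun n => mul_nonneg (p1 n) (by positivity)
  · intro z hz
    exact tsum_nonneg fun n => mul_nonneg (p2 n) (by positivity)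
  · intro y
    rw [← (Real.hasSum_sinh y).tsum_eq]
    unfold psum
    rw [← tsum_mul_left]
    refine tsum_congr fun n => ?_
    unfold cS
    rw [pow_succ y (2 * n), pow_mul]; ring
  · intro z hz
    have s0 := psum_summable cS b0 z
    have s1 := psum_summable c1 b1 z
    have s2 := psum_summable c2 b2 z
    have e2 : z * psum c2 z = ∑' n : ℕ, (n : ℝ) * c1 n * z ^ n := by
      unfold psum
      rw [Summable.tsum_eq_zero_add (f := fun n : ℕ => (n : ℝ) * c1 n * z ^ n)]
      · simp only [Nat.cast_zero, zero_mul, zero_add]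
        rw [← tsum_mul_left]
        refine tsum_congr fun n => ?_
        simp only [hc2]; push_cast; ring
      · rw [← summable_nat_add_iff 1]
        refine (s2.mul_left z).congr fun n => ?_
        simp only [hc2]; push_cast; ring
    have s2' : Summable fun n : ℕ => (n : ℝ) * c1 n * z ^ n := by
      rw [← summable_nat_add_iff 1]
      refine (s2.mul_left z).congr fun n => ?_
      simp only [hc2]; push_cast; ring
    have : 6 * psum c1 z + 4 * z * psum c2 z = 6 * psum c1 z + 4 * (z * psum c2 z) := by ring
    rw [this, e2]
    unfold psum
    rw [← tsum_mul_left, ← tsum_mul_left, ← (s1.mul_left 6).tsum_add (s2'.mul_left 4)]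
    refine tsum_congr fun n => ?_
    simp only [hc1, cS]
    have : ((2 * (n + 1) + 1).factorial : ℝ) = (2 * n + 3) * (2 * n + 2) * ((2 * n + 1).factorial : ℝ) := by
      rw [show 2 * (n + 1) + 1 = (2 * n + 1) + 1 + 1 by ring, Nat.factorial_succ, Nat.factorial_succ]
      push_cast; ring
    rw [this]
    field_simp
    ring
  · unfold psum
    rw [tsum_eq_single 0]
    · simp [cS]
    · intro n hn; simp [hn]

lemma slope_le {f f' : ℝ → ℝ} (hf : ∀ t, 0 ≤ t → HasDerivWithinAt f (f' t) (Ici 0) t)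
    {a b D : ℝ} (ha : 0 ≤ a) (hab : a ≤ b) (hD : ∀ t, a < t → t < b → D ≤ f' t) :
    f a + D * (b - a) ≤ f b := by
  have h1 : MonotoneOn (fun t => f t - D * t) (Icc a b) := by
    refine monotoneOn_of_hasDerivWithinAt_nonneg (f' := fun t => f' t - D) (convex_Icc a b) ?_ ?_ ?_
    · intro t ht
      have := (hf t (ha.trans ht.1)).continuousWithinAt.mono
        (show Icc a b ⊆ Ici 0 from fun x hx => ha.trans hx.1)
      exact this.sub (by fun_prop)
    · intro t ht
      rw [interior_Icc] at ht
      have h2 : HasDerivWithinAt (fun t => D * t) D (interior (Icc a b)) t := by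
        simpa using ((hasDerivAt_id t).const_mul D).hasDerivWithinAt
      refine HasDerivWithinAt.sub ((hf t (ha.trans ht.1.le)).mono ?_) h2
      exact interior_subset.trans (fun x hx => ha.trans hx.1)
    · intro t ht
      rw [interior_Icc] at ht
      exact sub_nonneg.2 (hD t ht.1 ht.2)
  have := h1 (left_mem_Icc.2 hab) (right_mem_Icc.2 hab) hab
  simp only at this
  linarith

set_option maxHeartbeats 2000000 in
lemma ode_contra (k μ lam M c C1 C2 s0 : ℝ) (hk : 0 < k) (hμ : 0 < μ) (hlam : 1 < lam) (hM : 0 < M)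
    (hc : 0 < c) (hC1 : 0 < C1) (hs0 : 0 < s0) (I Y N : ℝ → ℝ)
    (hI : ∀ t, 0 ≤ t → HasDerivWithinAt I (Y t) (Ici 0) t)
    (hY : ∀ t, 0 ≤ t → HasDerivWithinAt Y (k ^ 2 * I t + N t - μ / (1 + t) ^ lam * Y t) (Ici 0) t)
    (hN0 : ∀ t, 0 ≤ t → 0 ≤ N t)
    (hN : ∀ t, 0 ≤ t → ∀ s, 0 ≤ s → s ≤ s0 → c * s * (I t - s * (C1 * (t + M) * exp (k * t))) ≤ N t)
    (hup : ∀ t, 0 ≤ t → I t ≤ C2 * (1 + t) ^ 3 * exp (k * t))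
    (hI0 : 0 < I 0) (hU0 : 0 < Y 0 + k * I 0) : False := by
  set a : ℝ → ℝ := fun t => μ / (1 + t) ^ lam with ha
  have ha0 : ∀ t, 0 ≤ t → 0 ≤ a t := fun t ht => by
    have : 0 ≤ (1 + t) ^ lam := Real.rpow_nonneg (by linarith) _
    positivity
  set B : ℝ := μ / (lam - 1) with hB
  have hBpos : 0 < B := div_pos hμ (by linarith)
  set A : ℝ → ℝ := fun t => -B * (1 + t) ^ (1 - lam) with hA
  have hAd : ∀ t, 0 ≤ t → HasDerivAt A (a t) t := by
    intro t ht
    have h1 : HasDerivAt (fun t : ℝ => 1 + t) 1 t := by simpa using (hasDerivAt_id t).const_add 1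
    have h2 := (h1.rpow_const (p := 1 - lam) (Or.inl (by linarith))).const_mul (-B)
    convert! h2 using 1
    change μ / (1 + t) ^ lam = -(μ / (lam - 1)) * (1 * (1 - lam) * (1 + t) ^ (1 - lam - 1))
    rw [show (1 - lam - 1 : ℝ) = -lam by ring, Real.rpow_neg (by linarith)]
    have : lam - 1 ≠ 0 := by linarith
    field_simp
    ring
  have hA0 : ∀ t, 0 ≤ t → A t ≤ 0 := fun t ht => by
    have : 0 ≤ (1 + t) ^ (1 - lam) := Real.rpow_nonneg (by linarith) _
    simp only [hA]; nlinarith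
  have hAB : ∀ t, 0 ≤ t → -B ≤ A t := fun t ht => by
    have : (1 + t) ^ (1 - lam) ≤ 1 := Real.rpow_le_one_of_one_le_of_nonpos (by linarith) (by linarith)
    simp only [hA]; nlinarith
  set v : ℝ → ℝ := fun t => exp (-k * t + A t) * (Y t + k * I t) with hv
  set F : ℝ → ℝ := fun t => exp (k * t) * I t with hF
  have hvd : ∀ t, 0 ≤ t → HasDerivWithinAt v (exp (-k * t + A t) * (N t + a t * k * I t)) (Ici 0) t := by
    intro t ht
    have h1 : HasDerivAt (fun t => -k * t + A t) (-k + a t) t := by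
      have h0 : HasDerivAt (fun t => -k * t) (-k) t := by
        simpa only [mul_one, id] using ((hasDerivAt_id t).const_mul (-k))
      exact h0.add (hAd t ht)
    have h2 := (h1.exp.hasDerivWithinAt (s := Ici 0)).mul ((hY t ht).add ((hI t ht).const_mul k))
    convert! h2 using 1
    simp only [Pi.add_apply, ha]
    ring
  have hFd : ∀ t, 0 ≤ t → HasDerivWithinAt F (exp (2 * k * t - A t) * v t) (Ici 0) t := by
    intro t ht
    have h1 : HasDerivAt (fun t => k * t) k t := by
      simpa using ((hasDerivAt_id t).const_mul k)
    have h2 := (h1.exp.hasDerivWithinAt (s := Ici 0)).mul (hI t ht)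
    convert! h2 using 1
    simp only [hv]
    rw [← mul_assoc, ← Real.exp_add, show 2 * k * t - A t + (-k * t + A t) = k * t by ring]
    ring
  have hv0 : 0 < v 0 := mul_pos (exp_pos _) hU0
  have hF0 : 0 < F 0 := mul_pos (exp_pos _) hI0
  -- positivity
  have hIpos : ∀ t, 0 ≤ t → 0 < I t := by
    by_contra! hcon
    obtain ⟨t1, ht1, hIt1⟩ := hcon
    have hFc : ContinuousOn F (Icc 0 t1) := fun t ht =>
      (hFd t ht.1).continuousWithinAt.mono (fun x hx => hx.1)
    have hS : IsCompact (Icc 0 t1 ∩ F ⁻¹' (Iic 0)) :=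
      isCompact_Icc.of_isClosed_subset
        (hFc.preimage_isClosed_of_isClosed isClosed_Icc isClosed_Iic) inter_subset_left
    obtain ⟨τ, hτ, hmin⟩ := hS.exists_isLeast
      ⟨t1, ⟨ht1, le_rfl⟩, mul_nonpos_of_nonneg_of_nonpos (exp_pos _).le hIt1⟩
    have hpos : ∀ t, 0 ≤ t → t < τ → 0 < I t := by
      intro t h0 hlt
      by_contra! hneg
      have : τ ≤ t := hmin ⟨⟨h0, hlt.le.trans hτ.1.2⟩, mul_nonpos_of_nonneg_of_nonpos (exp_pos _).le hneg⟩
      linarith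
    have hvp : ∀ t, 0 ≤ t → t ≤ τ → v 0 ≤ v t := by
      intro t h0 hle
      have := slope_le hvd (le_refl 0) h0 (D := 0) (fun s hs hst => by
        have h1 := hN0 s hs.le
        have h2 := ha0 s hs.le
        have h3 := hpos s hs.le (hst.trans_le hle)
        positivity)
      linarith
    have := slope_le hFd (le_refl 0) hτ.1.1 (D := 0) (fun s hs hst => by
      have := hvp s hs.le hst.le
      exact mul_nonneg (exp_pos _).le (by linarith))
    have h2 : F τ ≤ 0 := hτ.2
    linarith
  have hvmono : ∀ s t, 0 ≤ s → s ≤ t → v s ≤ v t := by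
    intro s t hs hst
    have := slope_le hvd hs hst (D := 0) (fun r hr _ => by
        have h1 := hN0 r (by linarith)
        have h2 := ha0 r (by linarith)
        have h3 := hIpos r (by linarith)
        positivity)
    linarith
  have hvpos : ∀ t, 0 ≤ t → 0 < v t := fun t ht => hv0.trans_le (hvmono 0 t le_rfl ht)
  set β := exp (-2 * k) with hβ
  have hβpos : 0 < β := exp_pos _
  -- x t = exp(-k t) I t
  set x : ℝ → ℝ := fun t => exp (-k * t) * I t with hx
  have hxv : ∀ t, 0 ≤ t → β * v t ≤ x (t + 1) := by
    intro t ht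
    have h1 := slope_le hFd ht (show t ≤ t + 1 by linarith) (D := exp (2 * k * t) * v t) (fun s hs hs1 => by
      have h2 := hvmono t s ht hs.le
      have h3 := hA0 s (by linarith)
      have h4 := hvpos t ht
      gcongr
      nlinarith)
    have h2 : 0 < F t := mul_pos (exp_pos _) (hIpos t ht)
    have h3 : exp (2 * k * t) * v t ≤ F (t + 1) := by linarith
    have h4 : x (t + 1) = exp (-2 * k * (t + 1)) * F (t + 1) := by
      simp only [hx, hF]; rw [← mul_assoc, ← Real.exp_add]; congr 2; ring
    rw [h4]
    calc β * v t = exp (-2 * k * (t + 1)) * (exp (2 * k * t) * v t) := by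
          have hE : β = exp (-2 * k * (t + 1)) * exp (2 * k * t) := by
            rw [← Real.exp_add]; simp only [hβ]; congr 1; ring
          rw [hE, mul_assoc]
      _ ≤ _ := by gcongr
  have hxup : ∀ t, 0 ≤ t → x t ≤ C2 * (1 + t) ^ 3 := by
    intro t ht
    calc x t ≤ exp (-k * t) * (C2 * (1 + t) ^ 3 * exp (k * t)) := by
          simp only [hx]; have := hup t ht; gcongr
      _ = C2 * (1 + t) ^ 3 * (exp (-k * t) * exp (k * t)) := by ring
      _ = _ := by rw [← Real.exp_add]; simp
  set cA := exp (-B) with hcA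
  have hcApos : 0 < cA := exp_pos _
  have hvder : ∀ K, 0 < K → ∀ t, 0 ≤ t → K ≤ s0 * (t + M) → C1 * K ≤ x t →
      cA * c * (K / (t + M)) * (x t - C1 * K) ≤ exp (-k * t + A t) * (N t + a t * k * I t) := by
    intro K hK t ht hKs hxK
    have htM : 0 < t + M := by linarith
    have h1 := hN t ht (K / (t + M)) (by positivity) (by rw [div_le_iff₀ htM]; exact hKs)
    have h2 := ha0 t ht
    have h3 := hIpos t ht
    have h4 : K / (t + M) * (C1 * (t + M) * exp (k * t)) = C1 * K * exp (k * t) := by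
      field_simp
    rw [h4] at h1
    have h5 : x t - C1 * K = exp (-k * t) * (I t - C1 * K * exp (k * t)) := by
      simp only [hx]
      rw [mul_sub, show exp (-k * t) * (C1 * K * exp (k * t)) = C1 * K * (exp (-k*t) * exp (k * t)) by ring,
        ← Real.exp_add]
      simp
    have h6 : 0 ≤ I t - C1 * K * exp (k * t) := by
      have : 0 ≤ exp (-k * t) * (I t - C1 * K * exp (k * t)) := by rw [← h5]; linarith
      exact nonneg_of_mul_nonneg_right this (exp_pos _)
    calc cA * c * (K / (t + M)) * (x t - C1 * K)
        = (cA * exp (-k * t)) * (c * (K / (t + M)) * (I t - C1 * K * exp (k * t))) := by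
          rw [h5]; ring
      _ ≤ exp (-k * t + A t) * (c * (K / (t + M)) * (I t - C1 * K * exp (k * t))) := by
          have : cA * exp (-k * t) ≤ exp (-k * t + A t) := by
            rw [Real.exp_add, mul_comm]; gcongr; exact Real.exp_le_exp.2 (hAB t ht)
          gcongr
      _ ≤ exp (-k * t + A t) * (N t + a t * k * I t) := by
          gcongr
          have : 0 ≤ a t * k * I t := by positivity
          linarith
  set c4 := cA * c / 6 with hc4
  have hc4pos : 0 < c4 := by positivity
  have hdouble : ∀ K, 0 < K → ∀ T, 2 ≤ T → M ≤ T → K ≤ s0 * T → C1 * K ≤ β * v T →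
      v T + c4 * K * (β * v T - C1 * K) ≤ v (2 * T) := by
    intro K hK T hT2 hTM hKT hCK
    have h1 := slope_le hvd (show 0 ≤ T + 1 by linarith) (show T + 1 ≤ 2 * T by linarith)
      (D := cA * c * (K / (2 * T + M)) * (β * v T - C1 * K)) (fun t ht ht2 => by
        have ht0 : 0 ≤ t := by linarith
        have h2 : β * v T ≤ x t := by
          have h3 := hxv (t - 1) (by linarith)
          rw [sub_add_cancel] at h3
          have := hvmono T (t - 1) (by linarith) (by linarith)
          exact le_trans (by gcongr) h3
        refine le_trans ?_ (hvder K hK t ht0 (hKT.trans (by gcongr; linarith)) (hCK.trans h2))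
        have : 0 < t + M := by linarith
        have : 0 ≤ β * v T - C1 * K := by linarith
        gcongr)
    have h2 := hvmono T (T + 1) (by linarith) (by linarith)
    have h3 : 0 ≤ β * v T - C1 * K := by linarith
    have h4 : c4 * K * (β * v T - C1 * K) ≤
        cA * c * (K / (2 * T + M)) * (β * v T - C1 * K) * (2 * T - (T + 1)) := by
      have h5 : (1:ℝ) / 6 ≤ (2 * T - (T + 1)) / (2 * T + M) := by
        rw [div_le_div_iff₀ (by norm_num) (by linarith)]; linarith
      have : c4 * K * (β * v T - C1 * K) = cA * c * K * (β * v T - C1 * K) * (1 / 6) := by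
        rw [hc4]; ring
      rw [this]
      calc _ ≤ cA * c * K * (β * v T - C1 * K) * ((2 * T - (T + 1)) / (2 * T + M)) := by gcongr
        _ = _ := by ring
    linarith
  -- phase 1
  set K1 := β * v 0 / (2 * C1) with hK1
  have hK1pos : 0 < K1 := by positivity
  have hCK1 : C1 * K1 = β * v 0 / 2 := by rw [hK1]; field_simp
  set d := c4 * K1 * (β * v 0 / 2) with hd
  have hdpos : 0 < d := by positivity
  set T1 := max (max 2 M) (K1 / s0) with hT1
  have hT12 : 2 ≤ T1 := (le_max_left _ _).trans (le_max_left _ _)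
  have hT1M : M ≤ T1 := (le_max_right _ _).trans (le_max_left _ _)
  have hT1K : K1 / s0 ≤ T1 := le_max_right _ _
  have step1 : ∀ T, T1 ≤ T → v T + d ≤ v (2 * T) := by
    intro T hT
    have hvT := hvmono 0 T le_rfl (by linarith)
    have hβv : β * v 0 ≤ β * v T := by gcongr
    have hb0 : 0 < β * v 0 := by positivity
    have := hdouble K1 hK1pos T (by linarith) (by linarith)
      (by rw [← div_le_iff₀' hs0]; linarith) (by rw [hCK1]; linarith)
    have h2 : d ≤ c4 * K1 * (β * v T - C1 * K1) := by
      rw [hd, hCK1]; gcongr; linarith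
    linarith
  have phase1 : ∀ n : ℕ, v 0 + n * d ≤ v (2 ^ n * T1) := by
    intro n
    induction n with
    | zero => simpa using hvmono 0 T1 le_rfl (by linarith)
    | succ n ih =>
      have h1 : T1 ≤ 2 ^ n * T1 := by
        have : (1:ℝ) ≤ 2 ^ n := one_le_pow₀ (by norm_num)
        exact le_mul_of_one_le_left (by linarith) this
      have := step1 _ h1
      rw [show (2:ℝ) ^ (n + 1) * T1 = 2 * (2 ^ n * T1) by ring]
      push_cast
      linarith
  set K := 30 / (c4 * β) with hK
  have hKpos : 0 < K := by positivity
  have hKe : c4 * K * β = 30 := by rw [hK]; field_simp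
  obtain ⟨n1, hn1⟩ := exists_nat_gt (2 * C1 * K / β / d)
  obtain ⟨n2, hn2⟩ := pow_unbounded_of_one_lt (K / s0) (show (1:ℝ) < 2 by norm_num)
  set T := (2:ℝ) ^ (max n1 n2) * T1 with hT
  have hTT1 : T1 ≤ T := by
    have : (1:ℝ) ≤ 2 ^ (max n1 n2) := one_le_pow₀ (by norm_num)
    exact le_mul_of_one_le_left (by linarith) this
  have hvT : 2 * C1 * K / β ≤ v T := by
    have h1 := phase1 (max n1 n2)
    have h2 : (n1 : ℝ) ≤ (max n1 n2 : ℕ) := by exact_mod_cast le_max_left _ _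
    rw [div_lt_iff₀ hdpos] at hn1
    have h3 : (n1 : ℝ) * d ≤ (max n1 n2 : ℕ) * d := by gcongr
    linarith
  have hTK : K ≤ s0 * T := by
    rw [← div_le_iff₀' hs0]
    have h1 : (2:ℝ) ^ n2 ≤ 2 ^ (max n1 n2) := pow_le_pow_right₀ (by norm_num) (le_max_right _ _)
    have h2 : (2:ℝ) ^ (max n1 n2) * 1 ≤ 2 ^ (max n1 n2) * T1 := by gcongr; linarith
    linarith
  have step2 : ∀ S, T ≤ S → 16 * v S ≤ v (2 * S) := by
    intro S hS
    have h1 : 2 * C1 * K / β ≤ v S := hvT.trans (hvmono T S (by linarith) hS)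
    rw [div_le_iff₀ hβpos] at h1
    have hS0 := hvpos S (by linarith)
    have h2 := hdouble K hKpos S (by linarith) (by linarith) (hTK.trans (by gcongr))
      (by have : 0 < C1 * K := mul_pos hC1 hKpos
          linarith)
    have h3 : c4 * K * (β * v S / 2) ≤ c4 * K * (β * v S - C1 * K) := by gcongr; linarith
    have h4 : c4 * K * (β * v S / 2) = 15 * v S := by
      have : c4 * K * (β * v S / 2) = (c4 * K * β) * (v S / 2) := by ring
      rw [this, hKe]; ring
    linarith
  have phase2 : ∀ n : ℕ, 16 ^ n * v T ≤ v (2 ^ n * T) := by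
    intro n
    induction n with
    | zero => simp
    | succ n ih =>
      have h1 : T ≤ 2 ^ n * T := by
        have : (1:ℝ) ≤ 2 ^ n := one_le_pow₀ (by norm_num)
        exact le_mul_of_one_le_left (by linarith) this
      have := step2 _ h1
      rw [show (2:ℝ) ^ (n + 1) * T = 2 * (2 ^ n * T) by ring, pow_succ]
      linarith
  have upper : ∀ n : ℕ, β * v (2 ^ n * T) ≤ |C2| * (2 * T) ^ 3 * 8 ^ n := by
    intro n
    have h1 : T ≤ 2 ^ n * T := by
      have : (1:ℝ) ≤ 2 ^ n := one_le_pow₀ (by norm_num)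
      exact le_mul_of_one_le_left (by linarith) this
    have h2 : (0:ℝ) ≤ 2 ^ n * T := by linarith
    calc β * v (2 ^ n * T) ≤ x (2 ^ n * T + 1) := hxv _ h2
      _ ≤ C2 * (1 + (2 ^ n * T + 1)) ^ 3 := hxup _ (by linarith)
      _ ≤ |C2| * (1 + (2 ^ n * T + 1)) ^ 3 := by gcongr; exact le_abs_self _
      _ ≤ |C2| * (2 * (2 ^ n * T)) ^ 3 := by gcongr; linarith
      _ = |C2| * (2 * T) ^ 3 * 8 ^ n := by
        rw [show (8:ℝ) = 2 ^ 3 by norm_num, ← pow_mul]; ring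
  have hvTpos := hvpos T (by linarith)
  obtain ⟨n, hn⟩ := pow_unbounded_of_one_lt (|C2| * (2 * T) ^ 3 / (β * v T)) (show (1:ℝ) < 2 by norm_num)
  rw [div_lt_iff₀ (by positivity)] at hn
  have h1 := phase2 n
  have h2 := upper n
  have h3 : (16:ℝ) ^ n = 2 ^ n * 8 ^ n := by rw [← mul_pow]; norm_num
  have h8 : (0:ℝ) < 8 ^ n := by positivity
  have h4 : β * (16 ^ n * v T) ≤ |C2| * (2 * T) ^ 3 * 8 ^ n := le_trans (by gcongr) h2
  rw [h3] at h4
  have h5 : (|C2| * (2 * T) ^ 3) * 8 ^ n < 2 ^ n * (β * v T) * 8 ^ n := by gcongr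
  have h6 : β * (2 ^ n * 8 ^ n * v T) = 2 ^ n * (β * v T) * 8 ^ n := by ring
  linarith

lemma energy_alg (w r a D : ℝ) (v P m : Fin 3 → ℝ) (U : Fin 3 → Fin 3 → ℝ) (hr : 0 < r) (ha : 0 ≤ a) :
    2 * w * (- ∑ i, m i) + ∑ j, 2 * (r * v j) * (-(∑ i, (m i * v j + r * v i * U i j)) - (1 + D * w) * P j - a * (r * v j))
      + 2 * ∑ j, (P j * (r * v j) + w * m j)
    ≤ 2 * ((∑ j, |D| * |P j|) + |∑ i, m i| / r + ∑ i, ∑ j, |U i j|) * (w * w + ∑ j, (r * v j) * (r * v j)) := by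
  have e : ∀ j, (r * v j) * v j = ((r * v j) * (r * v j)) / r := fun j => by field_simp
  set n : Fin 3 → ℝ := fun j => r * v j with hn
  set E := w * w + ∑ j, (r * v j) * (r * v j) with hE
  have hE0 : 0 ≤ E := by
    have : 0 ≤ ∑ j, (r * v j) * (r * v j) := Finset.sum_nonneg fun j _ => mul_self_nonneg _
    nlinarith [mul_self_nonneg w]
  have hnE : ∀ j, n j * n j + w * w ≤ E := fun j => by
    have := Finset.single_le_sum (f := fun j => (r * v j) * (r * v j)) (fun j _ => mul_self_nonneg _) (Finset.mem_univ j)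
    simp only [hn, hE]; linarith
  have h1 : ∀ j, -(D * w * P j * n j) ≤ |D| * |P j| * E := fun j => by
    have h := neg_le_abs (D * w * P j * n j)
    rw [abs_mul, abs_mul, abs_mul] at h
    have h2 : |w| * |n j| ≤ E := by
      nlinarith [hnE j, abs_mul_abs_self w, abs_mul_abs_self (n j), sq_nonneg (|w| - |n j|), mul_self_nonneg w, mul_self_nonneg (n j)]
    calc _ ≤ |D| * |P j| * (|w| * |n j|) := by linarith
      _ ≤ _ := by gcongr
  have h2 : ∀ i j, -(n i * n j * U i j) ≤ |U i j| * E := fun i j => by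
    have h := neg_le_abs (n i * n j * U i j)
    rw [abs_mul, abs_mul] at h
    have h2 : |n i| * |n j| ≤ E := by
      nlinarith [hnE j, hnE i, abs_mul_abs_self (n i), abs_mul_abs_self (n j), sq_nonneg (|n i| - |n j|), mul_self_nonneg w]
    calc _ ≤ |U i j| * (|n i| * |n j|) := by linarith
      _ ≤ _ := by gcongr
  have h3 : -((∑ j, n j * v j) * ∑ i, m i) ≤ |∑ i, m i| / r * E := by
    have : ∑ j, n j * v j = (∑ j, n j * n j) / r := by
      rw [Finset.sum_div]; exact Finset.sum_congr rfl fun j _ => e j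
    rw [this]
    have hs : 0 ≤ ∑ j, n j * n j := Finset.sum_nonneg fun j _ => mul_self_nonneg _
    have hs2 : ∑ j, n j * n j ≤ E := by simp only [hE, hn]; linarith [mul_self_nonneg w]
    calc _ = (∑ j, n j * n j) / r * (-∑ i, m i) := by ring
      _ ≤ (∑ j, n j * n j) / r * |∑ i, m i| := by
        gcongr; exact neg_le_abs _
      _ ≤ E / r * |∑ i, m i| := by gcongr
      _ = _ := by ring
  have h4 : 0 ≤ a * ∑ j, n j * n j := mul_nonneg ha (Finset.sum_nonneg fun j _ => mul_self_nonneg _)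
  have h5 : ∑ j, -(D * w * P j * n j) ≤ (∑ j, |D| * |P j|) * E := by
    rw [Finset.sum_mul]; exact Finset.sum_le_sum fun j _ => h1 j
  have h6 : ∑ i, ∑ j, -(n i * n j * U i j) ≤ (∑ i, ∑ j, |U i j|) * E := by
    rw [Finset.sum_mul]; simp_rw [Finset.sum_mul]; exact Finset.sum_le_sum fun i _ => Finset.sum_le_sum fun j _ => h2 i j
  have key : 2 * w * (- ∑ i, m i) + ∑ j, 2 * (r * v j) * (-(∑ i, (m i * v j + r * v i * U i j)) - (1 + D * w) * P j - a * (r * v j))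
      + 2 * ∑ j, (P j * (r * v j) + w * m j) = 2 * (∑ j, -(D * w * P j * n j) + (∑ i, ∑ j, -(n i * n j * U i j)) + -((∑ j, n j * v j) * ∑ i, m i) - a * ∑ j, n j * n j) := by
    simp only [hn, Fin.sum_univ_three]; ring
  rw [key]
  nlinarith

lemma hasDerivAt_dt {f : Pt → ℝ} {t : ℝ} {x : E3} (hf : DifferentiableAt ℝ f (t, x)) :
    HasDerivAt (fun s => f (s, x)) (dt f (t, x)) t := by
  have h1 : HasDerivAt (fun s : ℝ => ((s, x) : Pt)) (1, 0) t :=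
    (hasDerivAt_id t).prodMk (hasDerivAt_const t x)
  exact hf.hasFDerivAt.comp_hasDerivAt t h1

lemma dxi_slice {f : Pt → ℝ} {t : ℝ} {x : E3} (i : Fin 3) (hf : DifferentiableAt ℝ f (t, x)) :
    dxi i f (t, x) = pd i (fun y => f (t, y)) x := by
  have h1 : HasFDerivAt (fun y : E3 => ((t, y) : Pt)) (ContinuousLinearMap.inr ℝ ℝ E3) x :=
    hasFDerivAt_prodMk_right t x
  have h2 := hf.hasFDerivAt.comp x h1
  unfold dxi pd
  have h3 : fderiv ℝ (fun y => f (t, y)) x = (fderiv ℝ f (t, x)).comp (ContinuousLinearMap.inr ℝ ℝ E3) :=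
    h2.fderiv
  rw [h3]
  simp

lemma continuous_dt {f : Pt → ℝ} (hf : ContDiff ℝ 1 f) : Continuous (dt f) :=
  (hf.continuous_fderiv one_ne_zero).clm_apply continuous_const

lemma continuous_dxi {f : Pt → ℝ} (i : Fin 3) (hf : ContDiff ℝ 1 f) : Continuous (dxi i f) :=
  (hf.continuous_fderiv one_ne_zero).clm_apply continuous_const

lemma continuous_pd {f : E3 → ℝ} (i : Fin 3) (hf : ContDiff ℝ 1 f) : Continuous (pd i f) :=
  (hf.continuous_fderiv one_ne_zero).clm_apply continuous_const

lemma hasDerivAt_setIntegral {f : Pt → ℝ} (hf : ContDiff ℝ 1 f) {K : Set E3} (hK : IsCompact K) (t : ℝ) :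
    HasDerivAt (fun s => ∫ x in K, f (s, x)) (∫ x in K, dt f (t, x)) t := by
  have hc : Continuous (dt f) := continuous_dt hf
  obtain ⟨C, hC⟩ := (isCompact_Icc.prod hK).exists_bound_of_continuousOn (s := Icc (t-1) (t+1) ×ˢ K)
    hc.continuousOn
  refine (hasDerivAt_integral_of_dominated_loc_of_deriv_le (bound := fun _ => C)
    (F' := fun s x => dt f (s, x)) (Icc_mem_nhds (show t - 1 < t by linarith) (show t < t + 1 by linarith))
    ?_ ?_ ?_ ?_ ?_ ?_).2
  · refine Filter.Eventually.of_forall fun s => ?_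
    exact (hf.continuous.comp (by fun_prop : Continuous fun x : E3 => ((s, x) : Pt))).aestronglyMeasurable
  · exact (hf.continuous.comp (by fun_prop : Continuous fun x : E3 => ((t, x) : Pt))).continuousOn.integrableOn_compact hK
  · exact (hc.comp (by fun_prop : Continuous fun x : E3 => ((t, x) : Pt))).aestronglyMeasurable
  · refine (ae_restrict_iff' hK.measurableSet).2 (Filter.Eventually.of_forall fun x hx s hs => ?_)
    exact hC (s, x) ⟨hs, hx⟩
  · exact continuousOn_const.integrableOn_compact hK
  · refine Filter.Eventually.of_forall fun x s _ => ?_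
    exact hasDerivAt_dt ((hf.differentiable one_ne_zero) _)

lemma pd_zero_of_outside {f : E3 → ℝ} (i : Fin 3) {R : ℝ} (h : ∀ x, R < ‖x‖ → f x = 0) (x : E3) (hx : R < ‖x‖) :
    pd i f x = 0 := by
  unfold pd
  have : f =ᶠ[nhds x] fun _ => 0 := by
    filter_upwards [(isOpen_lt continuous_const continuous_norm).mem_nhds hx] with y hy using h y hy
  rw [this.fderiv_eq]; simp

lemma compactSupport_of {f : E3 → ℝ} {R : ℝ} (h : ∀ x, R < ‖x‖ → f x = 0) : HasCompactSupport f := by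
  refine HasCompactSupport.intro (isCompact_closedBall (0 : E3) R) fun x hx => h x ?_
  simpa using hx

lemma ibp {f g : E3 → ℝ} (hf : ContDiff ℝ 1 f) (hg : ContDiff ℝ 1 g) {R : ℝ}
    (h : ∀ x, R < ‖x‖ → f x = 0) (i : Fin 3) :
    ∫ x, pd i f x * g x = - ∫ x, f x * pd i g x := by
  have h1 : Integrable (fun x => pd i f x * g x) := by
    refine ((continuous_pd i hf).mul hg.continuous).integrable_of_hasCompactSupport
      (compactSupport_of (R := R) fun x hx => ?_)
    simp [pd_zero_of_outside i h x hx]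
  have h2 : Integrable (fun x => f x * pd i g x) := by
    refine (hf.continuous.mul (continuous_pd i hg)).integrable_of_hasCompactSupport
      (compactSupport_of (R := R) fun x hx => ?_)
    simp [h x hx]
  have h3 : Integrable (fun x => f x * g x) := by
    refine (hf.continuous.mul hg.continuous).integrable_of_hasCompactSupport
      (compactSupport_of (R := R) fun x hx => ?_)
    simp [h x hx]
  have := integral_mul_fderiv_eq_neg_fderiv_mul_of_integrable (μ := volume) (v := EuclideanSpace.single i (1:ℝ)) h1 h2 h3
    (fun x _ => hf.differentiable one_ne_zero x) (fun x _ => hg.differentiable one_ne_zero x)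
  unfold pd
  rw [this, neg_neg]

lemma pd_radial {ψ : ℝ → ℝ} {d : ℝ} (X x : E3) (j : Fin 3) (h : HasDerivAt ψ d (‖x - X‖ ^ 2)) :
    pd j (fun y => ψ (‖y - X‖ ^ 2)) x = d * (2 * (x j - X j)) := by
  have h1 := (hasStrictFDerivAt_norm_sq (x - X)).hasFDerivAt.comp x
    (show HasFDerivAt (fun y : E3 => y - X) (ContinuousLinearMap.id ℝ E3) x from (hasFDerivAt_id x).sub_const X)
  have h2 := h.comp_hasFDerivAt x h1
  unfold pd
  have h3 : fderiv ℝ (fun y => ψ (‖y - X‖ ^ 2)) x = _ := h2.fderiv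
  rw [h3]
  simp [EuclideanSpace.inner_single_right]

structure Sol (A γ μ lam ρb M : ℝ) (ρ : Pt → ℝ) (u : Pt → Fin 3 → ℝ) : Prop where
  hA : 0 < A
  hγ : 1 < γ
  hμ : 0 < μ
  hρb : 0 < ρb
  hM : 0 < M
  hs : A * γ * ρb ^ (γ - 1) = 1
  cρ : ContDiff ℝ 1 ρ
  cu : ∀ i, ContDiff ℝ 1 (fun q => u q i)
  ini : ∀ x : E3, M < ‖x‖ → ρ (0, x) = ρb ∧ ∀ i, u (0, x) i = 0
  pde : ∀ q : Pt, 0 ≤ q.1 → eulerDamped A γ μ lam ρ u q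
  pos : ∀ q : Pt, 0 ≤ q.1 → 0 < ρ q

lemma dt_mul {f g : Pt → ℝ} (hf : ContDiff ℝ 1 f) (hg : ContDiff ℝ 1 g) (q : Pt) :
    dt (fun z => f z * g z) q = dt f q * g q + f q * dt g q := by
  unfold dt
  rw [fderiv_fun_mul (hf.differentiable one_ne_zero q) (hg.differentiable one_ne_zero q)]
  simp; ring

lemma dxi_mul' {f g : Pt → ℝ} (i : Fin 3) {q : Pt} (hf : DifferentiableAt ℝ f q) (hg : DifferentiableAt ℝ g q) :
    dxi i (fun z => f z * g z) q = dxi i f q * g q + f q * dxi i g q := by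
  unfold dxi
  rw [fderiv_fun_mul hf hg]
  simp; ring

lemma dxi_mul {f g : Pt → ℝ} (i : Fin 3) (hf : ContDiff ℝ 1 f) (hg : ContDiff ℝ 1 g) (q : Pt) :
    dxi i (fun z => f z * g z) q = dxi i f q * g q + f q * dxi i g q :=
  dxi_mul' i (hf.differentiable one_ne_zero q) (hg.differentiable one_ne_zero q)

lemma dxi_sub_const {f : Pt → ℝ} (i : Fin 3) (c : ℝ) (q : Pt) :
    dxi i (fun z => f z - c) q = dxi i f q := by
  unfold dxi
  rw [fderiv_sub_const]

lemma dt_sub_const {f : Pt → ℝ} (c : ℝ) (q : Pt) :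
    dt (fun z => f z - c) q = dt f q := by
  unfold dt
  rw [fderiv_sub_const]

lemma dxi_press {A γ : ℝ} {ρ : Pt → ℝ} (i : Fin 3) (hρ : ContDiff ℝ 1 ρ) (q : Pt) (h : 0 < ρ q) :
    dxi i (fun z => A * ρ z ^ γ) q = A * γ * ρ q ^ (γ - 1) * dxi i ρ q := by
  have h1 : HasFDerivAt (fun z => A * ρ z ^ γ) _ q :=
    (((hρ.differentiable one_ne_zero q).hasFDerivAt).rpow_const (p := γ) (Or.inl h.ne')).const_mul A
  unfold dxi
  rw [h1.fderiv]
  simp; ring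

lemma diff_press {A γ : ℝ} {ρ : Pt → ℝ} (hρ : ContDiff ℝ 1 ρ) (q : Pt) (h : 0 < ρ q) :
    DifferentiableAt ℝ (fun z => A * ρ z ^ γ) q :=
    ((((hρ.differentiable one_ne_zero q).hasFDerivAt).rpow_const (p := γ) (Or.inl h.ne')).const_mul A).differentiableAt

namespace Sol
variable {A γ μ lam ρb M : ℝ} {ρ : Pt → ℝ} {u : Pt → Fin 3 → ℝ}

lemma cm (S : Sol A γ μ lam ρb M ρ u) (i : Fin 3) : ContDiff ℝ 1 (fun q => ρ q * u q i) :=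
  S.cρ.mul (S.cu i)

lemma mom (S : Sol A γ μ lam ρb M ρ u) (q : Pt) (hq : 0 ≤ q.1) (j : Fin 3) :
    dt (fun z => ρ z * u z j) q = - (∑ i, (dxi i (fun z => ρ z * u z i) q * u q j + ρ q * u q i * dxi i (fun z => u z j) q))
      - A * γ * ρ q ^ (γ - 1) * dxi j ρ q - (μ / (1 + q.1) ^ lam) * (ρ q * u q j) := by
  have h := (S.pde q hq).2 j
  have h2 : ∀ i, dxi i (fun z => ρ z * u z i * u z j + (if i = j then A * ρ z ^ γ else 0)) q
      = (dxi i (fun z => ρ z * u z i) q * u q j + ρ q * u q i * dxi i (fun z => u z j) q)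
        + (if i = j then A * γ * ρ q ^ (γ - 1) * dxi j ρ q else 0) := by
    intro i
    have h3 := dxi_mul i (S.cm i) (S.cu j) q
    by_cases hij : i = j
    · simp only [hij, if_true]
      subst hij
      rw [← dxi_press i S.cρ q (S.pos q hq), ← h3]
      unfold dxi
      rw [fderiv_fun_add (((S.cm i).mul (S.cu i)).differentiable one_ne_zero q) (diff_press S.cρ q (S.pos q hq))]
      simp
    · simp only [hij, if_false, add_zero]
      exact h3
  simp only [h2, Finset.sum_add_distrib, Finset.sum_ite_eq', Finset.mem_univ, if_true] at h
  simp only [Finset.sum_add_distrib]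
  linarith

/-- energy bound coefficient -/
def Bc (A γ ρb : ℝ) (ρ : Pt → ℝ) (u : Pt → Fin 3 → ℝ) (q : Pt) : ℝ :=
  (∑ j, |dslope (fun r : ℝ => A * γ * r ^ (γ - 1)) ρb (ρ q)| * |dxi j ρ q|)
    + |∑ i, dxi i (fun z => ρ z * u z i) q| / ρ q + ∑ i, ∑ j, |dxi i (fun z => u z j) q|

def en (ρb : ℝ) (ρ : Pt → ℝ) (u : Pt → Fin 3 → ℝ) (q : Pt) : ℝ :=
  (ρ q - ρb) * (ρ q - ρb) + ∑ j, (ρ q * u q j) * (ρ q * u q j)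

lemma cen (S : Sol A γ μ lam ρb M ρ u) : ContDiff ℝ 1 (en ρb ρ u) := by
  unfold en
  refine ((S.cρ.sub contDiff_const).mul (S.cρ.sub contDiff_const)).add (ContDiff.sum fun j _ => (S.cm j).mul (S.cm j))

lemma dt_en (S : Sol A γ μ lam ρb M ρ u) (q : Pt) :
    dt (en ρb ρ u) q = 2 * (ρ q - ρb) * dt ρ q + ∑ j, 2 * (ρ q * u q j) * dt (fun z => ρ z * u z j) q := by
  have h0 : ContDiff ℝ 1 (fun z => ρ z - ρb) := S.cρ.sub contDiff_const
  have h1 := dt_mul h0 h0 q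
  rw [dt_sub_const] at h1
  have h2 := fun j => dt_mul (S.cm j) (S.cm j) q
  unfold en
  unfold dt at *
  rw [fderiv_fun_add ((h0.mul h0).differentiable one_ne_zero q)
    ((ContDiff.sum fun j _ => (S.cm j).mul (S.cm j)).differentiable one_ne_zero q),
    fderiv_fun_sum (fun j _ => ((S.cm j).mul (S.cm j)).differentiable one_ne_zero q)]
  simp only [add_apply, sum_apply]
  rw [h1]
  simp only [h2]
  congr 1
  · ring
  · exact Finset.sum_congr rfl fun j _ => by ring

lemma energy (S : Sol A γ μ lam ρb M ρ u) (q : Pt) (hq : 0 ≤ q.1) :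
    dt (en ρb ρ u) q + 2 * ∑ j, dxi j (fun z => (ρ z - ρb) * (ρ z * u z j)) q ≤ 2 * Bc A γ ρb ρ u q * en ρb ρ u q := by
  have hr := S.pos q hq
  have h0 : ContDiff ℝ 1 (fun z => ρ z - ρb) := S.cρ.sub contDiff_const
  have hD : A * γ * ρ q ^ (γ - 1) - 1 = dslope (fun r : ℝ => A * γ * r ^ (γ - 1)) ρb (ρ q) * (ρ q - ρb) := by
    have := sub_smul_dslope (fun r : ℝ => A * γ * r ^ (γ - 1)) ρb (ρ q)
    rw [S.hs] at this
    rw [← this]; simp [mul_comm]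
  have ha : 0 ≤ μ / (1 + q.1) ^ lam := by have := S.hμ; positivity
  have hc : dt ρ q = - ∑ i, dxi i (fun z => ρ z * u z i) q := by
    have := (S.pde q hq).1; linarith
  rw [S.dt_en]
  simp only [dxi_mul _ h0 (S.cm _), dxi_sub_const, S.mom q hq, hc]
  unfold Bc en
  set D := dslope (fun r : ℝ => A * γ * r ^ (γ - 1)) ρb (ρ q)
  have hD' : A * γ * ρ q ^ (γ - 1) = 1 + D * (ρ q - ρb) := by linarith
  rw [hD']
  set a := μ / (1 + q.1) ^ lam
  set w := ρ q - ρb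
  set r := ρ q
  exact energy_alg w r a D (fun j => u q j) (fun j => dxi j ρ q) (fun i => dxi i (fun z => ρ z * u z i) q)
    (fun i j => dxi i (fun z => u z j) q) hr ha
end Sol

lemma deriv_eg_nonneg (z : ℝ) : 0 ≤ deriv expNegInvGlue z := expNegInvGlue.monotone.deriv_nonneg

lemma deriv_eg_zero (z : ℝ) (hz : z < 0) : deriv expNegInvGlue z = 0 := by
  have : expNegInvGlue =ᶠ[nhds z] fun _ => 0 := by
    filter_upwards [Iio_mem_nhds hz] with y hy using expNegInvGlue.zero_of_nonpos (le_of_lt hy)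
  rw [this.deriv_eq]; simp

lemma hasDeriv_eg (z : ℝ) : HasDerivAt expNegInvGlue (deriv expNegInvGlue z) z :=
  ((expNegInvGlue.contDiff (n := 1)).differentiable one_ne_zero z).hasDerivAt

/-- cutoff -/
def cut (T : ℝ) (X : E3) (q : Pt) : ℝ := expNegInvGlue ((T - q.1) ^ 2 - ‖q.2 - X‖ ^ 2)

lemma cut_contDiff (T : ℝ) (X : E3) : ContDiff ℝ 1 (cut T X) := by
  unfold cut
  refine expNegInvGlue.contDiff.comp (ContDiff.sub ?_ ?_)
  · fun_prop
  · exact (contDiff_snd.sub contDiff_const).norm_sq ℝ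

lemma cut_dt (T : ℝ) (X : E3) (t : ℝ) (x : E3) :
    dt (cut T X) (t, x) = deriv expNegInvGlue ((T - t) ^ 2 - ‖x - X‖ ^ 2) * (-(2 * (T - t))) := by
  have h1 := hasDerivAt_dt ((cut_contDiff T X).differentiable one_ne_zero (t, x))
  have h2 : HasDerivAt (fun s : ℝ => (T - s) ^ 2 - ‖x - X‖ ^ 2) (-(2 * (T - t))) t := by
    have := (((hasDerivAt_id t).const_sub T).pow 2).sub_const (‖x - X‖ ^ 2)
    convert! this using 1
    simp
  have h3 := (hasDeriv_eg ((T - t) ^ 2 - ‖x - X‖ ^ 2)).comp t h2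
  exact h1.unique h3

lemma cut_pd (T : ℝ) (X : E3) (t : ℝ) (x : E3) (j : Fin 3) :
    pd j (fun y => cut T X (t, y)) x = deriv expNegInvGlue ((T - t) ^ 2 - ‖x - X‖ ^ 2) * (-(2 * (x j - X j))) := by
  have h2 : HasDerivAt (fun s : ℝ => (T - t) ^ 2 - s) (-1) (‖x - X‖ ^ 2) := (hasDerivAt_id _).const_sub _
  have h3 := (hasDeriv_eg ((T - t) ^ 2 - ‖x - X‖ ^ 2)).comp (‖x - X‖ ^ 2) h2
  have := pd_radial X x j h3
  rw [show (fun y => cut T X (t, y)) = (fun y => (expNegInvGlue ∘ fun s : ℝ => (T - t) ^ 2 - s) (‖y - X‖ ^ 2)) from rfl, this]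
  ring

lemma cut_zero {T t : ℝ} {X x : E3} (ht : 0 ≤ t) (htT : t ≤ T) (hx : T < ‖x - X‖) : cut T X (t, x) = 0 := by
  unfold cut
  refine expNegInvGlue.zero_of_nonpos ?_
  simp only
  nlinarith

/-- flux bound -/
lemma cut_flux {T t w : ℝ} {X x : E3} (htT : t ≤ T) (n : Fin 3 → ℝ) :
    2 * ∑ j, w * n j * pd j (fun y => cut T X (t, y)) x + (w * w + ∑ j, n j * n j) * dt (cut T X) (t, x) ≤ 0 := by
  simp only [cut_dt, cut_pd]
  set d := deriv expNegInvGlue ((T - t) ^ 2 - ‖x - X‖ ^ 2) with hd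
  by_cases hz : (T - t) ^ 2 - ‖x - X‖ ^ 2 < 0
  · rw [hd, deriv_eg_zero _ hz]; simp
  · push Not at hz
    have hd0 : 0 ≤ d := deriv_eg_nonneg _
    have hn : ‖x - X‖ ^ 2 = ∑ j, (x j - X j) ^ 2 := by
      rw [EuclideanSpace.norm_sq_eq]; simp
    set s := T - t with hs
    have hs0 : 0 ≤ s := by linarith
    have hcs : (∑ j, n j * (x j - X j)) ^ 2 ≤ (∑ j, n j ^ 2) * ∑ j, (x j - X j) ^ 2 :=
      Finset.sum_mul_sq_le_sq_mul_sq _ _ _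
    rw [← hn] at hcs
    set Q := ∑ j, n j * (x j - X j) with hQ
    set P := ∑ j, n j ^ 2 with hP
    have hP0 : 0 ≤ P := Finset.sum_nonneg fun j _ => sq_nonneg _
    have hPP : ∑ j, n j * n j = P := Finset.sum_congr rfl fun j _ => by ring
    have key : -(2 * w * Q) ≤ (w * w + P) * s := by
      have h0 : (2 * w * Q) ^ 2 ≤ ((w * w + P) * s) ^ 2 := by
        have : w ^ 2 * Q ^ 2 ≤ w ^ 2 * (P * s ^ 2) := by
          gcongr
          exact hcs.trans (mul_le_mul_of_nonneg_left (by linarith) hP0)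
        nlinarith [mul_nonneg (sq_nonneg (w ^ 2 - P)) (sq_nonneg s)]
      have h1 := abs_le_of_sq_le_sq h0 (mul_nonneg (by nlinarith) hs0)
      exact (neg_le_abs _).trans h1
    have e1 : ∑ j, w * n j * (d * (-(2 * (x j - X j)))) = -(2 * d * w * Q) := by
      rw [hQ, Finset.mul_sum, ← Finset.sum_neg_distrib]; exact Finset.sum_congr rfl fun j _ => by ring
    rw [e1, hPP]
    nlinarith

lemma gronwall0 {E E' : ℝ → ℝ} {T C : ℝ} (hE : ∀ t, HasDerivAt E (E' t) t)
    (h : ∀ t, 0 ≤ t → t ≤ T → E' t ≤ C * E t) (h0 : E 0 = 0) (t : ℝ) (ht : 0 ≤ t) (htT : t ≤ T) : E t ≤ 0 := by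
  have hd : ∀ s, HasDerivAt (fun s => Real.exp (-C * s) * E s)
      (Real.exp (-C * s) * (-C * 1) * E s + Real.exp (-C * s) * E' s) s := fun s =>
    (((hasDerivAt_id s).const_mul (-C)).exp).mul (hE s)
  have hanti : AntitoneOn (fun s => Real.exp (-C * s) * E s) (Icc 0 T) := by
    refine antitoneOn_of_deriv_nonpos (convex_Icc 0 T) (fun s _ => (hd s).continuousAt.continuousWithinAt)
      (fun s _ => (hd s).differentiableAt.differentiableWithinAt) fun s hs => ?_
    rw [interior_Icc] at hs
    rw [(hd s).deriv]
    have := h s hs.1.le hs.2.le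
    have h3 := Real.exp_pos (-C * s)
    nlinarith
  have := hanti (⟨le_rfl, ht.trans htT⟩ : (0:ℝ) ∈ Icc 0 T) ⟨ht, htT⟩ ht
  simp only [h0, mul_zero] at this
  by_contra hc
  push Not at hc
  have := mul_pos (Real.exp_pos (-C * t)) hc
  linarith

namespace Sol
variable {A γ μ lam ρb M : ℝ} {ρ : Pt → ℝ} {u : Pt → Fin 3 → ℝ}

lemma Bc_cont (S : Sol A γ μ lam ρb M ρ u) : ContinuousOn (Bc A γ ρb ρ u) {q : Pt | 0 ≤ q.1} := by
  have h1 : ContinuousOn (dslope (fun r : ℝ => A * γ * r ^ (γ - 1)) ρb) (Ioi 0) := by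
    rw [continuousOn_dslope (Ioi_mem_nhds S.hρb)]
    constructor
    · intro r hr
      exact (continuousAt_const.mul (Real.continuousAt_rpow_const _ _ (Or.inl (ne_of_gt hr)))).continuousWithinAt
    · exact ((Real.hasDerivAt_rpow_const (Or.inl S.hρb.ne')).differentiableAt).const_mul _
  have h2 : ContinuousOn (fun q => dslope (fun r : ℝ => A * γ * r ^ (γ - 1)) ρb (ρ q)) {q : Pt | 0 ≤ q.1} :=
    h1.comp S.cρ.continuous.continuousOn fun q hq => S.pos q hq
  unfold Bc
  refine ContinuousOn.add (ContinuousOn.add ?_ ?_) ?_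
  · exact continuousOn_finsetSum _ fun j _ => h2.abs.mul (continuous_dxi j S.cρ).abs.continuousOn
  · refine ContinuousOn.div ?_ S.cρ.continuous.continuousOn fun q hq => (S.pos q hq).ne'
    exact (continuous_finsetSum _ fun j _ => continuous_dxi j (S.cm j)).abs.continuousOn
  · exact (continuous_finsetSum _ fun i _ => continuous_finsetSum _ fun j _ => (continuous_dxi i (S.cu j)).abs).continuousOn

lemma en_nonneg (q : Pt) : 0 ≤ en ρb ρ u q :=
  add_nonneg (mul_self_nonneg _) (Finset.sum_nonneg fun _ _ => mul_self_nonneg _)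

lemma slice_contDiff {f : Pt → ℝ} (hf : ContDiff ℝ 1 f) (t : ℝ) : ContDiff ℝ 1 (fun y => f (t, y)) :=
  hf.comp (contDiff_const.prodMk contDiff_id)

lemma fp_aux (S : Sol A γ μ lam ρb M ρ u) (T : ℝ) (X : E3) (hT : 0 < T) (hX : M + T < ‖X‖) (t : ℝ) (ht : 0 ≤ t) (htT : t < T) :
    en ρb ρ u (t, X) = 0 := by
  have hec := S.cen
  have hcc := cut_contDiff T X
  have hK : IsCompact (Metric.closedBall X T) := isCompact_closedBall X T
  have hKn : ∀ x, x ∉ Metric.closedBall X T → T < ‖x - X‖ := fun x hx => by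
    simpa [dist_eq_norm] using hx
  obtain ⟨C, hC⟩ := (isCompact_Icc.prod hK).exists_bound_of_continuousOn (s := Icc 0 T ×ˢ (Metric.closedBall X T))
    (S.Bc_cont.mono (fun q hq => hq.1.1))
  have hE : ∀ t, HasDerivAt (fun s => ∫ x in Metric.closedBall X T, en ρb ρ u (s, x) * cut T X (s, x)) _ t :=
    fun t => hasDerivAt_setIntegral (hec.mul hcc) hK t
  have hfull : ∀ s, 0 ≤ s → s ≤ T → ∫ x in Metric.closedBall X T, en ρb ρ u (s, x) * cut T X (s, x)
      = ∫ x, en ρb ρ u (s, x) * cut T X (s, x) := fun s hs hsT =>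
    setIntegral_eq_integral_of_forall_compl_eq_zero fun x hx => by simp [cut_zero hs hsT (hKn x hx)]
  have hle := gronwall0 (T := T) (C := 2 * C) hE ?_ ?_ t ht htT.le
  · rw [hfull t ht htT.le] at hle
    by_contra hne
    have hpos : 0 < ∫ x, en ρb ρ u (t, x) * cut T X (t, x) := by
      refine Continuous.integral_pos_of_hasCompactSupport_nonneg_nonzero (x := X) ?_ ?_ ?_ ?_
      · exact (slice_contDiff (hec.mul hcc) t).continuous
      · refine compactSupport_of (R := ‖X‖ + T) fun x hx => ?_
        have : T < ‖x - X‖ := by linarith [norm_sub_norm_le x X]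
        simp [cut_zero ht htT.le this]
      · exact fun x => mul_nonneg (en_nonneg _) (expNegInvGlue.nonneg _)
      · refine mul_ne_zero hne (expNegInvGlue.pos_of_pos ?_).ne'
        simp; nlinarith
    linarith
  · intro t ht htT
    have hint : ∀ {f : Pt → ℝ}, Continuous f → IntegrableOn (fun x => f (t, x)) (Metric.closedBall X T) := fun hf =>
      (hf.comp (by fun_prop : Continuous fun x : E3 => ((t, x) : Pt))).continuousOn.integrableOn_compact hK
    have hcw : ContDiff ℝ 1 (fun z => ρ z - ρb) := S.cρ.sub contDiff_const
    have hwm : ∀ j, ContDiff ℝ 1 (fun z => (ρ z - ρb) * (ρ z * u z j)) := fun j => hcw.mul (S.cm j)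
    -- ibp
    have hibp : ∀ j, ∫ x in Metric.closedBall X T, dxi j (fun z => (ρ z - ρb) * (ρ z * u z j)) (t, x) * cut T X (t, x)
        = - ∫ x in Metric.closedBall X T, (ρ (t, x) - ρb) * (ρ (t, x) * u (t, x) j) * pd j (fun y => cut T X (t, y)) x := by
      intro j
      have h1 := ibp (slice_contDiff hcc t) (slice_contDiff (hwm j) t) (R := ‖X‖ + T) (fun x hx => by
        have : T < ‖x - X‖ := by linarith [norm_sub_norm_le x X]
        simp [cut_zero ht htT this]) j
      rw [setIntegral_eq_integral_of_forall_compl_eq_zero fun x hx => by simp [cut_zero ht htT (hKn x hx)],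
        setIntegral_eq_integral_of_forall_compl_eq_zero fun x hx => ?_]
      · have e1 : (fun x => dxi j (fun z => (ρ z - ρb) * (ρ z * u z j)) (t, x) * cut T X (t, x))
            = fun x => cut T X (t, x) * pd j (fun y => (ρ (t, y) - ρb) * (ρ (t, y) * u (t, y) j)) x := by
          funext x
          rw [dxi_slice j ((hwm j).differentiable one_ne_zero _), mul_comm]
        have e2 : (fun x => (ρ (t, x) - ρb) * (ρ (t, x) * u (t, x) j) * pd j (fun y => cut T X (t, y)) x)
            = fun x => pd j (fun y => cut T X (t, y)) x * ((ρ (t, x) - ρb) * (ρ (t, x) * u (t, x) j)) := by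
          funext x
          rw [mul_comm]
        rw [e1, e2, h1, neg_neg]
      · have hx' := hKn x hx
        have : (T - t) ^ 2 - ‖x - X‖ ^ 2 < 0 := by nlinarith
        rw [cut_pd, deriv_eg_zero _ this]; simp
    have hpdc : ∀ j, Continuous (fun x => pd j (fun y => cut T X (t, y)) x) := fun j => continuous_pd j (slice_contDiff hcc t)
    have hbd : ∀ x ∈ Metric.closedBall X T, dt (fun z => en ρb ρ u z * cut T X z) (t, x)
        ≤ 2 * C * (en ρb ρ u (t, x) * cut T X (t, x))
          - 2 * ∑ j, (dxi j (fun z => (ρ z - ρb) * (ρ z * u z j)) (t, x) * cut T X (t, x)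
            + (ρ (t, x) - ρb) * (ρ (t, x) * u (t, x) j) * pd j (fun y => cut T X (t, y)) x) := by
      intro x hx
      rw [dt_mul hec hcc]
      have h1 := S.energy (t, x) ht
      have h2 := cut_flux (X := X) (x := x) (w := ρ (t, x) - ρb) htT (fun j => ρ (t, x) * u (t, x) j)
      have h3 : Bc A γ ρb ρ u (t, x) ≤ C := (le_abs_self _).trans (hC (t, x) ⟨⟨ht, htT⟩, hx⟩)
      have h4 : 0 ≤ cut T X (t, x) := expNegInvGlue.nonneg _
      have h5 : 0 ≤ en ρb ρ u (t, x) := en_nonneg _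
      rw [Finset.sum_add_distrib, ← Finset.sum_mul]
      have h6 : Bc A γ ρb ρ u (t, x) * en ρb ρ u (t, x) ≤ C * en ρb ρ u (t, x) := by gcongr
      have h7 := mul_le_mul_of_nonneg_right h1 h4
      have h8 := mul_le_mul_of_nonneg_right h6 h4
      have h9 : en ρb ρ u (t, x) = (ρ (t, x) - ρb) * (ρ (t, x) - ρb) + ∑ j, (ρ (t, x) * u (t, x) j) * (ρ (t, x) * u (t, x) j) := rfl
      rw [← h9] at h2
      nlinarith
    have i1 : ∀ j, IntegrableOn (fun x => dxi j (fun z => (ρ z - ρb) * (ρ z * u z j)) (t, x) * cut T X (t, x)) (Metric.closedBall X T) :=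
      fun j => hint ((continuous_dxi j (hwm j)).mul hcc.continuous)
    have i2 : ∀ j, IntegrableOn (fun x => (ρ (t, x) - ρb) * (ρ (t, x) * u (t, x) j) * pd j (fun y => cut T X (t, y)) x) (Metric.closedBall X T) :=
      fun j => ((slice_contDiff (hwm j) t).continuous.mul (hpdc j)).continuousOn.integrableOn_compact hK
    have i3 : IntegrableOn (fun x => 2 * C * (en ρb ρ u (t, x) * cut T X (t, x))) (Metric.closedBall X T) :=
      (hint (hec.continuous.mul hcc.continuous)).const_mul _
    have i5 : ∀ j, IntegrableOn (fun x => dxi j (fun z => (ρ z - ρb) * (ρ z * u z j)) (t, x) * cut T X (t, x)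
            + (ρ (t, x) - ρb) * (ρ (t, x) * u (t, x) j) * pd j (fun y => cut T X (t, y)) x) (Metric.closedBall X T) :=
      fun j => (i1 j).add (i2 j)
    have i4 : IntegrableOn (fun x => 2 * ∑ j, (dxi j (fun z => (ρ z - ρb) * (ρ z * u z j)) (t, x) * cut T X (t, x)
            + (ρ (t, x) - ρb) * (ρ (t, x) * u (t, x) j) * pd j (fun y => cut T X (t, y)) x)) (Metric.closedBall X T) :=
      (integrable_finsetSum _ fun j _ => (i1 j).add (i2 j)).const_mul 2
    have hm := setIntegral_mono_on (hint (continuous_dt (hec.mul hcc))) (i3.sub i4) hK.measurableSet hbd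
    refine hm.trans (le_of_eq ?_)
    simp only [Pi.sub_apply]
    rw [integral_sub i3 i4, integral_const_mul, integral_const_mul, integral_finsetSum _ fun j _ => i5 j]
    have : ∀ j, ∫ x in Metric.closedBall X T, (dxi j (fun z => (ρ z - ρb) * (ρ z * u z j)) (t, x) * cut T X (t, x)
            + (ρ (t, x) - ρb) * (ρ (t, x) * u (t, x) j) * pd j (fun y => cut T X (t, y)) x) = 0 := fun j => by
      rw [integral_add (i1 j) (i2 j), hibp j]; ring
    simp [this]
  · refine setIntegral_eq_zero_of_forall_eq_zero fun x hx => ?_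
    have hx' : ‖x - X‖ ≤ T := by simpa [dist_eq_norm] using hx
    have : M < ‖x‖ := by linarith [norm_sub_norm_le X x, norm_sub_rev x X]
    have := S.ini x this
    simp [en, this.1, this.2]

lemma fp (S : Sol A γ μ lam ρb M ρ u) (t : ℝ) (ht : 0 ≤ t) (x : E3) (hx : M + t < ‖x‖) :
    ρ (t, x) = ρb ∧ ∀ i, u (t, x) i = 0 := by
  have h := S.fp_aux ((t + (‖x‖ - M)) / 2) x (by linarith [S.hM]) (by linarith) t ht (by linarith)
  have hs : 0 ≤ ∑ j, (ρ (t, x) * u (t, x) j) * (ρ (t, x) * u (t, x) j) := Finset.sum_nonneg fun _ _ => mul_self_nonneg _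
  unfold en at h
  have h1 := mul_self_nonneg (ρ (t, x) - ρb)
  have h2 : (ρ (t, x) - ρb) * (ρ (t, x) - ρb) = 0 := by linarith
  have h3 : ∑ j, (ρ (t, x) * u (t, x) j) * (ρ (t, x) * u (t, x) j) = 0 := by linarith
  refine ⟨by linarith [mul_self_eq_zero.1 h2], fun i => ?_⟩
  have h4 := (Finset.sum_eq_zero_iff_of_nonneg fun _ _ => mul_self_nonneg _).1 h3 i (Finset.mem_univ i)
  have h5 := mul_self_eq_zero.1 h4
  exact (mul_eq_zero.1 h5).resolve_left (S.pos (t, x) ht).ne'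

end Sol

lemma pd_radial0 {ψ : ℝ → ℝ} {d : ℝ} (x : E3) (j : Fin 3) (h : HasDerivAt ψ d (‖x‖ ^ 2)) :
    pd j (fun y => ψ (‖y‖ ^ 2)) x = d * (2 * x j) := by
  have := pd_radial (ψ := ψ) (d := d) 0 x j (by simpa using h)
  simpa using this

lemma pd_mul {f g : E3 → ℝ} (i : Fin 3) (hf : ContDiff ℝ 1 f) (hg : ContDiff ℝ 1 g) (q : E3) :
    pd i (fun z => f z * g z) q = pd i f q * g q + f q * pd i g q := by
  unfold pd
  rw [fderiv_fun_mul (hf.differentiable one_ne_zero q) (hg.differentiable one_ne_zero q)]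
  simp; ring

lemma pd_coord (i j : Fin 3) (x : E3) : pd i (fun y : E3 => y j) x = if i = j then 1 else 0 := by
  unfold pd
  have h : HasFDerivAt (fun y : E3 => y j) (EuclideanSpace.proj j : E3 →L[ℝ] ℝ) x :=
    (EuclideanSpace.proj j : E3 →L[ℝ] ℝ).hasFDerivAt
  rw [h.fderiv]
  simp [eq_comm]

lemma contDiff_coord (j : Fin 3) : ContDiff ℝ 1 (fun y : E3 => y j) :=
  (EuclideanSpace.proj j : E3 →L[ℝ] ℝ).contDiff

lemma contDiff_one_of {g g' : ℝ → ℝ} (h : ∀ z, HasDerivAt g (g' z) z) (hc : Continuous g') : ContDiff ℝ 1 g := by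
  rw [contDiff_one_iff_deriv]
  refine ⟨fun z => (h z).differentiableAt, ?_⟩
  have : deriv g = g' := funext fun z => (h z).deriv
  rwa [this]

structure TestFn (k : ℝ) (φ : E3 → ℝ) : Prop where
  c1 : ContDiff ℝ 1 φ
  c2 : ∀ j, ContDiff ℝ 1 (pd j φ)
  hess : ∀ x (v : Fin 3 → ℝ), 0 ≤ ∑ j, ∑ i, v i * v j * pd i (pd j φ) x
  lap : ∀ x, ∑ i, pd i (pd i φ) x = k ^ 2 * φ x
  one_le : ∀ x, 1 ≤ φ x
  val : ∀ x, k * ‖x‖ * φ x = sinh (k * ‖x‖)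
  mono : ∀ x y : E3, ‖x‖ ≤ ‖y‖ → φ x ≤ φ y
  grad : ∀ j, ∀ x : E3, x ≠ 0 → pd j φ x = x j * (cosh (k * ‖x‖) / ‖x‖ ^ 2 - sinh (k * ‖x‖) / (k * ‖x‖ ^ 3))

lemma exists_testFn (k : ℝ) (hk : 0 < k) : ∃ φ : E3 → ℝ, TestFn k φ := by
  obtain ⟨g0, g1, g2, h0, h1, c2, p1, p2, hS, hL, hz⟩ := exists_S
  have c1 : Continuous g1 := continuous_iff_continuousAt.2 fun z => (h1 z).continuousAt
  have cd0 : ContDiff ℝ 1 g0 := contDiff_one_of h0 c1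
  have cd1 : ContDiff ℝ 1 g1 := contDiff_one_of h1 c2
  have dk : ∀ {g g' : ℝ → ℝ}, (∀ z, HasDerivAt g (g' z) z) → ∀ z, HasDerivAt (fun z => g (k ^ 2 * z)) (g' (k ^ 2 * z) * k ^ 2) z := by
    intro g g' h z
    have := (h (k ^ 2 * z)).comp z (hasDerivAt_const_mul (k ^ 2))
    exact this
  have cn : ContDiff ℝ 1 (fun x : E3 => k ^ 2 * ‖x‖ ^ 2) := contDiff_const.mul (contDiff_id.norm_sq ℝ)
  have m0 : MonotoneOn g0 (Ici 0) := by
    refine monotoneOn_of_deriv_nonneg (convex_Ici 0) (fun z _ => (h0 z).continuousAt.continuousWithinAt)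
      (fun z _ => (h0 z).differentiableAt.differentiableWithinAt) fun z hz => ?_
    rw [interior_Ici] at hz
    rw [(h0 z).deriv]; exact p1 z (le_of_lt hz)
  have hp : ∀ j, pd j (fun x : E3 => g0 (k ^ 2 * ‖x‖ ^ 2)) = fun x => (2 * k ^ 2) * (x j * g1 (k ^ 2 * ‖x‖ ^ 2)) := by
    intro j; funext x
    rw [pd_radial0 (ψ := fun z => g0 (k ^ 2 * z)) x j (dk h0 _)]; ring
  have cg1 : ContDiff ℝ 1 (fun x : E3 => g1 (k ^ 2 * ‖x‖ ^ 2)) := cd1.comp cn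
  have hpp : ∀ i j x, pd i (pd j (fun x : E3 => g0 (k ^ 2 * ‖x‖ ^ 2))) x
      = (2 * k ^ 2) * ((if i = j then 1 else 0) * g1 (k ^ 2 * ‖x‖ ^ 2) + x j * (g2 (k ^ 2 * ‖x‖ ^ 2) * k ^ 2 * (2 * x i))) := by
    intro i j x
    rw [hp j, pd_mul i contDiff_const ((contDiff_coord j).mul cg1), pd_mul i (contDiff_coord j) cg1, pd_coord,
      pd_radial0 (ψ := fun z => g1 (k ^ 2 * z)) x i (dk h1 _)]
    have : pd i (fun _ : E3 => 2 * k ^ 2) x = 0 := by unfold pd; simp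
    rw [this]; ring
  have nn : ∀ x : E3, 0 ≤ k ^ 2 * ‖x‖ ^ 2 := fun x => by positivity
  refine ⟨fun x => g0 (k ^ 2 * ‖x‖ ^ 2), cd0.comp cn, ?_, ?_, ?_, ?_, ?_, ?_, ?_⟩
  · intro j; rw [hp j]
    exact contDiff_const.mul ((contDiff_coord j).mul cg1)
  · intro x v
    simp only [hpp]
    have e : ∑ j, ∑ i, v i * v j * ((2 * k ^ 2) * ((if i = j then 1 else 0) * g1 (k ^ 2 * ‖x‖ ^ 2) + x j * (g2 (k ^ 2 * ‖x‖ ^ 2) * k ^ 2 * (2 * x i))))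
        = 2 * k ^ 2 * g1 (k ^ 2 * ‖x‖ ^ 2) * (∑ j, v j ^ 2) + 4 * k ^ 4 * g2 (k ^ 2 * ‖x‖ ^ 2) * (∑ j, v j * x j) ^ 2 := by
      simp [Fin.sum_univ_three]; ring
    rw [e]
    have := p1 _ (nn x)
    have := p2 _ (nn x)
    positivity
  · intro x
    simp only [hpp]
    have hn : ‖x‖ ^ 2 = x 0 ^ 2 + x 1 ^ 2 + x 2 ^ 2 := by
      rw [EuclideanSpace.norm_sq_eq]; simp [Fin.sum_univ_three]
    have := hL _ (nn x)
    rw [← this]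
    simp only [Fin.sum_univ_three, if_true]
    have e5 : ∀ a b : ℝ, 2 * k ^ 2 * (1 * a + x 0 * (b * k ^ 2 * (2 * x 0))) + 2 * k ^ 2 * (1 * a + x 1 * (b * k ^ 2 * (2 * x 1)))
        + 2 * k ^ 2 * (1 * a + x 2 * (b * k ^ 2 * (2 * x 2))) = k ^ 2 * (6 * a + 4 * (k ^ 2 * ‖x‖ ^ 2) * b) := by
      intro a b; rw [hn]; ring
    exact e5 _ _
  · intro x
    have := m0 (by simp : (0:ℝ) ∈ Ici 0) (nn x) (nn x)
    simpa [hz] using this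
  · intro x
    have := hS (k * ‖x‖)
    rwa [mul_pow] at this
  · intro x y hxy
    exact m0 (nn x) (nn y) (by gcongr)
  · intro j x hx
    rw [hp j]
    have hr : 0 < ‖x‖ := norm_pos_iff.2 hx
    set y := k * ‖x‖ with hy
    have hy0 : 0 < y := by positivity
    have e1 : HasDerivAt (fun y => y * g0 (y ^ 2)) (1 * g0 (y ^ 2) + y * (g1 (y ^ 2) * (2 * y))) y := by
      have := (hasDerivAt_id y).mul ((h0 (y ^ 2)).comp y (hasDerivAt_pow 2 y))
      convert! this using 1
      simp
    have e2 : (fun y => y * g0 (y ^ 2)) = sinh := funext hS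
    rw [e2] at e1
    have e3 := e1.unique (Real.hasDerivAt_sinh y)
    have e4 := hS y
    have e5 : k ^ 2 * ‖x‖ ^ 2 = y ^ 2 := by rw [hy]; ring
    simp only [e5]
    rw [← e3, ← e4, hy]
    field_simp
    ring

lemma cons_law {f : Pt → ℝ} (hf : ContDiff ℝ 1 f) {φ : E3 → ℝ} (hφ : ContDiff ℝ 1 φ) {M t : ℝ} (ht : 0 ≤ t)
    (hsupp : ∀ s, 0 ≤ s → ∀ x, M + s < ‖x‖ → f (s, x) = 0) (F : Fin 3 → E3 → ℝ) (hF : ∀ i, ContDiff ℝ 1 (F i))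
    (hF0 : ∀ i x, M + t < ‖x‖ → F i x = 0) (g : E3 → ℝ) (hg : Continuous g) (hg0 : ∀ x, M + t < ‖x‖ → g x = 0)
    (heq : ∀ x, dt f (t, x) = - (∑ i, pd i (F i) x) + g x) :
    HasDerivWithinAt (fun s => ∫ x, f (s, x) * φ x) ((∑ i, ∫ x, F i x * pd i φ x) + ∫ x, g x * φ x) (Ici 0) t := by
  have hφ2 : ContDiff ℝ 1 (fun q : Pt => φ q.2) := hφ.comp contDiff_snd
  have h1 := hasDerivAt_setIntegral (hf.mul hφ2) (isCompact_closedBall (0 : E3) (M + t + 1)) t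
  have hK : ∀ x : E3, x ∉ Metric.closedBall (0 : E3) (M + t + 1) → M + t + 1 < ‖x‖ := fun x hx => by simpa using hx
  have hv : ∫ x in Metric.closedBall (0 : E3) (M + t + 1), dt (fun x => f x * φ x.2) (t, x)
      = (∑ i, ∫ x, F i x * pd i φ x) + ∫ x, g x * φ x := by
    have e0 : ∀ x, dt (fun x => f x * φ x.2) (t, x) = - (∑ i, pd i (F i) x * φ x) + g x * φ x := by
      intro x
      rw [dt_mul hf hφ2, heq]
      have : dt (fun q : Pt => φ q.2) (t, x) = 0 := by
        have := hasDerivAt_dt (hφ2.differentiable one_ne_zero (t, x))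
        exact this.unique (hasDerivAt_const t (φ x))
      rw [this, ← Finset.sum_mul]; ring
    simp only [e0]
    have i1 : ∀ i, Integrable (fun x => pd i (F i) x * φ x) := fun i => by
      refine ((continuous_pd i (hF i)).mul hφ.continuous).integrable_of_hasCompactSupport
        (compactSupport_of (R := M + t) fun x hx => ?_)
      simp [pd_zero_of_outside i (hF0 i) x hx]
    have i2 : Integrable (fun x => g x * φ x) := by
      refine (hg.mul hφ.continuous).integrable_of_hasCompactSupport
        (compactSupport_of (R := M + t) fun x hx => ?_)
      simp [hg0 x hx]
    have i3 : Integrable (fun x => - ∑ i, pd i (F i) x * φ x) := (integrable_finsetSum _ fun i _ => i1 i).neg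
    rw [setIntegral_eq_integral_of_forall_compl_eq_zero fun x hx => ?_]
    · rw [integral_add i3 i2, integral_neg,
        integral_finsetSum _ fun i _ => i1 i, ← Finset.sum_neg_distrib]
      congr 1
      refine Finset.sum_congr rfl fun i _ => ?_
      rw [ibp (hF i) hφ (hF0 i) i, neg_neg]
    · have hx' : M + t < ‖x‖ := by linarith [hK x hx]
      have : ∀ i, pd i (F i) x = 0 := fun i => pd_zero_of_outside i (hF0 i) x hx'
      simp [this, hg0 x hx']
  rw [hv] at h1
  refine h1.hasDerivWithinAt.congr_of_eventuallyEq ?_ ?_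
  · have : Iio (t + 1) ∈ nhdsWithin t (Ici 0) := mem_nhdsWithin_of_mem_nhds (Iio_mem_nhds (by linarith))
    filter_upwards [this, self_mem_nhdsWithin] with s hs hs0
    symm
    refine setIntegral_eq_integral_of_forall_compl_eq_zero fun x hx => ?_
    have := hK x hx
    rw [hsupp s hs0 x (by linarith [show s < t + 1 from hs])]; simp
  · symm
    refine setIntegral_eq_integral_of_forall_compl_eq_zero fun x hx => ?_
    have := hK x hx
    rw [hsupp t ht x (by linarith)]; simp

namespace Sol
variable {A γ μ lam ρb M : ℝ} {ρ : Pt → ℝ} {u : Pt → Fin 3 → ℝ}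

lemma mass (S : Sol A γ μ lam ρb M ρ u) {φ : E3 → ℝ} (hφ : ContDiff ℝ 1 φ) (t : ℝ) (ht : 0 ≤ t) :
    HasDerivWithinAt (fun s => ∫ x, (ρ (s, x) - ρb) * φ x) (∑ i, ∫ x, ρ (t, x) * u (t, x) i * pd i φ x) (Ici 0) t := by
  have h := cons_law (f := fun q => ρ q - ρb) (S.cρ.sub contDiff_const) hφ (M := M) ht
    (fun s hs x hx => by simp [(S.fp s hs x hx).1]) (fun i x => ρ (t, x) * u (t, x) i)
    (fun i => slice_contDiff (S.cm i) t) (fun i x hx => by simp [(S.fp t ht x hx).2]) 0 continuous_zero (fun _ _ => rfl) ?_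
  · simpa using h
  · intro x
    have := (S.pde (t, x) ht).1
    rw [dt_sub_const]
    simp only [dxi_slice _ ((S.cm _).differentiable one_ne_zero (t, x))] at this
    simp only [Pi.zero_apply]; linarith

/-- momentum flux -/
def fl (A γ ρb : ℝ) (ρ : Pt → ℝ) (u : Pt → Fin 3 → ℝ) (t : ℝ) (j i : Fin 3) (x : E3) : ℝ :=
  ρ (t, x) * u (t, x) i * u (t, x) j + if i = j then A * ρ (t, x) ^ γ - A * ρb ^ γ else 0

lemma cP (S : Sol A γ μ lam ρb M ρ u) (t : ℝ) (ht : 0 ≤ t) : ContDiff ℝ 1 (fun x => A * ρ (t, x) ^ γ) :=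
  contDiff_const.mul ((slice_contDiff S.cρ t).rpow_const_of_ne fun x => (S.pos (t, x) ht).ne')

lemma cfl (S : Sol A γ μ lam ρb M ρ u) (t : ℝ) (ht : 0 ≤ t) (j i : Fin 3) : ContDiff ℝ 1 (fl A γ ρb ρ u t j i) := by
  unfold fl
  refine (slice_contDiff ((S.cm i).mul (S.cu j)) t).add ?_
  by_cases h : i = j
  · simp only [h, if_true]; exact (S.cP t ht).sub contDiff_const
  · simp only [h, if_false]; exact contDiff_const

lemma momentum (S : Sol A γ μ lam ρb M ρ u) {φ : E3 → ℝ} (hφ : ContDiff ℝ 1 φ) (t : ℝ) (ht : 0 ≤ t) (j : Fin 3) :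
    HasDerivWithinAt (fun s => ∫ x, ρ (s, x) * u (s, x) j * φ x)
      ((∑ i, ∫ x, fl A γ ρb ρ u t j i x * pd i φ x) - μ / (1 + t) ^ lam * ∫ x, ρ (t, x) * u (t, x) j * φ x) (Ici 0) t := by
  have h := cons_law (f := fun q => ρ q * u q j) (S.cm j) hφ (M := M) ht
    (fun s hs x hx => by simp [(S.fp s hs x hx).2]) (fl A γ ρb ρ u t j)
    (S.cfl t ht j) (fun i x hx => by simp [fl, (S.fp t ht x hx).1, (S.fp t ht x hx).2])
    (fun x => -(μ / (1 + t) ^ lam) * (ρ (t, x) * u (t, x) j))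
    (continuous_const.mul (slice_contDiff (S.cm j) t).continuous) (fun x hx => by simp [(S.fp t ht x hx).2]) ?_
  · convert! h using 1
    rw [sub_eq_add_neg]
    congr 1
    rw [← neg_mul, ← integral_const_mul]
    refine integral_congr_ae (Filter.Eventually.of_forall fun x => ?_)
    simp only; ring
  · intro x
    have h := (S.pde (t, x) ht).2 j
    have e : ∀ i, dxi i (fun z => ρ z * u z i * u z j + (if i = j then A * ρ z ^ γ else 0)) (t, x) = pd i (fl A γ ρb ρ u t j i) x := by
      intro i
      rw [dxi_slice]
      · unfold fl
        by_cases h : i = j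
        · simp only [h, if_true, add_sub]
          unfold pd
          rw [show (fun x => ρ (t, x) * u (t, x) j * u (t, x) j + A * ρ (t, x) ^ γ - A * ρb ^ γ) =
            (fun x => (ρ (t, x) * u (t, x) j * u (t, x) j + A * ρ (t, x) ^ γ) - A * ρb ^ γ) from rfl, fderiv_sub_const]
        · simp only [h, if_false]
      · refine (((S.cm i).mul (S.cu j)).differentiable one_ne_zero _).add ?_
        by_cases h : i = j
        · simp only [h, if_true]; exact diff_press S.cρ _ (S.pos _ ht)
        · simp only [h, if_false]; exact differentiableAt_const _
    simp only [e] at h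
    linarith

end Sol

lemma rpow_tangent {γ r b : ℝ} (hγ : 1 ≤ γ) (hr : 0 < r) (hb : 0 < b) :
    b ^ γ + γ * b ^ (γ - 1) * (r - b) ≤ r ^ γ := by
  have h1 := one_add_mul_self_le_rpow_one_add (s := r / b - 1) (by have := div_pos hr hb; linarith) hγ
  rw [add_sub_cancel, Real.div_rpow hr.le hb.le, le_div_iff₀ (by positivity)] at h1
  have h2 : b ^ γ = b ^ (γ - 1) * b := by
    rw [← Real.rpow_add_one hb.ne']; ring_nf
  have h3 : (1 + γ * (r / b - 1)) * b ^ γ = b ^ γ + γ * b ^ (γ - 1) * (r - b) := by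
    rw [h2]; field_simp
  linarith

lemma kappa_lower {β z : ℝ} (hβ : 0 < β) (hz : 0 ≤ z) (hz1 : z ≤ 1) : β * z / 2 ≤ (1 + z) ^ β - 1 := by
  have h1 : 0 < 1 + z := by linarith
  rw [Real.rpow_def_of_pos h1]
  have h2 := Real.add_one_le_exp (Real.log (1 + z) * β)
  have h3 := Real.one_sub_inv_le_log_of_pos h1
  have h4 : z / 2 ≤ 1 - (1 + z)⁻¹ := by
    have : 1 - (1 + z)⁻¹ = z / (1 + z) := by field_simp; ring
    rw [this]
    exact div_le_div_of_nonneg_left hz h1 (by linarith)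
  have h5 : z / 2 * β ≤ Real.log (1 + z) * β := by gcongr; linarith
  linarith

lemma G_lower {A γ ρb r s : ℝ} (hA : 0 < A) (hγ : 1 < γ) (hρb : 0 < ρb) (hs : A * γ * ρb ^ (γ - 1) = 1)
    (hr : 0 < r) (hs0 : 0 ≤ s) :
    ((1 + s / ρb) ^ (γ - 1) - 1) * (r - ρb - s) ≤ A * r ^ γ - A * ρb ^ γ - (r - ρb) := by
  have hb : 0 < ρb + s := by linarith
  have h1 := rpow_tangent hγ.le hr hb
  have h2 := rpow_tangent hγ.le hb hρb
  have h3 : A * γ * (ρb + s) ^ (γ - 1) = (1 + s / ρb) ^ (γ - 1) := by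
    have : ρb + s = ρb * (1 + s / ρb) := by field_simp
    rw [this, Real.mul_rpow hρb.le (by positivity), ← mul_assoc, hs, one_mul]
  have h4 := mul_le_mul_of_nonneg_left h1 hA.le
  have h5 := mul_le_mul_of_nonneg_left h2 hA.le
  have h6 : A * ((ρb + s) ^ γ + γ * (ρb + s) ^ (γ - 1) * (r - (ρb + s))) = A * (ρb + s) ^ γ + (1 + s / ρb) ^ (γ - 1) * (r - (ρb + s)) := by
    rw [← h3]; ring
  have h7 : A * (ρb ^ γ + γ * ρb ^ (γ - 1) * (ρb + s - ρb)) = A * ρb ^ γ + s := by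
    have : A * (ρb ^ γ + γ * ρb ^ (γ - 1) * (ρb + s - ρb)) = A * ρb ^ γ + (A * γ * ρb ^ (γ - 1)) * s := by ring
    rw [this, hs, one_mul]
  linarith

namespace Sol
variable {A γ μ lam ρb M : ℝ} {ρ : Pt → ℝ} {u : Pt → Fin 3 → ℝ}

def II (ρb : ℝ) (ρ : Pt → ℝ) (φ : E3 → ℝ) (t : ℝ) : ℝ := ∫ x, (ρ (t, x) - ρb) * φ x
def YY (ρ : Pt → ℝ) (u : Pt → Fin 3 → ℝ) (φ : E3 → ℝ) (t : ℝ) : ℝ := ∑ j, ∫ x, ρ (t, x) * u (t, x) j * pd j φ x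
def NN (A γ ρb k : ℝ) (ρ : Pt → ℝ) (u : Pt → Fin 3 → ℝ) (φ : E3 → ℝ) (t : ℝ) : ℝ :=
  (∑ j, ∑ i, ∫ x, fl A γ ρb ρ u t j i x * pd i (pd j φ) x) - k ^ 2 * II ρb ρ φ t

lemma II_deriv (S : Sol A γ μ lam ρb M ρ u) {k : ℝ} {φ : E3 → ℝ} (hφ : TestFn k φ) (t : ℝ) (ht : 0 ≤ t) :
    HasDerivWithinAt (II ρb ρ φ) (YY ρ u φ t) (Ici 0) t := S.mass hφ.c1 t ht

lemma YY_deriv (S : Sol A γ μ lam ρb M ρ u) {k : ℝ} {φ : E3 → ℝ} (hφ : TestFn k φ) (t : ℝ) (ht : 0 ≤ t) :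
    HasDerivWithinAt (YY ρ u φ) (k ^ 2 * II ρb ρ φ t + NN A γ ρb k ρ u φ t - μ / (1 + t) ^ lam * YY ρ u φ t) (Ici 0) t := by
  have h := HasDerivWithinAt.fun_sum (u := Finset.univ) fun j _ => S.momentum (hφ.c2 j) t ht j
  convert! h using 1
  unfold NN YY
  rw [Finset.sum_sub_distrib, Finset.mul_sum]; ring

lemma w_int (S : Sol A γ μ lam ρb M ρ u) {φ : E3 → ℝ} (hφ : Continuous φ) (t : ℝ) (ht : 0 ≤ t) :
    Integrable (fun x => (ρ (t, x) - ρb) * φ x) := by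
  refine (((slice_contDiff S.cρ t).continuous.sub continuous_const).mul hφ).integrable_of_hasCompactSupport
        (compactSupport_of (R := M + t) fun x hx => ?_)
  simp [(S.fp t ht x hx).1]

lemma fl_int (S : Sol A γ μ lam ρb M ρ u) {φ : E3 → ℝ} (hφ : Continuous φ) (t : ℝ) (ht : 0 ≤ t) (j i : Fin 3) :
    Integrable (fun x => fl A γ ρb ρ u t j i x * φ x) := by
  refine ((S.cfl t ht j i).continuous.mul hφ).integrable_of_hasCompactSupport
        (compactSupport_of (R := M + t) fun x hx => ?_)
  simp [fl, (S.fp t ht x hx).1, (S.fp t ht x hx).2]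

lemma NN_eq (S : Sol A γ μ lam ρb M ρ u) {k : ℝ} {φ : E3 → ℝ} (hφ : TestFn k φ) (t : ℝ) (ht : 0 ≤ t) :
    Integrable (fun x => (∑ j, ∑ i, fl A γ ρb ρ u t j i x * pd i (pd j φ) x) - k ^ 2 * ((ρ (t, x) - ρb) * φ x)) ∧ 
    NN A γ ρb k ρ u φ t = ∫ x, ((∑ j, ∑ i, fl A γ ρb ρ u t j i x * pd i (pd j φ) x) - k ^ 2 * ((ρ (t, x) - ρb) * φ x)) := by
  have i1 : ∀ j i, Integrable (fun x => fl A γ ρb ρ u t j i x * pd i (pd j φ) x) := fun j i =>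
    S.fl_int (continuous_pd i (hφ.c2 j)) t ht j i
  have i2 : ∀ j, Integrable (fun x => ∑ i, fl A γ ρb ρ u t j i x * pd i (pd j φ) x) := fun j =>
    integrable_finsetSum _ fun i _ => i1 j i
  have i3 : Integrable (fun x => ∑ j, ∑ i, fl A γ ρb ρ u t j i x * pd i (pd j φ) x) :=
    integrable_finsetSum _ fun j _ => i2 j
  have i4 : Integrable (fun x => k ^ 2 * ((ρ (t, x) - ρb) * φ x)) := (S.w_int hφ.c1.continuous t ht).const_mul _
  refine ⟨i3.sub i4, ?_⟩
  rw [integral_sub i3 i4, integral_const_mul, integral_finsetSum _ fun j _ => i2 j]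
  unfold NN II
  congr 1
  refine Finset.sum_congr rfl fun j _ => ?_
  rw [integral_finsetSum _ fun i _ => i1 j i]

lemma NN_pt (S : Sol A γ μ lam ρb M ρ u) {k : ℝ} {φ : E3 → ℝ} (hφ : TestFn k φ) (t : ℝ) (ht : 0 ≤ t) (s : ℝ) (hs : 0 ≤ s) (x : E3) :
    k ^ 2 * ((1 + s / ρb) ^ (γ - 1) - 1) * ((ρ (t, x) - ρb) * φ x - s * φ x)
      ≤ (∑ j, ∑ i, fl A γ ρb ρ u t j i x * pd i (pd j φ) x) - k ^ 2 * ((ρ (t, x) - ρb) * φ x) := by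
  have hr := S.pos (t, x) ht
  have h1 := G_lower S.hA S.hγ S.hρb S.hs hr hs
  have h2 := mul_nonneg hr.le (hφ.hess x (u (t, x)))
  have h3 := hφ.lap x
  have h4 := hφ.one_le x
  have e : (∑ j, ∑ i, fl A γ ρb ρ u t j i x * pd i (pd j φ) x) = ρ (t, x) * (∑ j, ∑ i, u (t, x) i * u (t, x) j * pd i (pd j φ) x)
      + (A * ρ (t, x) ^ γ - A * ρb ^ γ) * ∑ i, pd i (pd i φ) x := by
    unfold fl
    simp [Fin.sum_univ_three]; ring
  rw [e, h3]
  have h5 := mul_le_mul_of_nonneg_left h1 (show 0 ≤ k ^ 2 * φ x by have := sq_nonneg k; positivity)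
  linarith

lemma NN_nonneg (S : Sol A γ μ lam ρb M ρ u) {k : ℝ} {φ : E3 → ℝ} (hφ : TestFn k φ) (t : ℝ) (ht : 0 ≤ t) :
    0 ≤ NN A γ ρb k ρ u φ t := by
  rw [(S.NN_eq hφ t ht).2]
  refine integral_nonneg fun x => ?_
  have := S.NN_pt hφ t ht 0 le_rfl x
  simpa using this

lemma NN_lower (S : Sol A γ μ lam ρb M ρ u) {k : ℝ} {φ : E3 → ℝ} (hφ : TestFn k φ) (t : ℝ) (ht : 0 ≤ t) (s : ℝ) (hs : 0 ≤ s)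
    (hs1 : s ≤ ρb) {Φ : ℝ} (hΦ : ∫ x in Metric.closedBall (0 : E3) (M + t), φ x ≤ Φ) :
    (k ^ 2 * (γ - 1) / (2 * ρb)) * s * (II ρb ρ φ t - s * Φ) ≤ NN A γ ρb k ρ u φ t := by
  have h0 := S.NN_nonneg hφ t ht
  have hγ := S.hγ
  have hρb := S.hρb
  have hκ := kappa_lower (β := γ - 1) (z := s / ρb) (by linarith) (by positivity) ((div_le_one hρb).2 hs1)
  set κ := (1 + s / ρb) ^ (γ - 1) - 1 with hκd
  have hκ0 : 0 ≤ κ := le_trans (by have : 0 < γ - 1 := by linarith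
                                   positivity) hκ
  set J := ∫ x in Metric.closedBall (0 : E3) (M + t), φ x with hJ
  have ib : IntegrableOn φ (Metric.closedBall (0 : E3) (M + t)) :=
    hφ.c1.continuous.continuousOn.integrableOn_compact (isCompact_closedBall _ _)
  have ib' : Integrable (indicator (Metric.closedBall (0 : E3) (M + t)) φ) := ib.integrable_indicator measurableSet_closedBall
  have h1 : k ^ 2 * κ * (II ρb ρ φ t - s * J) ≤ NN A γ ρb k ρ u φ t := by
    rw [(S.NN_eq hφ t ht).2]
    have e : k ^ 2 * κ * (II ρb ρ φ t - s * J) = ∫ x, k ^ 2 * κ * ((ρ (t, x) - ρb) * φ x - s * indicator (Metric.closedBall (0 : E3) (M + t)) φ x) := by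
      rw [integral_const_mul, integral_sub (S.w_int hφ.c1.continuous t ht) (ib'.const_mul s), integral_const_mul,
        integral_indicator measurableSet_closedBall]
      rfl
    rw [e]
    refine integral_mono (((S.w_int hφ.c1.continuous t ht).sub (ib'.const_mul s)).const_mul _) (S.NN_eq hφ t ht).1 fun x => ?_
    by_cases hx : x ∈ Metric.closedBall (0 : E3) (M + t)
    · simp only [indicator_of_mem hx]
      exact S.NN_pt hφ t ht s hs x
    · have hx' : M + t < ‖x‖ := by simpa using hx
      have := S.NN_pt hφ t ht 0 le_rfl x
      simp only [indicator_of_notMem hx, (S.fp t ht x hx').1] at this ⊢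
      simpa using this
  set c := k ^ 2 * (γ - 1) / (2 * ρb) with hc
  have hc0 : 0 ≤ c := by have : 0 < γ - 1 := by linarith
                         positivity
  have hcs : c * s ≤ k ^ 2 * κ := by
    have : c * s = k ^ 2 * ((γ - 1) * (s / ρb) / 2) := by rw [hc]; field_simp
    rw [this]; gcongr
  have h2 : c * s * (II ρb ρ φ t - s * Φ) ≤ c * s * (II ρb ρ φ t - s * J) := by gcongr
  refine h2.trans ?_
  by_cases h3 : 0 ≤ II ρb ρ φ t - s * J
  · exact (mul_le_mul_of_nonneg_right hcs h3).trans h1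
  · push Not at h3
    exact (mul_nonpos_of_nonneg_of_nonpos (by positivity) h3.le).trans h0

end Sol

namespace TestFn

lemma radial {k : ℝ} {φ : E3 → ℝ} (hφ : TestFn k φ) (x : E3) : φ x = φ (EuclideanSpace.single 0 ‖x‖) := by
  apply le_antisymm <;> apply hφ.mono <;> simp

lemma ball_le {k : ℝ} (hk : 0 < k) {φ : E3 → ℝ} (hφ : TestFn k φ) {R : ℝ} (hR : 0 < R) (x : E3) (hx : ‖x‖ ≤ R) :
    φ x ≤ Real.exp (k * R) / (k * R) := by
  have h1 := hφ.mono x (EuclideanSpace.single 0 R) (by simpa [abs_of_pos hR] using hx)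
  have h2 := hφ.val (EuclideanSpace.single 0 R)
  simp only [EuclideanSpace.norm_single, Real.norm_eq_abs, abs_of_pos hR] at h2
  refine h1.trans ?_
  rw [le_div_iff₀ (by positivity), mul_comm, h2, Real.sinh_eq]
  have := Real.exp_pos (k * R)
  have := Real.exp_pos (-(k * R))
  linarith

lemma int_ball {k : ℝ} (hk : 0 < k) {φ : E3 → ℝ} (hφ : TestFn k φ) {R : ℝ} (hR : 0 < R) :
    ∫ x in Metric.closedBall (0 : E3) R, φ x ≤ 3 * volume.real (Metric.ball (0 : E3) 1) * (R * Real.exp (k * R) / k ^ 2) := by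
  have e1 : ∫ x in Metric.closedBall (0 : E3) R, φ x
      = ∫ x : E3, (indicator (Iic R) (fun y : ℝ => φ (EuclideanSpace.single 0 y))) ‖x‖ := by
    rw [← integral_indicator measurableSet_closedBall]
    refine integral_congr_ae (Filter.Eventually.of_forall fun x => ?_)
    by_cases hx : ‖x‖ ≤ R
    · simp only
      rw [indicator_of_mem (by simpa using hx), indicator_of_mem (by simpa using hx), ← hφ.radial]
    · simp only
      rw [indicator_of_notMem (by simpa using hx), indicator_of_notMem (by simpa using hx)]
  rw [e1, integral_fun_norm_addHaar volume]
  have hd : Module.finrank ℝ E3 = 3 := by simp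
  rw [hd]
  simp only [nsmul_eq_mul, smul_eq_mul]
  push_cast
  rw [← mul_assoc]
  refine mul_le_mul_of_nonneg_left ?_ (by positivity)
  have e2 : ∫ y in Ioi (0:ℝ), y ^ 2 * (indicator (Iic R) (fun y : ℝ => φ (EuclideanSpace.single 0 y))) y
      = ∫ y in (0:ℝ)..R, y ^ 2 * φ (EuclideanSpace.single 0 y) := by
    rw [intervalIntegral.integral_of_le hR.le, ← Ioi_inter_Iic, ← setIntegral_indicator measurableSet_Iic]
    refine integral_congr_ae (Filter.Eventually.of_forall fun y => ?_)
    by_cases hy : y ∈ Iic R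
    · simp [indicator_of_mem hy]
    · simp [indicator_of_notMem hy]
  rw [e2]
  have hcs : Continuous fun y : ℝ => φ (EuclideanSpace.single 0 y) := by
    refine hφ.c1.continuous.comp ?_
    have : (fun y : ℝ => (EuclideanSpace.single 0 y : E3)) = fun y => y • EuclideanSpace.single 0 (1:ℝ) := by
      funext y; ext i; by_cases h : i = 0 <;> simp [h]
    exact (by fun_prop : Continuous fun y : ℝ => y • (EuclideanSpace.single 0 (1:ℝ) : E3)).congr fun y => (congrFun this y).symm
  have e3 : ∫ y in (0:ℝ)..R, y ^ 2 * φ (EuclideanSpace.single 0 y) ≤ ∫ y in (0:ℝ)..R, R / k * Real.exp (k * y) := by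
    refine intervalIntegral.integral_mono_on hR.le (((continuous_pow 2).mul hcs).intervalIntegrable _ _)
      (Continuous.intervalIntegrable (by fun_prop) _ _) fun y hy => ?_
    have h2 := hφ.val (EuclideanSpace.single 0 y)
    simp only [EuclideanSpace.norm_single, Real.norm_eq_abs, abs_of_nonneg hy.1] at h2
    have h3 : y ^ 2 * φ (EuclideanSpace.single 0 y) = y / k * sinh (k * y) := by
      rw [← h2]; field_simp
    rw [h3]
    have h4 : sinh (k * y) ≤ Real.exp (k * y) := by
      rw [Real.sinh_eq]
      have := Real.exp_pos (k * y)
      have := Real.exp_pos (-(k * y))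
      linarith
    have := hy.1
    have := hy.2
    have : 0 ≤ y / k := by positivity
    calc _ ≤ y / k * Real.exp (k * y) := by gcongr
      _ ≤ _ := by gcongr
  refine e3.trans ?_
  rw [intervalIntegral.integral_const_mul]
  have e4 : ∫ y in (0:ℝ)..R, Real.exp (k * y) = (Real.exp (k * R) - 1) / k := by
    rw [intervalIntegral.integral_comp_mul_left (fun y => Real.exp y) hk.ne']
    simp; field_simp
  rw [e4]
  have : R / k * ((Real.exp (k * R) - 1) / k) = R * (Real.exp (k * R) - 1) / k ^ 2 := by field_simp
  rw [this]
  gcongr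
  linarith

end TestFn

namespace Sol
variable {A γ μ lam ρb M : ℝ} {ρ : Pt → ℝ} {u : Pt → Fin 3 → ℝ}

lemma mass_const (S : Sol A γ μ lam ρb M ρ u) (t : ℝ) (ht : 0 ≤ t) :
    ∫ x, (ρ (t, x) - ρb) = ∫ x, (ρ (0, x) - ρb) := by
  have h : ∀ t, 0 ≤ t → HasDerivWithinAt (fun s => ∫ x, (ρ (s, x) - ρb)) 0 (Ici 0) t := fun t ht => by
    have := S.mass (φ := fun _ => 1) contDiff_const t ht
    have e : ∀ i x, pd i (fun _ : E3 => (1:ℝ)) x = 0 := fun i x => by unfold pd; simp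
    simpa [e] using this
  refine constant_of_has_deriv_right_zero (f := fun s => ∫ x, (ρ (s, x) - ρb)) (a := 0) (b := t)
    (fun s hs => (h s hs.1).continuousWithinAt.mono fun y hy => hy.1)
    (fun s hs => (h s hs.1).mono fun y hy => le_trans hs.1 hy) t ⟨ht, le_rfl⟩

lemma II_upper (S : Sol A γ μ lam ρb M ρ u) {k : ℝ} (hk : 0 < k) {φ : E3 → ℝ} (hφ : TestFn k φ) :
    ∃ C2 : ℝ, ∀ t, 0 ≤ t → II ρb ρ φ t ≤ C2 * (1 + t) ^ 3 * Real.exp (k * t) := by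
  set m0 := ∫ x, (ρ (0, x) - ρb) with hm0
  set v := volume.real (Metric.ball (0 : E3) 1) with hv
  have hM := S.hM
  have hρb := S.hρb
  refine ⟨Real.exp (k * M) / (k * M) * (|m0| + ρb * v * (M + 1) ^ 3), fun t ht => ?_⟩
  set K := Metric.closedBall (0 : E3) (M + t) with hK
  have hKc : IsCompact K := isCompact_closedBall _ _
  have hR : 0 < M + t := by linarith
  have hKn : ∀ x : E3, x ∉ K → M + t < ‖x‖ := fun x hx => by simpa [hK] using hx
  have cr : Continuous fun x => ρ (t, x) := (slice_contDiff S.cρ t).continuous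
  have e1 : II ρb ρ φ t = ∫ x in K, (ρ (t, x) - ρb) * φ x := by
    symm
    refine setIntegral_eq_integral_of_forall_compl_eq_zero fun x hx => ?_
    simp [(S.fp t ht x (hKn x hx)).1]
  set E := Real.exp (k * (M + t)) / (k * (M + t)) with hE
  have e2 : ∫ x in K, (ρ (t, x) - ρb) * φ x ≤ ∫ x in K, E * ((ρ (t, x) - ρb) + ρb) := by
    refine setIntegral_mono_on ?_ ?_ hKc.measurableSet fun x hx => ?_
    · exact ((cr.sub continuous_const).mul hφ.c1.continuous).continuousOn.integrableOn_compact hKc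
    · exact (continuous_const.mul ((cr.sub continuous_const).add continuous_const)).continuousOn.integrableOn_compact hKc
    · have h1 := hφ.ball_le hk hR x (by simpa [hK] using hx)
      have h2 := hφ.one_le x
      have h3 := S.pos (t, x) ht
      have h4 : ρ (t, x) * φ x ≤ ρ (t, x) * E := by gcongr
      nlinarith
  have e3 : ∫ x in K, E * ((ρ (t, x) - ρb) + ρb) = E * (m0 + ρb * (v * (M + t) ^ 3)) := by
    rw [integral_const_mul, integral_add]
    · congr 2
      · rw [hm0, ← S.mass_const t ht]
        refine setIntegral_eq_integral_of_forall_compl_eq_zero fun x hx => ?_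
        simp [(S.fp t ht x (hKn x hx)).1]
      · rw [setIntegral_const, smul_eq_mul, mul_comm]
        congr 1
        rw [hK, Measure.real, Measure.addHaar_closedBall _ _ hR.le, hv, Measure.real, ENNReal.toReal_mul,
          ENNReal.toReal_ofReal (by positivity)]
        simp [mul_comm]
    · exact (cr.sub continuous_const).continuousOn.integrableOn_compact hKc
    · exact continuousOn_const.integrableOn_compact hKc
  rw [e1]
  refine e2.trans (e3.le.trans ?_)
  have hv0 : 0 ≤ v := measureReal_nonneg
  have f1 : E ≤ Real.exp (k * M) / (k * M) * Real.exp (k * t) := by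
    rw [hE, mul_add, Real.exp_add]
    have : Real.exp (k * M) / (k * M) * Real.exp (k * t) = Real.exp (k * M) * Real.exp (k * t) / (k * M) := by ring
    rw [this]
    gcongr
    nlinarith
  have f2 : m0 + ρb * (v * (M + t) ^ 3) ≤ (|m0| + ρb * v * (M + 1) ^ 3) * (1 + t) ^ 3 := by
    have g1 : m0 ≤ |m0| * (1 + t) ^ 3 := by
      have : (1:ℝ) ≤ (1 + t) ^ 3 := one_le_pow₀ (by linarith)
      nlinarith [le_abs_self m0, abs_nonneg m0]
    have g2 : (M + t) ^ 3 ≤ ((M + 1) * (1 + t)) ^ 3 := by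
      gcongr; nlinarith
    have g3 : ρb * v * (M + t) ^ 3 ≤ ρb * v * ((M + 1) * (1 + t)) ^ 3 := by gcongr
    rw [mul_pow] at g3
    nlinarith
  have hE0 : 0 ≤ E := by positivity
  have hpos : 0 ≤ (|m0| + ρb * v * (M + 1) ^ 3) * (1 + t) ^ 3 := by positivity
  calc E * (m0 + ρb * (v * (M + t) ^ 3)) ≤ E * ((|m0| + ρb * v * (M + 1) ^ 3) * (1 + t) ^ 3) := by gcongr
    _ ≤ (Real.exp (k * M) / (k * M) * Real.exp (k * t)) * ((|m0| + ρb * v * (M + 1) ^ 3) * (1 + t) ^ 3) := by gcongr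
    _ = _ := by ring

theorem contra (S : Sol A γ μ lam ρb M ρ u) (hlam : 1 < lam) {k : ℝ} (hk : 0 < k) {φ : E3 → ℝ} (hφ : TestFn k φ)
    (hI0 : 0 < II ρb ρ φ 0) (hU0 : 0 < YY ρ u φ 0 + k * II ρb ρ φ 0) : False := by
  obtain ⟨C2, hC2⟩ := S.II_upper hk hφ
  have hγ := S.hγ
  have hρb := S.hρb
  have hγ' : 0 < γ - 1 := by linarith
  have hv : 0 < volume.real (Metric.ball (0 : E3) 1) :=
    ENNReal.toReal_pos (Metric.measure_ball_pos _ _ one_pos).ne' measure_ball_lt_top.ne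
  refine ode_contra k μ lam M (k ^ 2 * (γ - 1) / (2 * ρb)) (3 * volume.real (Metric.ball (0 : E3) 1) * Real.exp (k * M) / k ^ 2) C2 ρb hk S.hμ hlam S.hM
    (by positivity) (by positivity) hρb (II ρb ρ φ) (YY ρ u φ) (NN A γ ρb k ρ u φ) (S.II_deriv hφ) (S.YY_deriv hφ)
    (S.NN_nonneg hφ) (fun t ht s hs hs1 => ?_) hC2 hI0 hU0
  refine S.NN_lower hφ t ht s hs hs1 ?_
  have := hφ.int_ball hk (R := M + t) (by linarith [S.hM])
  refine this.trans (le_of_eq ?_)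
  rw [mul_add, Real.exp_add]; ring

end Sol

lemma fub {f : E3 → ℝ} (hf : Continuous f) {M B : ℝ} (hM : 0 < M) (hB : 0 ≤ B) (hf0 : ∀ x, M < ‖x‖ → f x = 0) (κ : E3 → ℝ → ℝ)
    (hκ : Measurable (Function.uncurry κ)) (hb : ∀ x l, 0 < l → l < ‖x‖ → |κ x l * f x| ≤ B) :
    IntervalIntegrable (fun l => ∫ x in {y : E3 | l < ‖y‖}, κ x l * f x) volume 0 M ∧
    ∀ k, IntervalIntegrable (fun l => cosh (k * l) * ∫ x in {y : E3 | l < ‖y‖}, κ x l * f x) volume 0 M ∧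
      ∫ l in (0:ℝ)..M, cosh (k * l) * ∫ x in {y : E3 | l < ‖y‖}, κ x l * f x
      = ∫ x, f x * ∫ l in (0:ℝ)..‖x‖, cosh (k * l) * κ x l := by
  set D : Set (E3 × ℝ) := {p | 0 < p.2 ∧ p.2 < ‖p.1‖ ∧ p.2 ≤ M} with hD
  have mD : MeasurableSet D := by
    refine (measurableSet_lt measurable_const measurable_snd).inter
      ((measurableSet_lt measurable_snd measurable_fst.norm).inter (measurableSet_le measurable_snd measurable_const))
  set K := Metric.closedBall (0 : E3) M with hK
  haveI : IsFiniteMeasure (volume.restrict K) := ⟨by simpa using measure_closedBall_lt_top⟩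
  haveI : IsFiniteMeasure ((volume : Measure ℝ).restrict (Ioc 0 M)) := ⟨by simp⟩
  set H : E3 × ℝ → ℝ := indicator D (fun p => κ p.1 p.2 * f p.1) with hH
  have mH : Measurable H := (hκ.mul (hf.measurable.comp measurable_fst)).indicator mD
  have bH : ∀ p, |H p| ≤ B := fun p => by
    by_cases hp : p ∈ D
    · rw [hH, indicator_of_mem hp]; exact hb _ _ hp.1 hp.2.1
    · rw [hH, indicator_of_notMem hp]; simpa using hB
  have iH : ∀ k, Integrable (fun p : E3 × ℝ => cosh (k * p.2) * H p) ((volume.restrict K).prod (volume.restrict (Ioc 0 M))) := fun k => by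
    refine Integrable.of_bound (C := cosh (k * M) * B) ?_ (Filter.Eventually.of_forall fun p => ?_)
    · exact ((by fun_prop : Measurable fun p : E3 × ℝ => cosh (k * p.2)).mul mH).aestronglyMeasurable
    · by_cases hp : p ∈ D
      · rw [norm_mul]
        refine mul_le_mul ?_ (bH p) (norm_nonneg _) (Real.cosh_pos _).le
        rw [Real.norm_eq_abs, abs_of_pos (Real.cosh_pos _), Real.cosh_le_cosh, abs_mul, abs_mul, abs_of_pos hp.1, abs_of_pos hM]
        have := hp.2.2
        gcongr
      · have : H p = 0 := by rw [hH, indicator_of_notMem hp]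
        rw [this]
        have := Real.cosh_pos (k * M)
        simp only [mul_zero, norm_zero]; positivity
  have hq : ∀ l, l ∈ Ioc 0 M → ∫ x in {y : E3 | l < ‖y‖}, κ x l * f x = ∫ x in K, H (x, l) := by
    intro l hl
    have m1 : MeasurableSet {y : E3 | l < ‖y‖} := measurableSet_lt measurable_const measurable_norm
    rw [← integral_indicator m1, ← integral_indicator measurableSet_closedBall]
    refine integral_congr_ae (Filter.Eventually.of_forall fun x => ?_)
    by_cases hx : x ∈ K
    · rw [indicator_of_mem hx]
      by_cases hx2 : l < ‖x‖
      · rw [indicator_of_mem (show x ∈ {y : E3 | l < ‖y‖} from hx2), hH, indicator_of_mem (show (x, l) ∈ D from ⟨hl.1, hx2, hl.2⟩)]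
      · rw [indicator_of_notMem (show x ∉ {y : E3 | l < ‖y‖} from hx2), hH, indicator_of_notMem (show (x, l) ∉ D from fun h => hx2 h.2.1)]
    · rw [indicator_of_notMem hx]
      have : f x = 0 := hf0 x (by simpa [hK] using hx)
      by_cases hx2 : l < ‖x‖
      · rw [indicator_of_mem (show x ∈ {y : E3 | l < ‖y‖} from hx2), this, mul_zero]
      · rw [indicator_of_notMem (show x ∉ {y : E3 | l < ‖y‖} from hx2)]
  have hqk : ∀ k, IntegrableOn (fun l => cosh (k * l) * ∫ x in {y : E3 | l < ‖y‖}, κ x l * f x) (Ioc 0 M) := fun k => by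
    have := (iH k).integral_prod_right
    refine this.congr ((ae_restrict_iff' measurableSet_Ioc).2 (Filter.Eventually.of_forall fun l hl => ?_))
    simp only
    rw [integral_const_mul, hq l hl]
  refine ⟨?_, fun k => ⟨?_, ?_⟩⟩
  · rw [intervalIntegrable_iff_integrableOn_Ioc_of_le hM.le]
    simpa using hqk 0
  · rw [intervalIntegrable_iff_integrableOn_Ioc_of_le hM.le]
    exact hqk k
  · rw [intervalIntegral.integral_of_le hM.le]
    have e1 : ∫ l in Ioc 0 M, cosh (k * l) * ∫ x in {y : E3 | l < ‖y‖}, κ x l * f x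
        = ∫ l in Ioc 0 M, ∫ x in K, cosh (k * l) * H (x, l) := by
      refine setIntegral_congr_fun measurableSet_Ioc fun l hl => ?_
      rw [integral_const_mul, hq l hl]
    rw [e1, ← integral_integral_swap (f := fun x l => cosh (k * l) * H (x, l)) (iH k)]
    have e2 : ∫ x, f x * ∫ l in (0:ℝ)..‖x‖, cosh (k * l) * κ x l = ∫ x in K, f x * ∫ l in (0:ℝ)..‖x‖, cosh (k * l) * κ x l := by
      symm
      refine setIntegral_eq_integral_of_forall_compl_eq_zero fun x hx => ?_
      rw [hf0 x (by simpa [hK] using hx), zero_mul]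
    rw [e2]
    refine setIntegral_congr_fun measurableSet_closedBall fun x hx => ?_
    have hx' : ‖x‖ ≤ M := by simpa [hK] using hx
    rw [intervalIntegral.integral_of_le (norm_nonneg x), ← integral_const_mul]
    rw [integral_Ioc_eq_integral_Ioo (y := ‖x‖), ← integral_indicator measurableSet_Ioc, ← integral_indicator measurableSet_Ioo]
    refine integral_congr_ae (Filter.Eventually.of_forall fun l => ?_)
    by_cases hl : l ∈ Ioo 0 ‖x‖
    · have hl2 : l ∈ Ioc 0 M := ⟨hl.1, hl.2.le.trans hx'⟩
      rw [indicator_of_mem hl, indicator_of_mem hl2, hH, indicator_of_mem (show (x, l) ∈ D from ⟨hl.1, hl.2, hl2.2⟩)]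
      ring
    · rw [indicator_of_notMem hl]
      by_cases hl2 : l ∈ Ioc 0 M
      · rw [indicator_of_mem hl2, hH, indicator_of_notMem (show (x, l) ∉ D from fun h => hl ⟨h.1, h.2.1⟩), mul_zero]
      · rw [indicator_of_notMem hl2]

lemma ker0 {k r : ℝ} (hk : 0 < k) (hr : 0 < r) :
    ∫ l in (0:ℝ)..r, cosh (k * l) * ((r - l) ^ 2 / r) = 2 / k ^ 2 * (sinh (k * r) / (k * r) - 1) := by
  have hd : ∀ l ∈ uIcc 0 r, HasDerivAt (fun l => ((r - l) ^ 2 * (sinh (k * l) / k) + 2 * (r - l) * (cosh (k * l) / k ^ 2) + 2 * sinh (k * l) / k ^ 3) / r)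
      (cosh (k * l) * ((r - l) ^ 2 / r)) l := by
    intro l _
    have hkl : HasDerivAt (fun l => k * l) k l := hasDerivAt_const_mul k
    have h1 : HasDerivAt (fun l => r - l) (-1) l := (hasDerivAt_id l).const_sub r
    have h2 := h1.fun_pow 2
    have hs := hkl.sinh
    have hc := hkl.cosh
    have := (((h2.fun_mul (hs.div_const k)).fun_add ((h1.const_mul 2).fun_mul (hc.div_const (k ^ 2)))).fun_add ((hs.const_mul 2).div_const (k ^ 3))).div_const r
    refine this.congr_deriv ?_
    field_simp
    ring
  rw [intervalIntegral.integral_eq_sub_of_hasDerivAt hd (Continuous.intervalIntegrable (by fun_prop) _ _)]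
  simp
  field_simp

lemma ker1 {k r : ℝ} (hk : 0 < k) (hr : 0 < r) :
    ∫ l in (0:ℝ)..r, cosh (k * l) * ((r ^ 2 - l ^ 2) / r ^ 3) = 2 / k ^ 2 * (cosh (k * r) / r ^ 2 - sinh (k * r) / (k * r ^ 3)) := by
  have hd : ∀ l ∈ uIcc 0 r, HasDerivAt (fun l => ((r ^ 2 - l ^ 2) * (sinh (k * l) / k) + 2 * l * (cosh (k * l) / k ^ 2) - 2 * sinh (k * l) / k ^ 3) / r ^ 3)
      (cosh (k * l) * ((r ^ 2 - l ^ 2) / r ^ 3)) l := by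
    intro l _
    have hkl : HasDerivAt (fun l => k * l) k l := hasDerivAt_const_mul k
    have h1 : HasDerivAt (fun l => 2 * l) 2 l := hasDerivAt_const_mul 2
    have h2 : HasDerivAt (fun l => r ^ 2 - l ^ 2) (-(2 * l)) l := by
      have := (hasDerivAt_pow 2 l).const_sub (r ^ 2)
      simpa using this
    have hs := hkl.sinh
    have hc := hkl.cosh
    have := (((h2.fun_mul (hs.div_const k)).fun_add (h1.fun_mul (hc.div_const (k ^ 2)))).fun_sub ((hs.const_mul 2).div_const (k ^ 3))).div_const (r ^ 3)
    refine this.congr_deriv ?_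
    field_simp
    ring
  rw [intervalIntegral.integral_eq_sub_of_hasDerivAt hd (Continuous.intervalIntegrable (by fun_prop) _ _)]
  simp
  field_simp

lemma init_exists {M M₀ : ℝ} (hM₀ : 0 ≤ M₀) (hM : M₀ < M) {q₀ q₁ : ℝ → ℝ} (a : ℝ)
    (i0 : IntervalIntegrable q₀ volume 0 M) (i1 : IntervalIntegrable q₁ volume 0 M)
    (i0k : ∀ k : ℝ, IntervalIntegrable (fun l => cosh (k * l) * q₀ l) volume 0 M)
    (i1k : ∀ k : ℝ, IntervalIntegrable (fun l => cosh (k * l) * q₁ l) volume 0 M)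
    (h0 : ∀ l, M₀ < l → l < M → 0 < q₀ l) (h1 : ∀ l, M₀ < l → l < M → 0 ≤ q₁ l) :
    ∃ k : ℝ, 1 ≤ k ∧ 0 < a + k ^ 2 / 2 * ∫ l in (0:ℝ)..M, cosh (k * l) * q₀ l ∧
      0 < k ^ 2 / 2 * (∫ l in (0:ℝ)..M, cosh (k * l) * q₁ l) + k * (a + k ^ 2 / 2 * ∫ l in (0:ℝ)..M, cosh (k * l) * q₀ l) := by
  have hMp : 0 < M := hM₀.trans_lt hM
  obtain ⟨l₁, hl₁, hl₁M⟩ := exists_between hM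
  have sub : ∀ {g : ℝ → ℝ} {c d : ℝ}, IntervalIntegrable g volume 0 M → 0 ≤ c → c ≤ d → d ≤ M → IntervalIntegrable g volume c d := by
    intro g c d hg hc hcd hd
    refine hg.mono_set ?_
    rw [uIcc_of_le hcd, uIcc_of_le hMp.le]
    exact Icc_subset_Icc hc hd
  have hD : 0 < ∫ l in l₁..M, q₀ l :=
    intervalIntegral.intervalIntegral_pos_of_pos_on (sub i0 (hM₀.trans hl₁.le) hl₁M.le le_rfl)
      (fun x hx => h0 x (hl₁.trans hx.1) hx.2) hl₁M
  set D := ∫ l in l₁..M, q₀ l with hDdef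
  -- lower bound on the inner part
  have inner : ∀ {g : ℝ → ℝ}, IntervalIntegrable g volume 0 M → (∀ k : ℝ, IntervalIntegrable (fun l => cosh (k * l) * g l) volume 0 M) → 
      ∀ k : ℝ, 0 ≤ k → -(cosh (k * M₀) * ∫ l in (0:ℝ)..M₀, |g l|) ≤ ∫ l in (0:ℝ)..M₀, cosh (k * l) * g l := by
    intro g hg hgk k hk
    rw [← intervalIntegral.integral_const_mul, ← intervalIntegral.integral_neg]
    refine intervalIntegral.integral_mono_on hM₀ ((sub hg le_rfl hM₀ hM.le).abs.const_mul _).neg (sub (hgk k) le_rfl hM₀ hM.le) fun l hl => ?_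
    have c1 : cosh (k * l) ≤ cosh (k * M₀) := by
      rw [Real.cosh_le_cosh, abs_of_nonneg (mul_nonneg hk hl.1), abs_of_nonneg (mul_nonneg hk hM₀)]
      exact mul_le_mul_of_nonneg_left hl.2 hk
    have c2 := Real.cosh_pos (k * l)
    have c3 := neg_abs_le (g l)
    have c4 := abs_nonneg (g l)
    nlinarith
  set c0 := ∫ l in (0:ℝ)..M₀, |q₀ l| with hc0
  set c1 := ∫ l in (0:ℝ)..M₀, |q₁ l| with hc1
  have c0n : 0 ≤ c0 := intervalIntegral.integral_nonneg hM₀ fun l _ => abs_nonneg _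
  have c1n : 0 ≤ c1 := intervalIntegral.integral_nonneg hM₀ fun l _ => abs_nonneg _
  set C := 1 + |a| + c0 + c1 with hC
  have an := abs_nonneg a
  have hC1 : 1 ≤ C := by linarith
  set k := max 1 (12 * C / (D * (l₁ - M₀))) with hk
  have hk1 : 1 ≤ k := le_max_left _ _
  have hk0 : 0 < k := by linarith
  have hlp : 0 < l₁ - M₀ := by linarith
  have hkk : 12 * C ≤ k * (D * (l₁ - M₀)) := by
    have := le_max_right 1 (12 * C / (D * (l₁ - M₀)))
    rwa [div_le_iff₀ (by positivity)] at this
  have big : 6 * C * cosh (k * M₀) < D * cosh (k * l₁) := by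
    have e1 : cosh (k * M₀) ≤ exp (k * M₀) := by
      rw [Real.cosh_eq]
      have : exp (-(k * M₀)) ≤ exp (k * M₀) := Real.exp_le_exp.2 (by have := mul_nonneg hk0.le hM₀; linarith)
      linarith
    have e2 : exp (k * l₁) / 2 ≤ cosh (k * l₁) := by
      rw [Real.cosh_eq]
      have := Real.exp_pos (-(k * l₁))
      linarith
    have e3 : exp (k * l₁) = exp (k * M₀) * exp (k * (l₁ - M₀)) := by
      rw [← Real.exp_add]; ring_nf
    have e4 := Real.add_one_le_exp (k * (l₁ - M₀))
    have e5 := Real.exp_pos (k * M₀)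
    have e6 : 12 * C < D * exp (k * (l₁ - M₀)) := by nlinarith
    calc 6 * C * cosh (k * M₀) ≤ 6 * C * exp (k * M₀) := by gcongr
      _ < D * (exp (k * l₁) / 2) := by rw [e3]; nlinarith
      _ ≤ _ := by gcongr
  have s0 : D * cosh (k * l₁) - C * cosh (k * M₀) + |a| * cosh (k * M₀) ≤ ∫ l in (0:ℝ)..M, cosh (k * l) * q₀ l := by
    rw [← intervalIntegral.integral_add_adjacent_intervals (sub (i0k k) le_rfl hM₀ hM.le) (sub (i0k k) hM₀ hM.le le_rfl),
      ← intervalIntegral.integral_add_adjacent_intervals (sub (i0k k) hM₀ hl₁.le hl₁M.le) (sub (i0k k) (hM₀.trans hl₁.le) hl₁M.le le_rfl)]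
    have a1 := inner i0 i0k k hk0.le
    have a2 : 0 ≤ ∫ l in M₀..l₁, cosh (k * l) * q₀ l := by
      have := intervalIntegral.intervalIntegral_pos_of_pos_on (sub (i0k k) hM₀ hl₁.le hl₁M.le)
        (fun x hx => mul_pos (Real.cosh_pos _) (h0 x hx.1 (hx.2.trans hl₁M))) hl₁
      exact this.le
    have a3 : D * cosh (k * l₁) ≤ ∫ l in l₁..M, cosh (k * l) * q₀ l := by
      rw [hDdef, mul_comm, ← intervalIntegral.integral_const_mul]
      refine intervalIntegral.integral_mono_on_of_le_Ioo hl₁M.le ((sub i0 (hM₀.trans hl₁.le) hl₁M.le le_rfl).const_mul _) (sub (i0k k) (hM₀.trans hl₁.le) hl₁M.le le_rfl) fun l hl => ?_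
      have hl0 : 0 ≤ l := by linarith [hl.1]
      have : cosh (k * l₁) ≤ cosh (k * l) := by
        rw [Real.cosh_le_cosh, abs_of_nonneg (mul_nonneg hk0.le hl0), abs_of_nonneg (mul_nonneg hk0.le (hM₀.trans hl₁.le))]
        exact mul_le_mul_of_nonneg_left hl.1.le hk0.le
      exact mul_le_mul_of_nonneg_right this (h0 l (hl₁.trans hl.1) hl.2).le
    have c2 := Real.cosh_pos (k * M₀)
    have : C * cosh (k * M₀) = cosh (k * M₀) + |a| * cosh (k * M₀) + cosh (k * M₀) * c0 + c1 * cosh (k * M₀) := by rw [hC]; ring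
    have : 0 ≤ c1 * cosh (k * M₀) := by positivity
    linarith
  have s1 : -(C * cosh (k * M₀)) ≤ ∫ l in (0:ℝ)..M, cosh (k * l) * q₁ l := by
    rw [← intervalIntegral.integral_add_adjacent_intervals (sub (i1k k) le_rfl hM₀ hM.le) (sub (i1k k) hM₀ hM.le le_rfl)]
    have a1 := inner i1 i1k k hk0.le
    have a2 : 0 ≤ ∫ l in M₀..M, cosh (k * l) * q₁ l := by
      have := intervalIntegral.integral_mono_on_of_le_Ioo (f := fun _ => (0:ℝ)) hM.le (by simp) (sub (i1k k) hM₀ hM.le le_rfl) (fun l hl => mul_nonneg (Real.cosh_pos (k * l)).le (h1 l hl.1 hl.2))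
      simpa using this
    have c2 := Real.cosh_pos (k * M₀)
    have : c1 * cosh (k * M₀) ≤ C * cosh (k * M₀) := by gcongr; linarith
    linarith
  have hch : 1 ≤ cosh (k * M₀) := Real.one_le_cosh _
  have aC : |a| ≤ C * cosh (k * M₀) := by nlinarith
  have s2 : 5 * (C * cosh (k * M₀)) ≤ ∫ l in (0:ℝ)..M, cosh (k * l) * q₀ l := by
    have : 0 ≤ |a| * cosh (k * M₀) := by positivity
    linarith
  set X := C * cosh (k * M₀) with hX
  have hXp : 1 ≤ X := by nlinarith
  set J0 := ∫ l in (0:ℝ)..M, cosh (k * l) * q₀ l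
  set J1 := ∫ l in (0:ℝ)..M, cosh (k * l) * q₁ l
  have a4 := neg_abs_le a
  have k2 : 1 ≤ k ^ 2 := by nlinarith
  have t : k ^ 2 * X ≤ a + k ^ 2 / 2 * J0 := by nlinarith
  have t1 : -(k ^ 2 / 2 * X) ≤ k ^ 2 / 2 * J1 := by nlinarith
  refine ⟨k, hk1, ?_, ?_⟩
  · nlinarith
  · have : 0 < k ^ 2 * X := by positivity
    nlinarith

lemma pt_ii {k : ℝ} (hk : 0 < k) {φ : E3 → ℝ} (hφ : TestFn k φ) {x : E3} (hx : x ≠ 0) :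
    φ x = 1 + k ^ 2 / 2 * ∫ l in (0:ℝ)..‖x‖, cosh (k * l) * ((‖x‖ - l) ^ 2 / ‖x‖) := by
  have hr : 0 < ‖x‖ := norm_pos_iff.2 hx
  rw [ker0 hk hr, ← hφ.val x]
  field_simp
  ring

lemma pt_yy {k : ℝ} (hk : 0 < k) {φ : E3 → ℝ} (hφ : TestFn k φ) {x : E3} (hx : x ≠ 0) (j : Fin 3) :
    pd j φ x = x j * (k ^ 2 / 2 * ∫ l in (0:ℝ)..‖x‖, cosh (k * l) * ((‖x‖ ^ 2 - l ^ 2) / ‖x‖ ^ 3)) := by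
  have hr : 0 < ‖x‖ := norm_pos_iff.2 hx
  rw [ker1 hk hr, hφ.grad j x hx]
  field_simp

lemma final_step {A γ μ lam ρb M M₀ : ℝ} {ρ : Pt → ℝ} {u : Pt → Fin 3 → ℝ} (S : Sol A γ μ lam ρb M ρ u) (hlam : 1 < lam)
    (hM₀ : 0 ≤ M₀) (hM : M₀ < M)
    (hq₀ : ∀ l : ℝ, M₀ < l → l < M →
      0 < ∫ x in {y : E3 | l < ‖y‖}, ((‖x‖ - l) ^ 2 / ‖x‖) * (ρ (0, x) - ρb))
    (hq₁ : ∀ l : ℝ, M₀ < l → l < M →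
      0 ≤ ∫ x in {y : E3 | l < ‖y‖},
        ((‖x‖ ^ 2 - l ^ 2) / ‖x‖ ^ 3) * ∑ i, x i * (ρ (0, x) * u (0, x) i)) : False := by
  have hMp := S.hM
  have ne0 : ∀ᵐ x : E3, x ≠ 0 := by
    rw [ae_iff]; simp
  have cp : Continuous fun x : E3 => ((0:ℝ), x) := by fun_prop
  have cf0 : Continuous fun x : E3 => ρ (0, x) - ρb := (S.cρ.continuous.comp cp).sub continuous_const
  have cm : ∀ i, Continuous fun x : E3 => ρ (0, x) * u (0, x) i := fun i =>
    (S.cρ.continuous.comp cp).mul ((S.cu i).continuous.comp cp)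
  have cx : ∀ i, Continuous fun x : E3 => x i := fun i => by fun_prop
  have cf1 : Continuous fun x : E3 => ∑ i, x i * (ρ (0, x) * u (0, x) i) :=
    continuous_finsetSum _ fun i _ => (cx i).mul (cm i)
  have z0 : ∀ x : E3, M < ‖x‖ → ρ (0, x) - ρb = 0 := fun x hx => by rw [(S.ini x hx).1, sub_self]
  have zm : ∀ i, ∀ x : E3, M < ‖x‖ → ρ (0, x) * u (0, x) i = 0 := fun i x hx => by rw [(S.ini x hx).2 i, mul_zero]
  have z1 : ∀ x : E3, M < ‖x‖ → ∑ i, x i * (ρ (0, x) * u (0, x) i) = 0 := fun x hx =>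
    Finset.sum_eq_zero fun i _ => by rw [zm i x hx, mul_zero]
  have bd : ∀ {g : E3 → ℝ}, Continuous g → (∀ x : E3, M < ‖x‖ → g x = 0) → ∃ B, 0 ≤ B ∧ ∀ x, |g x| ≤ B := by
    intro g hg hz
    obtain ⟨B, hB⟩ := (compactSupport_of hz).exists_bound_of_continuous hg
    exact ⟨B, (norm_nonneg _).trans (hB 0), hB⟩
  have igl : ∀ {g : E3 → ℝ}, Continuous g → (∀ x : E3, M < ‖x‖ → g x = 0) → Integrable g := fun hg hz =>
    hg.integrable_of_hasCompactSupport (compactSupport_of hz)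
  obtain ⟨B0, hB0, hb0⟩ := bd (g := fun x => ‖x‖ * (ρ (0, x) - ρb)) (continuous_norm.mul cf0) (fun x hx => by rw [z0 x hx, mul_zero])
  choose Bm hBm hbm using fun i => bd (cm i) (zm i)
  obtain ⟨i0, i0k⟩ := fub cf0 hMp hB0 z0 (fun x l => (‖x‖ - l) ^ 2 / ‖x‖) (by unfold Function.uncurry; fun_prop) (fun x l hl hlx => by
    refine le_trans ?_ (hb0 x)
    have hr : 0 < ‖x‖ := hl.trans hlx
    rw [abs_mul, abs_mul]
    refine mul_le_mul_of_nonneg_right ?_ (abs_nonneg _)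
    rw [abs_of_pos hr, abs_of_nonneg (by positivity), div_le_iff₀ hr]
    nlinarith)
  obtain ⟨i1, i1k⟩ := fub cf1 hMp (B := ∑ i, Bm i) (Finset.sum_nonneg fun i _ => hBm i) z1 (fun x l => (‖x‖ ^ 2 - l ^ 2) / ‖x‖ ^ 3) (by unfold Function.uncurry; fun_prop) (fun x l hl hlx => by
    have hr : 0 < ‖x‖ := hl.trans hlx
    have e1 : |(‖x‖ ^ 2 - l ^ 2) / ‖x‖ ^ 3| ≤ 1 / ‖x‖ := by
      rw [abs_of_nonneg (div_nonneg (by nlinarith) (by positivity)), div_le_div_iff₀ (by positivity) hr]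
      nlinarith [sq_nonneg l, mul_nonneg (sq_nonneg l) hr.le]
    have e2 : |∑ i, x i * (ρ (0, x) * u (0, x) i)| ≤ ‖x‖ * ∑ i, Bm i := by
      rw [Finset.mul_sum]
      refine (Finset.abs_sum_le_sum_abs _ _).trans (Finset.sum_le_sum fun i _ => ?_)
      rw [abs_mul]
      exact mul_le_mul (PiLp.norm_apply_le x i) (hbm i x) (abs_nonneg _) (norm_nonneg _)
    rw [abs_mul]
    refine (mul_le_mul e1 e2 (abs_nonneg _) (by positivity)).trans (le_of_eq ?_)
    field_simp)
  obtain ⟨k, hk1, P, Q⟩ := init_exists hM₀ hM (∫ x, (ρ (0, x) - ρb)) i0 i1 (fun k => (i0k k).1) (fun k => (i1k k).1) hq₀ hq₁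
  have hk : 0 < k := by linarith
  obtain ⟨φ, hφ⟩ := exists_testFn k hk
  have cφ : Continuous φ := hφ.c1.continuous
  have eI : Sol.II ρb ρ φ 0 = (∫ x, (ρ (0, x) - ρb)) + k ^ 2 / 2 * ∫ x, (ρ (0, x) - ρb) * ∫ l in (0:ℝ)..‖x‖, cosh (k * l) * ((‖x‖ - l) ^ 2 / ‖x‖) := by
    have j1 : Integrable fun x => (ρ (0, x) - ρb) * φ x := igl (cf0.mul cφ) fun x hx => by rw [z0 x hx, zero_mul]
    have j2 : Integrable fun x => ρ (0, x) - ρb := igl cf0 z0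
    rw [← integral_const_mul, ← sub_eq_iff_eq_add']
    unfold Sol.II
    rw [← integral_sub j1 j2]
    refine integral_congr_ae ?_
    filter_upwards [ne0] with x hx
    rw [pt_ii hk hφ hx]; ring
  have eY : Sol.YY ρ u φ 0 = k ^ 2 / 2 * ∫ x, (∑ i, x i * (ρ (0, x) * u (0, x) i)) * ∫ l in (0:ℝ)..‖x‖, cosh (k * l) * ((‖x‖ ^ 2 - l ^ 2) / ‖x‖ ^ 3) := by
    unfold Sol.YY
    rw [← integral_const_mul, ← integral_finsetSum]
    · refine integral_congr_ae ?_
      filter_upwards [ne0] with x hx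
      rw [Finset.sum_mul, Finset.mul_sum]
      refine Finset.sum_congr rfl fun j _ => ?_
      rw [pt_yy hk hφ hx]; ring
    · intro j _
      exact igl ((cm j).mul (continuous_pd j hφ.c1)) fun x hx => by rw [zm j x hx, zero_mul]
  rw [(i0k k).2] at P Q
  rw [(i1k k).2] at Q
  rw [← eI] at P Q
  rw [← eY] at Q
  exact S.contra hlam hk hφ P Q

/-- **Blowup for λ > 1** (Theorem 1.2): if `supp ρ₀, supp u₀ ⊆ {|x| ≤ M}`, the quantities
`q₀(l) = ∫_{|x|>l} ((|x|-l)²/|x|)(ρ(0,x) - ρ̄) dx > 0` and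
`q₁(l) = ∫_{|x|>l} ((|x|²-l²)/|x|³) x·(ρu)(0,x) dx ≥ 0` for all `l ∈ (M₀, M)`,
`μ > 0` and `λ > 1`, then there is `ε₀ > 0` such that for all `0 < ε ≤ ε₀` there is no
global smooth solution `(ρ, u)` on `[0,∞) × ℝ³`. -/
theorem blowup_small_data
    (A γ μ lam ρb M M₀ : ℝ) (hA : 0 < A) (hγ : 1 < γ) (hμ : 0 < μ)
    (hlam : 1 < lam) (hρb : 0 < ρb) (hM₀ : 0 ≤ M₀) (hM : M₀ < M)
    (hsound : A * γ * ρb ^ (γ - 1) = 1)  -- normalization c(ρ̄) = 1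
    (ρ₀ : E3 → ℝ) (u₀ : E3 → Fin 3 → ℝ)
    (hρ₀ : ContDiff ℝ (⊤ : ℕ∞) ρ₀) (hu₀ : ContDiff ℝ (⊤ : ℕ∞) u₀)
    (hρ₀c : HasCompactSupport ρ₀) (hu₀c : HasCompactSupport u₀)
    (hsupp : ∀ x : E3, M < ‖x‖ → ρ₀ x = 0 ∧ u₀ x = 0)
    (hnontriv : ¬(ρ₀ = 0 ∧ u₀ = 0))
    (hq₀ : ∀ ε : ℝ, 0 < ε → ∀ l : ℝ, M₀ < l → l < M →
      0 < ∫ x in {y : E3 | l < ‖y‖}, ((‖x‖ - l) ^ 2 / ‖x‖) * (ε * ρ₀ x))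
    (hq₁ : ∀ ε : ℝ, 0 < ε → ∀ l : ℝ, M₀ < l → l < M →
      0 ≤ ∫ x in {y : E3 | l < ‖y‖},
        ((‖x‖ ^ 2 - l ^ 2) / ‖x‖ ^ 3) * ∑ i, x i * ((ρb + ε * ρ₀ x) * (ε * u₀ x i))) :
    ∃ ε₀ > 0, ∀ ε : ℝ, 0 < ε → ε ≤ ε₀ →
      ¬ ∃ (ρ : Pt → ℝ) (u : Pt → Fin 3 → ℝ),
          ContDiff ℝ (⊤ : ℕ∞) ρ ∧ ContDiff ℝ (⊤ : ℕ∞) u ∧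
          (∀ x : E3, ρ (0, x) = ρb + ε * ρ₀ x) ∧
          (∀ (x : E3) (i : Fin 3), u (0, x) i = ε * u₀ x i) ∧
          (∀ q : Pt, 0 ≤ q.1 → eulerDamped A γ μ lam ρ u q) ∧
          (∀ q : Pt, 0 ≤ q.1 → 0 < ρ q) := by
  refine ⟨1, one_pos, fun ε hε _ => ?_⟩
  rintro ⟨ρ, u, hρ, hu, hρ0, hu0, hpde, hpos⟩
  have S : Sol A γ μ lam ρb M ρ u :=
    { hA := hA
      hγ := hγ
      hμ := hμ
      hρb := hρb
      hM := hM₀.trans_lt hM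
      hs := hsound
      cρ := hρ.of_le (by exact_mod_cast le_top)
      cu := fun i => (contDiff_pi.1 hu i).of_le (by exact_mod_cast le_top)
      ini := fun x hx => ⟨by rw [hρ0, (hsupp x hx).1]; ring, fun i => by rw [hu0, (hsupp x hx).2]; simp⟩
      pde := hpde
      pos := hpos }
  refine final_step S hlam hM₀ hM (fun l h1 h2 => ?_) (fun l h1 h2 => ?_)
  · have := hq₀ ε hε l h1 h2
    simpa only [hρ0, add_sub_cancel_left] using this
  · have := hq₁ ε hε l h1 h2
    simpa only [hρ0, hu0] using this
end
end

section
/- Suppose L(0) ≥ 0 and there exists T* > 0 such that H(0) · ∫₀^{T*} dτ/(α(τ)β(τ)) > 1. Then for every T > 0, every C¹ solution (ρ, u) of the damped compressible Euler system on [0,T]×ℝ³ with ρ > 0 and with ρ(t,·) − ρ̄ and u(t,·) supported in {|x| ≤ t + M} for each t ∈ [0,T], satisfies T < T*. -/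
noncomputable section
open MeasureTheory Real Set

theorem aux_deriv (w : E3 → ℝ) (hw : Continuous w) (F : Pt → ℝ) (hF : ContDiff ℝ 1 F) (R t : ℝ) :
    HasDerivAt (fun s => ∫ x in Metric.closedBall (0:E3) R, w x * F (s, x))
      (∫ x in Metric.closedBall (0:E3) R, w x * dt F (t, x)) t := by
  have hdt : Continuous (fun q : Pt => dt F q) := by
    unfold dt
    exact (hF.continuous_fderiv (by norm_num)).clm_apply continuous_const
  have hFc := hF.continuous
  have hK : IsCompact (Metric.closedBall t 1 ×ˢ Metric.closedBall (0:E3) R) :=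
    (isCompact_closedBall t 1).prod (isCompact_closedBall _ _)
  obtain ⟨C, hC⟩ := hK.exists_bound_of_continuousOn
    (f := fun q : Pt => w q.2 * dt F q) (by fun_prop)
  have hfin : IsFiniteMeasure (volume.restrict (Metric.closedBall (0:E3) R)) :=
    ⟨by rw [Measure.restrict_apply_univ]; exact measure_closedBall_lt_top⟩
  refine (hasDerivAt_integral_of_dominated_loc_of_deriv_le (s := Metric.closedBall t 1)
    (bound := fun _ => C) (F' := fun s x => w x * dt F (s, x))
    (Metric.closedBall_mem_nhds t one_pos) ?_ ?_ ?_ ?_ ?_ ?_).2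
  · refine Filter.Eventually.of_forall fun s => ?_
    exact (by fun_prop : Continuous fun x => w x * F (s, x)).aestronglyMeasurable
  · exact (by fun_prop : Continuous fun x => w x * F (t, x)).continuousOn.integrableOn_compact
      (isCompact_closedBall _ _)
  · exact (by fun_prop : Continuous fun x => w x * dt F (t, x)).aestronglyMeasurable
  · refine (ae_restrict_mem measurableSet_closedBall).mono fun x hx s hs => ?_
    exact hC (s, x) ⟨hs, hx⟩
  · exact integrable_const _
  · refine Filter.Eventually.of_forall fun x s _ => ?_
    have h1 : HasFDerivAt F (fderiv ℝ F (s, x)) (s, x) :=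
      (hF.differentiable (by norm_num) _).hasFDerivAt
    have h2 : HasDerivAt (fun s : ℝ => ((s, x) : Pt)) (1, 0) s :=
      (hasDerivAt_id s).prodMk (hasDerivAt_const s x)
    exact (h1.comp_hasDerivAt s h2).const_mul (w x)

theorem aux_slice (i : Fin 3) (F : Pt → ℝ) (t : ℝ) (x : E3) (hF : DifferentiableAt ℝ F (t, x)) :
    dxi i F (t, x) = pd i (fun y => F (t, y)) x := by
  have h2 : HasFDerivAt (fun y : E3 => ((t, y) : Pt)) (ContinuousLinearMap.inr ℝ ℝ E3) x :=
    hasFDerivAt_prodMk_right t x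
  have := (hF.hasFDerivAt.comp x h2).fderiv
  unfold dxi pd
  change _ = (fderiv ℝ (F ∘ fun y : E3 => ((t, y) : Pt)) x) _
  rw [this]; simp

theorem aux_pd_zero (i : Fin 3) (f : E3 → ℝ) (R : ℝ) (h0 : ∀ x, R < ‖x‖ → f x = 0) :
    ∀ x, R < ‖x‖ → pd i f x = 0 := by
  intro x hx
  have : f =ᶠ[nhds x] fun _ => 0 := by
    filter_upwards [(isOpen_lt continuous_const continuous_norm).mem_nhds hx] with y hy
    exact h0 y hy
  unfold pd
  rw [this.fderiv_eq]; simp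

theorem aux_set (g : E3 → ℝ) (R : ℝ) (h0 : ∀ x, R < ‖x‖ → g x = 0) :
    ∫ x in Metric.closedBall (0:E3) R, g x = ∫ x, g x := by
  apply setIntegral_eq_integral_of_forall_compl_eq_zero
  intro x hx
  apply h0
  simpa using hx

theorem aux_int (g : E3 → ℝ) (hg : Continuous g) (R : ℝ) (h0 : ∀ x, R < ‖x‖ → g x = 0) :
    Integrable g := by
  refine hg.integrable_of_hasCompactSupport ?_
  refine HasCompactSupport.intro (isCompact_closedBall (0:E3) R) fun x hx => ?_
  apply h0
  simpa using hx

theorem aux_pd_cont (i : Fin 3) (f : E3 → ℝ) (hf : ContDiff ℝ 1 f) : Continuous (pd i f) := by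
  unfold pd
  exact (hf.continuous_fderiv (by norm_num)).clm_apply continuous_const

theorem aux_ibp0 (i : Fin 3) (f : E3 → ℝ) (hf : ContDiff ℝ 1 f) (R : ℝ)
    (h0 : ∀ x, R < ‖x‖ → f x = 0) :
    ∫ x, pd i f x = 0 := by
  have h := integral_mul_fderiv_eq_neg_fderiv_mul_of_integrable (μ := (volume : Measure E3))
    (f := fun _ : E3 => (1:ℝ)) (g := f) (v := EuclideanSpace.single i 1)
    (by simp)
    (by simpa [pd] using aux_int (fun x => pd i f x) (aux_pd_cont i f hf) R (aux_pd_zero i f R h0))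
    (by simpa using aux_int _ hf.continuous R h0)
    (fun _ _ => by fun_prop) (fun x _ => hf.differentiable (by norm_num) x)
  simpa [pd] using h

theorem aux_ibp (i j : Fin 3) (f : E3 → ℝ) (hf : ContDiff ℝ 1 f) (R : ℝ)
    (h0 : ∀ x, R < ‖x‖ → f x = 0) :
    ∫ x, x j * pd i f x = - (if i = j then ∫ x, f x else 0) := by
  have hj : ∀ x : E3, pd i (fun y : E3 => y j) x = if i = j then 1 else 0 := by
    intro x
    unfold pd
    have : HasFDerivAt (fun y : E3 => y j) (EuclideanSpace.proj j : E3 →L[ℝ] ℝ) x :=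
      (EuclideanSpace.proj j : E3 →L[ℝ] ℝ).hasFDerivAt
    rw [this.fderiv]
    simp [eq_comm]
  have hjd : Differentiable ℝ (fun y : E3 => y j) := (EuclideanSpace.proj j : E3 →L[ℝ] ℝ).differentiable
  have hjc : Continuous (fun y : E3 => y j) := hjd.continuous
  have h := integral_mul_fderiv_eq_neg_fderiv_mul_of_integrable (μ := (volume : Measure E3))
    (f := fun y : E3 => y j) (g := f) (v := EuclideanSpace.single i 1)
    (by
      change Integrable (fun x => pd i (fun y : E3 => y j) x * f x) _
      simp_rw [hj]
      exact aux_int _ (continuous_const.mul hf.continuous) R fun x hx => by simp [h0 x hx])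
    (aux_int _ (hjc.mul (aux_pd_cont i f hf)) R
      fun x hx => by
        change x j * pd i f x = 0
        simp [aux_pd_zero i f R h0 x hx])
    (aux_int _ (hjc.mul hf.continuous) R fun x hx => by simp [h0 x hx])
    (fun x _ => hjd x) (fun x _ => hf.differentiable (by norm_num) x)
  change ∫ x, x j * pd i f x = - ∫ x, pd i (fun y : E3 => y j) x * f x at h
  rw [h]
  simp_rw [hj]
  split_ifs <;> simp

theorem aux_vol (r : ℝ) (hr : 0 ≤ r) :
    volume.real (Metric.closedBall (0:E3) r) = 4 * π / 3 * r ^ 3 := by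
  rw [Measure.real, EuclideanSpace.volume_closedBall_fin_three]
  rw [ENNReal.toReal_mul, ENNReal.toReal_pow, ENNReal.toReal_ofReal hr, ENNReal.toReal_ofReal (by positivity)]
  ring

theorem aux_convex (A γ ρb r : ℝ) (hA : 0 < A) (hγ : 1 < γ) (hρb : 0 < ρb)
    (hs : A * γ * ρb ^ (γ - 1) = 1) (hr : 0 < r) :
    r - ρb ≤ A * r ^ γ - A * ρb ^ γ := by
  have h := one_add_mul_self_le_rpow_one_add (s := r / ρb - 1) (p := γ)
    (by have : 0 < r / ρb := by positivity
        linarith) hγ.le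
  rw [show 1 + (r / ρb - 1) = r / ρb by ring, Real.div_rpow hr.le hρb.le] at h
  have hp : 0 < ρb ^ γ := Real.rpow_pos_of_pos hρb _
  rw [Real.rpow_sub_one hρb.ne'] at hs
  rw [le_div_iff₀ hp] at h
  have h3 : A * ((1 + γ * (r / ρb - 1)) * ρb ^ γ) ≤ A * r ^ γ := by gcongr
  have h4 : A * ((1 + γ * (r / ρb - 1)) * ρb ^ γ) = A * ρb ^ γ + (A * γ * (ρb ^ γ / ρb)) * (r - ρb) := by
    field_simp
  rw [h4, hs] at h3
  linarith

theorem aux_beta (μ lam : ℝ) (β : ℝ → ℝ) (hβ0 : β 0 = 1)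
    (hβ : ∀ t : ℝ, 0 ≤ t → HasDerivAt β (μ / (1 + t) ^ lam * β t) t) (t : ℝ) (ht : 0 ≤ t) :
    0 < β t := by
  let c : ℝ → ℝ := fun t => μ / (1 + max t 0) ^ lam
  have hpos : ∀ t : ℝ, 0 < 1 + max t 0 := fun t => by positivity
  have hc : Continuous c := by
    refine continuous_const.div ?_ fun t => (Real.rpow_pos_of_pos (hpos t) _).ne'
    exact Continuous.rpow_const (by fun_prop) fun t => Or.inl (hpos t).ne'
  have hC : ∀ t, HasDerivAt (fun t => ∫ s in (0:ℝ)..t, c s) (c t) t := fun t =>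
    hc.integral_hasStrictDerivAt 0 t |>.hasDerivAt
  have hD : ∀ s, 0 ≤ s → HasDerivAt (fun t => β t * Real.exp (-∫ s in (0:ℝ)..t, c s)) 0 s := by
    intro s hs
    have hcs : c s = μ / (1 + s) ^ lam := by simp only [c, max_eq_left hs]
    have h := (hβ s hs).fun_mul ((hC s).fun_neg.exp)
    rw [hcs] at h
    refine h.congr_deriv ?_
    ring
  have := constant_of_has_deriv_right_zero (a := 0) (b := t)
    (f := fun t => β t * Real.exp (-∫ s in (0:ℝ)..t, c s))
    (fun s hs => (hD s hs.1).continuousAt.continuousWithinAt)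
    (fun s hs => (hD s hs.1).hasDerivWithinAt) t ⟨ht, le_rfl⟩
  simp [hβ0] at this
  by_contra! hn
  have := mul_nonpos_of_nonpos_of_nonneg hn (Real.exp_pos (-∫ s in (0:ℝ)..t, c s)).le
  linarith

theorem aux_massflux (R t : ℝ) (ρ : Pt → ℝ) (u : Pt → Fin 3 → ℝ)
    (hρ : ContDiff ℝ 1 ρ) (hu : ContDiff ℝ 1 u)
    (hsupp : ∀ x : E3, R < ‖x‖ → u (t, x) = 0)
    (hsol : ∀ x : E3, dt ρ (t, x) + ∑ i, dxi i (fun z => ρ z * u z i) (t, x) = 0) :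
    ∫ x in Metric.closedBall (0:E3) R, dt ρ (t, x) = 0 := by
  have hui : ∀ i, ContDiff ℝ 1 (fun z => u z i) := fun i => (contDiff_pi.1 hu i)
  have hF : ∀ i, ContDiff ℝ 1 (fun z => ρ z * u z i) := fun i => hρ.mul (hui i)
  have hf : ∀ i, ContDiff ℝ 1 (fun x : E3 => ρ (t, x) * u (t, x) i) := fun i =>
    (hF i).comp (contDiff_const.prodMk contDiff_id)
  have h0 : ∀ i, ∀ x : E3, R < ‖x‖ → ρ (t, x) * u (t, x) i = 0 := fun i x hx => by
    simp [hsupp x hx]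
  have e : ∀ x : E3, dt ρ (t, x) = - ∑ i, pd i (fun x : E3 => ρ (t, x) * u (t, x) i) x := by
    intro x
    have h := hsol x
    have : ∀ i, dxi i (fun z => ρ z * u z i) (t, x) = pd i (fun x : E3 => ρ (t, x) * u (t, x) i) x :=
      fun i => aux_slice i _ t x ((hF i).differentiable (by norm_num) _)
    simp_rw [this] at h
    linarith
  simp_rw [e]
  rw [aux_set _ R fun x hx => by simp [aux_pd_zero _ _ R (h0 _) x hx], integral_neg,
    integral_finsetSum _ fun i _ => aux_int _ (aux_pd_cont i _ (hf i)) R (aux_pd_zero i _ R (h0 i))]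
  simp [aux_ibp0 _ _ (hf _) R (h0 _)]

theorem aux_momflux (A γ c ρb R t : ℝ) (ρ : Pt → ℝ) (u : Pt → Fin 3 → ℝ)
    (hρ : ContDiff ℝ 1 ρ) (hu : ContDiff ℝ 1 u)
    (hpos : ∀ x : E3, 0 < ρ (t, x))
    (hsupp : ∀ x : E3, R < ‖x‖ → ρ (t, x) = ρb ∧ u (t, x) = 0) (j : Fin 3)
    (hsol : ∀ x : E3, dt (fun z => ρ z * u z j) (t, x)
      + ∑ i, dxi i (fun z => ρ z * u z i * u z j + (if i = j then A * ρ z ^ γ else 0)) (t, x)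
      = -c * (ρ (t, x) * u (t, x) j)) :
    ∫ x in Metric.closedBall (0:E3) R, x j * dt (fun z => ρ z * u z j) (t, x) =
      (∫ x : E3, (ρ (t, x) * u (t, x) j * u (t, x) j + (A * ρ (t, x) ^ γ - A * ρb ^ γ)))
        - c * ∫ x : E3, x j * (ρ (t, x) * u (t, x) j) := by
  have hui : ∀ i, ContDiff ℝ 1 (fun z => u z i) := fun i => (contDiff_pi.1 hu i)
  have hs : ContDiff ℝ 1 (fun x : E3 => ((t, x) : Pt)) := contDiff_const.prodMk contDiff_id
  have hρs : ContDiff ℝ 1 (fun x : E3 => ρ (t, x)) := hρ.comp hs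
  have hus : ∀ i, ContDiff ℝ 1 (fun x : E3 => u (t, x) i) := fun i => (hui i).comp hs
  let f : Fin 3 → E3 → ℝ := fun i x => ρ (t, x) * u (t, x) i * u (t, x) j +
    (if i = j then A * ρ (t, x) ^ γ - A * ρb ^ γ else 0)
  have hf : ∀ i, ContDiff ℝ 1 (f i) := by
    intro i
    refine ((hρs.mul (hus i)).mul (hus j)).add ?_
    by_cases hij : i = j
    · simp only [hij, if_true]
      exact (contDiff_const.mul (hρs.rpow_const_of_ne fun x => (hpos x).ne')).sub contDiff_const
    · simp only [hij, if_false]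
      exact contDiff_const
  have h0 : ∀ i, ∀ x : E3, R < ‖x‖ → f i x = 0 := fun i x hx => by
    simp [f, hsupp x hx]
  have e : ∀ x : E3, x j * dt (fun z => ρ z * u z j) (t, x) =
      - (∑ i, x j * pd i (f i) x) - c * (x j * (ρ (t, x) * u (t, x) j)) := by
    intro x
    have h := hsol x
    have : ∀ i, dxi i (fun z => ρ z * u z i * u z j + (if i = j then A * ρ z ^ γ else 0)) (t, x)
        = pd i (f i) x := by
      intro i
      rw [aux_slice i _ t x]
      · unfold pd
        have : f i = fun y => (ρ (t, y) * u (t, y) i * u (t, y) j +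
          (if i = j then A * ρ (t, y) ^ γ else 0)) - (if i = j then A * ρb ^ γ else 0) := by
          funext y
          simp only [f]
          split_ifs <;> ring
        rw [this, fderiv_sub_const]
      · refine DifferentiableAt.add ?_ ?_
        · exact ((hρ.mul (hui i)).mul (hui j)).differentiable (by norm_num) _
        · by_cases hij : i = j
          · simp only [hij, if_true]
            exact ((hρ.differentiable (by norm_num) _).rpow_const (Or.inl (hpos x).ne')).const_mul A
          · simp only [hij, if_false]
            exact differentiableAt_const _
    simp_rw [this] at h
    rw [← Finset.mul_sum]
    linear_combination (x j) * h
  have hjc : Continuous (fun y : E3 => y j) := (EuclideanSpace.proj j : E3 →L[ℝ] ℝ).continuous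
  have hi1 : ∀ i, Integrable (fun x : E3 => x j * pd i (f i) x) := fun i =>
    aux_int _ (hjc.mul (aux_pd_cont i _ (hf i))) R
      fun x hx => by simp [aux_pd_zero i _ R (h0 i) x hx]
  have hi2 : Integrable (fun x : E3 => x j * (ρ (t, x) * u (t, x) j)) :=
    aux_int _ (hjc.mul (hρs.continuous.mul (hus j).continuous)) R
      fun x hx => by simp [hsupp x hx]
  simp_rw [e]
  rw [aux_set _ R fun x hx => by simp [aux_pd_zero _ _ R (h0 _) x hx, hsupp x hx],
    integral_sub (f := fun x : E3 => -∑ i, x j * pd i (f i) x)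
      (integrable_finsetSum _ fun i _ => hi1 i).neg (hi2.const_mul c), integral_neg,
    integral_finsetSum _ fun i _ => hi1 i, integral_const_mul]
  simp_rw [aux_ibp _ j _ (hf _) R (h0 _)]
  congr 1
  simp [f]

theorem aux_ineq (A γ ρb r L : ℝ) (hA : 0 < A) (hγ : 1 < γ) (hρb : 0 < ρb) (hr : 0 < r)
    (hs : A * γ * ρb ^ (γ - 1) = 1)
    (ρ : E3 → ℝ) (u : E3 → Fin 3 → ℝ) (hρ : Continuous ρ) (hu : Continuous u)
    (hpos : ∀ x, 0 < ρ x) (hsupp : ∀ x : E3, r < ‖x‖ → ρ x = ρb ∧ u x = 0)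
    (hL : ∫ x, (ρ x - ρb) = L) (hL0 : 0 ≤ L) :
    (∑ j, ∫ x : E3, x j * (ρ x * u x j)) ^ 2 / (r ^ 2 * (L + 4 * π ^ 2 * ρb / 3 * r ^ 3)) ≤
      ∑ j, ∫ x : E3, (ρ x * u x j * u x j + (A * ρ x ^ γ - A * ρb ^ γ)) := by
  set α := r ^ 2 * (L + 4 * π ^ 2 * ρb / 3 * r ^ 3) with hα
  have hα0 : 0 < α := by positivity
  have hui : ∀ i, Continuous (fun z => u z i) := fun i => (continuous_pi_iff.1 hu i)
  have hjc : ∀ j, Continuous (fun y : E3 => y j) := fun j =>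
    (EuclideanSpace.proj j : E3 →L[ℝ] ℝ).continuous
  have hi1 : ∀ j, Integrable (fun x : E3 => x j * (ρ x * u x j)) := fun j =>
    aux_int _ ((hjc j).mul (hρ.mul (hui j))) r fun x hx => by simp [hsupp x hx]
  have hi2 : ∀ j, Integrable (fun x : E3 => ρ x * u x j * u x j) := fun j =>
    aux_int _ ((hρ.mul (hui j)).mul (hui j)) r fun x hx => by simp [hsupp x hx]
  have hi3 : Integrable (fun x : E3 => A * ρ x ^ γ - A * ρb ^ γ) :=
    aux_int _ ((continuous_const.mul (hρ.rpow_const fun x => Or.inl (hpos x).ne')).sub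
      continuous_const) r fun x hx => by simp [hsupp x hx]
  have hi4 : Integrable (fun x : E3 => ρ x - ρb) :=
    aux_int _ (hρ.sub continuous_const) r fun x hx => by simp [hsupp x hx]
  have hP : 0 ≤ ∫ x : E3, (A * ρ x ^ γ - A * ρb ^ γ) := by
    have := integral_mono hi4 hi3 fun x => aux_convex A γ ρb (ρ x) hA hγ hρb hs (hpos x)
    linarith
  have e1 : ∑ j, ∫ x : E3, (ρ x * u x j * u x j + (A * ρ x ^ γ - A * ρb ^ γ)) =
      (∫ x : E3, ∑ j, ρ x * u x j * u x j) + 3 * ∫ x : E3, (A * ρ x ^ γ - A * ρb ^ γ) := by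
    rw [integral_finsetSum _ fun j _ => hi2 j]
    simp_rw [fun j => integral_add (hi2 j) hi3]
    rw [Finset.sum_add_distrib]
    simp
  have e2 : ∑ j, ∫ x : E3, x j * (ρ x * u x j) = ∫ x : E3, ∑ j, x j * (ρ x * u x j) := by
    rw [integral_finsetSum _ fun j _ => hi1 j]
  set H := ∑ j, ∫ x : E3, x j * (ρ x * u x j) with hH
  let B := Metric.closedBall (0:E3) r
  have hB : IsCompact B := isCompact_closedBall _ _
  have m : ∫ x in B, ρ x = L + 4 * π / 3 * r ^ 3 * ρb := by
    have : ∫ x in B, (ρ x - ρb) = L := by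
      rw [← hL]; exact aux_set _ r fun x hx => by simp [hsupp x hx]
    rw [integral_sub (hρ.continuousOn.integrableOn_compact hB)
      (continuousOn_const.integrableOn_compact hB), setIntegral_const, aux_vol r hr.le] at this
    simp only [smul_eq_mul] at this
    linarith
  have key : ∀ s : ℝ, 2 * s * H - s ^ 2 * r ^ 2 * (L + 4 * π / 3 * r ^ 3 * ρb) ≤
      ∫ x : E3, ∑ j, ρ x * u x j * u x j := by
    intro s
    rw [e2, ← m, ← aux_set (fun x : E3 => ∑ j, x j * (ρ x * u x j)) r
      fun x hx => by simp [hsupp x hx],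
      ← aux_set (fun x : E3 => ∑ j, ρ x * u x j * u x j) r fun x hx => by simp [hsupp x hx],
      ← integral_const_mul, ← integral_const_mul]
    have c1 : Continuous fun x : E3 => 2 * s * ∑ j, x j * (ρ x * u x j) := by fun_prop
    have c2 : Continuous fun x : E3 => s ^ 2 * r ^ 2 * ρ x := by fun_prop
    have c3 : Continuous fun x : E3 => ∑ j, ρ x * u x j * u x j := by fun_prop
    rw [← integral_sub (c1.continuousOn.integrableOn_compact hB)
      (c2.continuousOn.integrableOn_compact hB)]
    refine setIntegral_mono_on ((c1.sub c2).continuousOn.integrableOn_compact hB)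
      (c3.continuousOn.integrableOn_compact hB) measurableSet_closedBall fun x hx => ?_
    have hx' : ‖x‖ ≤ r := by simpa [B] using hx
    have hn : x 0 ^ 2 + x 1 ^ 2 + x 2 ^ 2 ≤ r ^ 2 := by
      have : ‖x‖ ^ 2 ≤ r ^ 2 := by gcongr
      rw [EuclideanSpace.norm_sq_eq] at this
      simpa [Fin.sum_univ_three] using this
    simp only [Fin.sum_univ_three]
    have h1 : 0 ≤ ρ x * ((u x 0 - s * x 0) ^ 2 + (u x 1 - s * x 1) ^ 2 + (u x 2 - s * x 2) ^ 2) :=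
      mul_nonneg (hpos x).le (by positivity)
    have h2 : 0 ≤ ρ x * s ^ 2 * (r ^ 2 - (x 0 ^ 2 + x 1 ^ 2 + x 2 ^ 2)) :=
      mul_nonneg (mul_nonneg (hpos x).le (by positivity)) (by linarith)
    nlinarith [h1, h2]
  have hα2 : r ^ 2 * (L + 4 * π / 3 * r ^ 3 * ρb) ≤ α := by
    rw [hα]
    refine mul_le_mul_of_nonneg_left ?_ (by positivity)
    have : π ≤ π ^ 2 := by nlinarith [Real.pi_gt_three]
    have : π * (r ^ 3 * ρb) ≤ π ^ 2 * (r ^ 3 * ρb) := by gcongr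
    linarith
  have k := key (H / α)
  rw [e1]
  have h5 : (H / α) ^ 2 * (r ^ 2 * (L + 4 * π / 3 * r ^ 3 * ρb)) ≤ (H / α) ^ 2 * α := by gcongr
  have h6 : (H / α) ^ 2 * α = H ^ 2 / α := by field_simp
  have h7 : 2 * (H / α) * H = 2 * (H ^ 2 / α) := by ring
  linarith

theorem aux_ode (T : ℝ) (hT : 0 < T) (H H' c a β : ℝ → ℝ)
    (hH : ∀ t ∈ Icc 0 T, HasDerivAt H (H' t) t)
    (hβ : ∀ t ∈ Icc 0 T, HasDerivAt β (c t * β t) t) (hβ0 : β 0 = 1)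
    (hβp : ∀ t ∈ Icc 0 T, 0 < β t) (ha : ∀ t ∈ Icc 0 T, 0 < a t) (hac : ContinuousOn a (Icc 0 T))
    (hin : ∀ t ∈ Icc 0 T, H t ^ 2 / a t - c t * H t ≤ H' t)
    (h1 : 1 < H 0 * ∫ τ in (0:ℝ)..T, 1 / (a τ * β τ)) : False := by
  have hG : ∀ t ∈ Icc 0 T, HasDerivAt (fun t => β t * H t) (c t * β t * H t + β t * H' t) t :=
    fun t ht => (hβ t ht).mul (hH t ht)
  have hGc : ContinuousOn (fun t => β t * H t) (Icc 0 T) :=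
    fun t ht => (hG t ht).continuousAt.continuousWithinAt
  have hGi : ∀ t ∈ Icc 0 T, (β t * H t) ^ 2 / (a t * β t) ≤ c t * β t * H t + β t * H' t := by
    intro t ht
    have hb := hβp t ht
    have hat := ha t ht
    have := mul_le_mul_of_nonneg_left (hin t ht) hb.le
    have e : (β t * H t) ^ 2 / (a t * β t) = β t * (H t ^ 2 / a t) := by field_simp
    rw [e]; linarith
  have hIpos : 0 ≤ ∫ τ in (0:ℝ)..T, 1 / (a τ * β τ) :=
    intervalIntegral.integral_nonneg hT.le fun t ht =>
      (one_div_pos.2 (mul_pos (ha t ht) (hβp t ht))).le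
  have hH0 : 0 < H 0 := by
    by_contra! hn
    nlinarith [mul_nonpos_of_nonpos_of_nonneg hn hIpos]
  have hmono : MonotoneOn (fun t => β t * H t) (Icc 0 T) := by
    refine monotoneOn_of_hasDerivWithinAt_nonneg (convex_Icc 0 T) hGc
      (fun t ht => (hG t (interior_subset ht)).hasDerivWithinAt) fun t ht => ?_
    have ht := interior_subset ht
    exact le_trans (div_nonneg (sq_nonneg _) (mul_pos (ha t ht) (hβp t ht)).le) (hGi t ht)
  have h0m : (0:ℝ) ∈ Icc 0 T := ⟨le_rfl, hT.le⟩
  have hGp : ∀ t ∈ Icc 0 T, 0 < β t * H t := by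
    intro t ht
    have := hmono h0m ht ht.1
    simp only [hβ0, one_mul] at this
    linarith
  have hβc : ContinuousOn β (Icc 0 T) := fun t ht => (hβ t ht).continuousAt.continuousWithinAt
  have := intervalIntegral.integral_le_sub_of_hasDeriv_right_of_le (a := 0) (b := T)
    (g := fun t => -(β t * H t)⁻¹) (φ := fun τ => 1 / (a τ * β τ))
    (g' := fun t => -(-(c t * β t * H t + β t * H' t) / (β t * H t) ^ 2)) hT.le
    ((hGc.inv₀ fun t ht => (hGp t ht).ne').neg)
    (fun t ht => (((hG t (Ioo_subset_Icc_self ht)).inv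
      (hGp t (Ioo_subset_Icc_self ht)).ne').neg).hasDerivWithinAt)
    ((continuousOn_const.div (hac.mul hβc) fun t ht =>
      (mul_pos (ha t ht) (hβp t ht)).ne').integrableOn_compact isCompact_Icc)
    (fun t ht => by
      have ht := Ioo_subset_Icc_self ht
      have hg := hGp t ht
      have h := hGi t ht
      have hab := mul_pos (ha t ht) (hβp t ht)
      have e : -(-(c t * β t * H t + β t * H' t) / (β t * H t) ^ 2) =
        (c t * β t * H t + β t * H' t) / (β t * H t) ^ 2 := by ring
      rw [e, le_div_iff₀ (by positivity)]
      rw [one_div_mul_eq_div]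
      exact h)
  simp only [hβ0, one_mul] at this
  have hTp : 0 < (β T * H T)⁻¹ := inv_pos.2 (hGp T ⟨hT.le, le_rfl⟩)
  have h2 : (∫ τ in (0:ℝ)..T, 1 / (a τ * β τ)) < (H 0)⁻¹ := by linarith
  have h3 := mul_lt_mul_of_pos_left h2 hH0
  rw [mul_inv_cancel₀ hH0.ne'] at h3
  linarith

/-- **Blowup for large data** (Theorem 4.1): with `L(0) = ∫ (ρ(0,x) - ρ̄) dx ≥ 0`,
`H(0) = ∫ x·(ρu)(0,x) dx`, `α(t) = (t+M)²(L(0) + (4π²ρ̄/3)(t+M)³)` and `β` the solution of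
`β' = (μ/(1+t)^λ)β`, `β(0) = 1`: if `H(0)·∫₀^{T*} dτ/(α(τ)β(τ)) > 1` for some `T* > 0`,
then every C¹ solution `(ρ, u)` on `[0,T] × ℝ³` (with `ρ > 0` and `ρ - ρ̄`, `u` supported
in `{|x| ≤ t + M}`) satisfies `T < T*`. -/
theorem blowup_large_data
    (A γ μ lam ρb M T : ℝ) (hA : 0 < A) (hγ : 1 < γ) (hμ : 0 < μ)
    (hlam : 0 ≤ lam) (hρb : 0 < ρb) (hM : 0 < M) (hT : 0 ≤ T)
    (hsound : A * γ * ρb ^ (γ - 1) = 1)  -- normalization c(ρ̄) = 1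
    (ρ : Pt → ℝ) (u : Pt → Fin 3 → ℝ)
    (hρ : ContDiff ℝ 1 ρ) (hu : ContDiff ℝ 1 u)
    (hpos : ∀ q : Pt, q.1 ∈ Icc 0 T → 0 < ρ q)
    (hsupp : ∀ t ∈ Icc 0 T, ∀ x : E3, t + M < ‖x‖ → ρ (t, x) = ρb ∧ u (t, x) = 0)
    (hsol : ∀ q : Pt, q.1 ∈ Icc 0 T → eulerDamped A γ μ lam ρ u q)
    (β : ℝ → ℝ) (hβ0 : β 0 = 1)
    (hβ : ∀ t : ℝ, 0 ≤ t → HasDerivAt β (μ / (1 + t) ^ lam * β t) t)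
    (hL0 : 0 ≤ ∫ x : E3, (ρ ((0 : ℝ), x) - ρb))
    (Tstar : ℝ) (hTstar : 0 < Tstar)
    (hint : 1 < (∫ x : E3, ∑ i, x i * (ρ ((0 : ℝ), x) * u ((0 : ℝ), x) i)) *
      ∫ τ in (0 : ℝ)..Tstar,
        1 / ((τ + M) ^ 2 * ((∫ x : E3, (ρ ((0 : ℝ), x) - ρb)) +
          4 * π ^ 2 * ρb / 3 * (τ + M) ^ 3) * β τ)) :
    T < Tstar := by
  by_contra! hTT
  have hui : ∀ i, ContDiff ℝ 1 (fun z => u z i) := fun i => (contDiff_pi.1 hu i)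
  have hjc : ∀ j, Continuous (fun y : E3 => y j) := fun j =>
    (EuclideanSpace.proj j : E3 →L[ℝ] ℝ).continuous
  have hcs : ∀ t : ℝ, Continuous fun x : E3 => ((t, x) : Pt) := fun t => by fun_prop
  let R := T + M
  have hsR : ∀ t ∈ Icc 0 T, ∀ x : E3, R < ‖x‖ → ρ (t, x) = ρb ∧ u (t, x) = 0 := fun t ht x hx =>
    hsupp t ht x (lt_of_le_of_lt (by simp only [R]; linarith [ht.2]) hx)
  have h0m : (0:ℝ) ∈ Icc 0 T := ⟨le_rfl, hT⟩
  -- mass conservation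
  have hLd : ∀ t, HasDerivAt (fun s => ∫ x in Metric.closedBall (0:E3) R, (ρ (s, x) - ρb))
      (∫ x in Metric.closedBall (0:E3) R, dt ρ (t, x)) t := by
    intro t
    have := aux_deriv (fun _ => 1) continuous_const (fun z => ρ z - ρb)
      (hρ.sub contDiff_const) R t
    have e : ∀ q, dt (fun z => ρ z - ρb) q = dt ρ q := fun q => by
      unfold dt; rw [fderiv_sub_const]
    simpa [e] using this
  have hLfull : ∀ t ∈ Icc 0 T, ∫ x in Metric.closedBall (0:E3) R, (ρ (t, x) - ρb) =
      ∫ x : E3, (ρ (t, x) - ρb) := fun t ht =>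
    aux_set _ R fun x hx => by simp [hsR t ht x hx]
  have hL : ∀ t ∈ Icc 0 T, ∫ x : E3, (ρ (t, x) - ρb) = ∫ x : E3, (ρ ((0:ℝ), x) - ρb) := by
    intro t ht
    rw [← hLfull t ht, ← hLfull 0 h0m]
    refine constant_of_has_deriv_right_zero (a := 0) (b := T)
      (f := fun s => ∫ x in Metric.closedBall (0:E3) R, (ρ (s, x) - ρb))
      (fun s hs => (hLd s).continuousAt.continuousWithinAt) (fun s hs => ?_) t ht
    have hs' : s ∈ Icc 0 T := Ico_subset_Icc_self hs
    have := hLd s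
    rw [aux_massflux R s ρ u hρ hu (fun x hx => (hsR s hs' x hx).2)
      (fun x => (hsol (s, x) hs').1)] at this
    exact this.hasDerivWithinAt
  -- momentum
  let Hf : ℝ → ℝ := fun s => ∑ j, ∫ x in Metric.closedBall (0:E3) R, x j * (ρ (s, x) * u (s, x) j)
  have hHd : ∀ t, HasDerivAt Hf (∑ j, ∫ x in Metric.closedBall (0:E3) R,
      x j * dt (fun z => ρ z * u z j) (t, x)) t := fun t =>
    HasDerivAt.fun_sum fun j _ =>
      aux_deriv (fun x => x j) (hjc j) (fun z => ρ z * u z j) (hρ.mul (hui j)) R t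
  have hHfull : ∀ t ∈ Icc 0 T, Hf t = ∑ j, ∫ x : E3, x j * (ρ (t, x) * u (t, x) j) :=
    fun t ht => Finset.sum_congr rfl fun j _ =>
      aux_set _ R fun x hx => by simp [hsR t ht x hx]
  set L := ∫ x : E3, (ρ ((0 : ℝ), x) - ρb) with hLdef
  have hH0 : ∫ x : E3, ∑ i, x i * (ρ ((0 : ℝ), x) * u ((0 : ℝ), x) i) = Hf 0 := by
    rw [hHfull 0 h0m]
    refine integral_finsetSum _ fun j _ => ?_
    exact aux_int _ ((hjc j).mul ((hρ.continuous.comp (hcs 0)).mul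
      ((hui j).continuous.comp (hcs 0)))) R fun x hx => by simp [hsR 0 h0m x hx]
  rw [hH0] at hint
  have hsub : ∀ t ∈ Icc 0 Tstar, t ∈ Icc 0 T := fun t ht => ⟨ht.1, ht.2.trans hTT⟩
  refine aux_ode Tstar hTstar Hf _ (fun t => μ / (1 + t) ^ lam)
    (fun τ => (τ + M) ^ 2 * (L + 4 * π ^ 2 * ρb / 3 * (τ + M) ^ 3)) β
    (fun t _ => hHd t) (fun t ht => hβ t ht.1) hβ0 (fun t ht => aux_beta μ lam β hβ0 hβ t ht.1)
    (fun t ht => ?_) (by fun_prop) (fun t ht => ?_) hint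
  · have : 0 < t + M := by linarith [ht.1]
    positivity
  · have ht' := hsub t ht
    have hr : 0 < t + M := by linarith [ht.1]
    have k := aux_ineq A γ ρb (t + M) L hA hγ hρb hr hsound (fun x => ρ (t, x)) (fun x => u (t, x))
      (hρ.continuous.comp (hcs t)) (hu.continuous.comp (hcs t)) (fun x => hpos (t, x) ht')
      (hsupp t ht') (hL t ht') hL0
    have e : ∀ j, _ := fun j => aux_momflux A γ (μ / (1 + t) ^ lam) ρb R t ρ u hρ hu
      (fun x => hpos (t, x) ht') (hsR t ht') j (fun x => (hsol (t, x) ht').2 j)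
    simp_rw [e]
    rw [Finset.sum_sub_distrib, ← Finset.mul_sum, hHfull t ht']
    linarith
end
end

section
/- If 0 ≤ λ < 1 and μ > 0, or if λ = 1 and μ > 1, then for all sufficiently small ε > 0 the damped Burgers problem has a global C¹ solution, i.e. T_ε = ∞. -/
noncomputable section
open Real Set

/-- Time derivative ∂ₜ for a function on ℝ × ℝ (time × space). -/
def dt1 (w : ℝ × ℝ → ℝ) (p : ℝ × ℝ) : ℝ := fderiv ℝ w p (1, 0)
/-- Spatial derivative ∂ₓ for a function on ℝ × ℝ. -/
def dx1 (w : ℝ × ℝ → ℝ) (p : ℝ × ℝ) : ℝ := fderiv ℝ w p (0, 1)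

/-- The 1-D Burgers equation with time-dependent damping
`∂ₜw + w ∂ₓw = -(μ/(1+t)^λ) w` at the point `p = (t, x)`. -/
def burgersDamped (μ lam : ℝ) (w : ℝ × ℝ → ℝ) (p : ℝ × ℝ) : Prop :=
  dt1 w p + w p * dx1 w p = -(μ / (1 + p.1) ^ lam) * w p

open Filter Topology MeasureTheory

lemma aux_contDiff {f f' : ℝ → ℝ} (h : ∀ t, HasDerivAt f (f' t) t) (hc : Continuous f') :
    ContDiff ℝ 1 f := by
  rw [contDiff_one_iff_deriv]
  refine ⟨fun t => (h t).differentiableAt, ?_⟩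
  have : deriv f = f' := funext fun t => (h t).deriv
  rwa [this]

lemma aux_prim {f : ℝ → ℝ} (hc : Continuous f) (t : ℝ) :
    HasDerivAt (fun u => ∫ s in (0:ℝ)..u, f s) (f t) t :=
  intervalIntegral.integral_hasDerivAt_right (hc.intervalIntegrable _ _)
    (hc.stronglyMeasurableAtFilter _ _) hc.continuousAt

lemma aux_damp (μ lam : ℝ)
    (hcase : (0 ≤ lam ∧ lam < 1 ∧ 0 < μ) ∨ (lam = 1 ∧ 1 < μ)) :
    ∃ p : ℝ, 1 < p ∧ ∃ T : ℝ, 0 ≤ T ∧ ∀ t, T ≤ t → p / (1 + t) ≤ μ / (1 + t) ^ lam := by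
  rcases hcase with ⟨h0, h1, hμ⟩ | ⟨h1, hμ⟩
  · have h : Tendsto (fun t : ℝ => (1 + t) ^ (1 - lam)) atTop atTop :=
      (tendsto_rpow_atTop (by linarith)).comp (tendsto_atTop_add_const_left _ _ tendsto_id)
    obtain ⟨T, hT⟩ := eventually_atTop.1 (h.eventually_ge_atTop (2 / μ))
    refine ⟨2, by norm_num, max T 0, le_max_right _ _, fun t ht => ?_⟩
    have h2 := hT t ((le_max_left _ _).trans ht)
    have h3 : (0:ℝ) ≤ t := (le_max_right _ _).trans ht
    have h4 : (0:ℝ) < 1 + t := by linarith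
    rw [rpow_sub h4, rpow_one, div_le_div_iff₀ hμ (by positivity)] at h2
    rw [div_le_div_iff₀ h4 (by positivity)]
    linarith
  · refine ⟨μ, hμ, 0, le_rfl, fun t ht => ?_⟩
    rw [h1, rpow_one]

lemma aux_time (μ lam : ℝ)
    (hcase : (0 ≤ lam ∧ lam < 1 ∧ 0 < μ) ∨ (lam = 1 ∧ 1 < μ)) :
    ∃ (β β' b b' : ℝ → ℝ) (M : ℝ), (∀ t, HasDerivAt β (β' t) t) ∧ Continuous β' ∧
      (∀ t, HasDerivAt b (b' t) t) ∧ Continuous b' ∧ β 0 = 1 ∧ b 0 = 0 ∧ (∀ t, |b t| ≤ M) ∧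
      (∀ t, 0 ≤ t → b' t = β t) ∧ (∀ t, 0 ≤ t → β' t = -(μ / (1 + t) ^ lam) * β t) := by
  obtain ⟨p, hp, T, hT0, hT⟩ := aux_damp μ lam hcase
  set a : ℝ → ℝ := fun t => μ / (1 + max t 0) ^ lam with ha
  have hpos : ∀ t : ℝ, (0:ℝ) < 1 + max t 0 := fun t => by
    have := le_max_right t 0
    linarith
  have hac : Continuous a := by
    refine continuous_const.div ?_ fun t => (rpow_pos_of_pos (hpos t) _).ne'
    exact (by fun_prop : Continuous fun t : ℝ => 1 + max t 0).rpow_const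
      fun t => Or.inl (hpos t).ne'
  have hat : ∀ t, 0 ≤ t → a t = μ / (1 + t) ^ lam := fun t ht => by simp [ha, max_eq_left ht]
  set A : ℝ → ℝ := fun u => ∫ s in (0:ℝ)..u, a s with hA
  have hAd : ∀ t, HasDerivAt A (a t) t := aux_prim hac
  set β : ℝ → ℝ := fun t => exp (-A t) with hβ
  have hβd : ∀ t, HasDerivAt β (β t * (-a t)) t := fun t => (hAd t).neg.exp
  have hβc : Continuous β := continuous_iff_continuousAt.2 fun t => (hβd t).continuousAt
  have hgc : Continuous fun t : ℝ => β |t| := hβc.comp continuous_abs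
  have hβpos : ∀ t, 0 < β t := fun t => exp_pos _
  have hanti : AntitoneOn (fun t => β t * (1 + t) ^ p) (Ici T) := by
    have hd : ∀ t, 0 ≤ t → HasDerivAt (fun t => β t * (1 + t) ^ p)
        (β t * (-a t) * (1 + t) ^ p + β t * (1 * p * (1 + t) ^ (p - 1))) t := fun t ht =>
      (hβd t).mul (((hasDerivAt_id t).const_add 1).rpow_const (Or.inl (by simp; linarith)))
    have hTn : ∀ t ∈ Ici T, (0:ℝ) ≤ t := fun t ht => hT0.trans ht
    refine antitoneOn_of_deriv_nonpos (convex_Ici T)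
      (fun t ht => (hd t (hTn t ht)).continuousAt.continuousWithinAt)
      (fun t ht => (hd t (hTn t (interior_subset ht))).differentiableAt.differentiableWithinAt) ?_
    intro t ht
    have ht := interior_subset ht
    have ht0 := hTn t ht
    have h4 : (0:ℝ) < 1 + t := by linarith
    rw [(hd t ht0).deriv, rpow_sub h4, rpow_one, hat t ht0]
    have h5 := hT t ht
    have h6 : 0 ≤ β t * (1 + t) ^ p := mul_nonneg (hβpos t).le (rpow_nonneg h4.le _)
    have : β t * (-(μ / (1 + t) ^ lam)) * (1 + t) ^ p + β t * (1 * p * ((1 + t) ^ p / (1 + t)))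
      = (β t * (1 + t) ^ p) * (p / (1 + t) - μ / (1 + t) ^ lam) := by ring
    rw [this]
    exact mul_nonpos_of_nonneg_of_nonpos h6 (by linarith)
  have hint : Integrable (fun t : ℝ => β |t|) := by
    refine hgc.locallyIntegrable.integrable_of_isBigO_atTop_of_norm_isNegInvariant
      (g := fun t : ℝ => t ^ (-p)) ?_ ?_ (integrableAtFilter_rpow_atTop_iff.2 (by linarith))
    · filter_upwards with t
      simp
    · refine Asymptotics.IsBigO.of_bound (β T * (1 + T) ^ p) ?_
      filter_upwards [eventually_ge_atTop T, eventually_gt_atTop 0] with t ht ht0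
      have h1 := hanti (mem_Ici.2 le_rfl) (mem_Ici.2 ht) ht
      simp only at h1
      rw [abs_of_pos ht0, norm_of_nonneg (hβpos t).le, norm_of_nonneg (rpow_nonneg ht0.le _),
        rpow_neg ht0.le, ← div_eq_mul_inv, le_div_iff₀ (rpow_pos_of_pos ht0 _)]
      refine le_trans ?_ h1
      exact mul_le_mul_of_nonneg_left (rpow_le_rpow ht0.le (by linarith) (by linarith)) (hβpos t).le
  refine ⟨β, fun t => β t * (-a t), fun u => ∫ s in (0:ℝ)..u, β |s|, fun t => β |t|,
    ∫ s, ‖β |s|‖, hβd, hβc.mul hac.neg, aux_prim hgc, hgc, by simp [hβ, hA], by simp, ?_, ?_, ?_⟩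
  · intro t
    rw [← Real.norm_eq_abs]
    refine intervalIntegral.norm_integral_le_integral_norm_uIoc.trans ?_
    exact setIntegral_le_integral hint.norm (Eventually.of_forall fun _ => norm_nonneg _)
  · intro t ht
    simp [abs_of_nonneg ht]
  · intro t ht
    simp only [hat t ht]
    ring

lemma aux_bdd {f : ℝ → ℝ} (hf : Continuous f) (hc : HasCompactSupport f) :
    ∃ C, 0 < C ∧ ∀ x, |f x| ≤ C := by
  obtain ⟨C, hC⟩ := hc.exists_bound_of_continuous hf
  exact ⟨max C 1, by positivity, fun x => (hC x).trans (le_max_left _ _)⟩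

/-- The inverse of the characteristic map. -/
lemma aux_inv (v v' b b' : ℝ → ℝ) (K : ℝ) (hv : ∀ y, HasDerivAt v (v' y) y)
    (hv' : Continuous v')
    (hb : ∀ y, HasDerivAt b (b' y) y) (hb' : Continuous b') (hK : ∀ y, |v y| ≤ K)
    (hpos : ∀ t y, 0 < 1 + v' y * b t) :
    ∃ Y : ℝ × ℝ → ℝ, ContDiff ℝ 1 Y ∧ (∀ t y, Y (t, y + v y * b t) = y) ∧
      ∀ t x, Y (t, x) + v (Y (t, x)) * b t = x := by
  have hvC := aux_contDiff hv hv'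
  have hbC := aux_contDiff hb hb'
  set Φ : ℝ × ℝ → ℝ × ℝ := fun q => (q.1, q.2 + v q.2 * b q.1) with hΦ
  have hΦC : ContDiff ℝ 1 Φ := by
    refine contDiff_fst.prodMk (contDiff_snd.add ((hvC.comp contDiff_snd).mul
      (hbC.comp contDiff_fst)))
  let L : ℝ × ℝ → (ℝ × ℝ) →L[ℝ] (ℝ × ℝ) := fun q =>
    (ContinuousLinearMap.fst ℝ ℝ ℝ).prod
      ((1 + v' q.2 * b q.1) • ContinuousLinearMap.snd ℝ ℝ ℝ
        + (v q.2 * b' q.1) • ContinuousLinearMap.fst ℝ ℝ ℝ)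
  let R : ℝ × ℝ → (ℝ × ℝ) →L[ℝ] (ℝ × ℝ) := fun q =>
    (ContinuousLinearMap.fst ℝ ℝ ℝ).prod
      ((1 + v' q.2 * b q.1)⁻¹ • (ContinuousLinearMap.snd ℝ ℝ ℝ
        - (v q.2 * b' q.1) • ContinuousLinearMap.fst ℝ ℝ ℝ))
  let E : ℝ × ℝ → (ℝ × ℝ) ≃L[ℝ] (ℝ × ℝ) := fun q =>
    ContinuousLinearEquiv.equivOfInverse (L q) (R q)
      (fun z => by
        have := (hpos q.1 q.2).ne'
        ext
        · simp [L, R]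
        · simp [L, R]
          field_simp)
      (fun z => by
        have := (hpos q.1 q.2).ne'
        ext
        · simp [L, R]
        · simp [L, R]
          field_simp
          try ring)
  have hE : ∀ q, (E q : (ℝ × ℝ) →L[ℝ] (ℝ × ℝ)) = L q := fun q => by
    ext <;> rfl
  have hfd : ∀ q, HasFDerivAt Φ (E q : (ℝ × ℝ) →L[ℝ] (ℝ × ℝ)) q := by
    intro q
    rw [hE]
    have h1 : HasFDerivAt (fun q : ℝ × ℝ => v q.2) (v' q.2 • ContinuousLinearMap.snd ℝ ℝ ℝ) q :=
      (hv q.2).comp_hasFDerivAt q hasFDerivAt_snd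
    have h2 : HasFDerivAt (fun q : ℝ × ℝ => b q.1) (b' q.1 • ContinuousLinearMap.fst ℝ ℝ ℝ) q :=
      (hb q.1).comp_hasFDerivAt q hasFDerivAt_fst
    refine HasFDerivAt.prodMk hasFDerivAt_fst ?_
    refine (hasFDerivAt_snd.add (h1.mul h2)).congr_fderiv ?_
    ext <;> simp
    ring
  have hstr : ∀ q, HasStrictFDerivAt Φ (E q : (ℝ × ℝ) →L[ℝ] (ℝ × ℝ)) q := fun q =>
    hΦC.contDiffAt.hasStrictFDerivAt' (hfd q) (by norm_num)
  have hopen : IsOpenMap Φ := isOpenMap_of_hasStrictFDerivAt_equiv hstr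
  have hsd : ∀ t y, HasDerivAt (fun y => y + v y * b t) (1 + v' y * b t) y := fun t y =>
    (hasDerivAt_id y).add ((hv y).mul_const _)
  have hmono : ∀ t, StrictMono fun y => y + v y * b t := fun t =>
    strictMono_of_deriv_pos fun y => by rw [(hsd t y).deriv]; exact hpos t y
  have hbd : ∀ t y, |v y * b t| ≤ K * |b t| := fun t y => by
    rw [abs_mul]
    exact mul_le_mul_of_nonneg_right (hK y) (abs_nonneg _)
  have hsurj : ∀ t, Function.Surjective fun y => y + v y * b t := fun t => by
    refine Continuous.surjective
      (continuous_iff_continuousAt.2 fun y => (hsd t y).continuousAt) ?_ ?_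
    · refine tendsto_atTop_mono (f := fun y => y + -(K * |b t|)) (fun y => ?_)
        (tendsto_atTop_add_const_right _ _ tendsto_id)
      have := (abs_le.1 (hbd t y)).1
      linarith
    · refine tendsto_atBot_mono (g := fun y => y + v y * b t) (f := fun y => y + (K * |b t|)) (fun y => ?_)
        (tendsto_atBot_add_const_right _ _ tendsto_id)
      have := (abs_le.1 (hbd t y)).2
      linarith
  have hbij : Function.Bijective Φ := by
    constructor
    · rintro ⟨t, y⟩ ⟨t', y'⟩ h
      simp only [hΦ, Prod.mk.injEq] at h
      obtain ⟨rfl, h⟩ := h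
      rw [(hmono t).injective h]
    · rintro ⟨t, x⟩
      obtain ⟨y, hy⟩ := hsurj t x
      exact ⟨(t, y), by simp only [hΦ]; exact Prod.ext rfl hy⟩
  let H : (ℝ × ℝ) ≃ₜ (ℝ × ℝ) :=
    (Equiv.ofBijective Φ hbij).toHomeomorphOfContinuousOpen hΦC.continuous hopen
  have hHs : ContDiff ℝ 1 H.symm := H.contDiff_symm (f₀' := E) hfd hΦC
  have hr : ∀ z, Φ (H.symm z) = z := fun z => H.apply_symm_apply z
  have hl : ∀ z, H.symm (Φ z) = z := fun z => H.symm_apply_apply z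
  refine ⟨fun z => (H.symm z).2, contDiff_snd.comp hHs, fun t y => ?_, fun t x => ?_⟩
  · have := hl (t, y)
    exact congrArg Prod.snd this
  · have h := hr (t, x)
    have h1 : (H.symm (t, x)).1 = t := congrArg Prod.fst h
    have h2 : (H.symm (t, x)).2 + v (H.symm (t, x)).2 * b (H.symm (t, x)).1 = x :=
      congrArg Prod.snd h
    rwa [h1] at h2

/-- **Global existence for the damped Burgers equation**: if `0 ≤ λ < 1` and `μ > 0`, or
`λ = 1` and `μ > 1`, then for all sufficiently small `ε > 0` the problem
`∂ₜw + w∂ₓw = -(μ/(1+t)^λ)w`, `w(0,x) = ε w₀(x)` has a global C¹ solution, i.e. `T_ε = ∞`. -/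
theorem burgers_global_existence
    (μ lam : ℝ) (w₀ : ℝ → ℝ)
    (hw₀ : ContDiff ℝ (⊤ : ℕ∞) w₀) (hw₀c : HasCompactSupport w₀) (hw₀ne : w₀ ≠ 0)
    (hcase : (0 ≤ lam ∧ lam < 1 ∧ 0 < μ) ∨ (lam = 1 ∧ 1 < μ)) :
    ∃ ε₀ > 0, ∀ ε : ℝ, 0 < ε → ε ≤ ε₀ →
      ∃ w : ℝ × ℝ → ℝ,
        ContDiff ℝ 1 w ∧
        (∀ x : ℝ, w (0, x) = ε * w₀ x) ∧
        (∀ p : ℝ × ℝ, 0 ≤ p.1 → burgersDamped μ lam w p) := by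
  obtain ⟨β, β', b, b', M, hβ, hβ', hb, hb', hβ0, hb0, hM, hbβ, hββ⟩ := aux_time μ lam hcase
  have hd : ∀ y, HasDerivAt w₀ (deriv w₀ y) y := fun y =>
    (hw₀.differentiable (by simp) y).hasDerivAt
  have hdc : Continuous (deriv w₀) := hw₀.continuous_deriv (by simp)
  obtain ⟨C, hC0, hC⟩ := aux_bdd hw₀.continuous hw₀c
  obtain ⟨D, hD0, hD⟩ := aux_bdd hdc hw₀c.deriv
  have hM0 : 0 ≤ M := (abs_nonneg _).trans (hM 0)
  refine ⟨1 / (2 * (D * (M + 1))), by positivity, fun ε hε hε1 => ?_⟩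
  rw [le_div_iff₀ (by positivity)] at hε1
  obtain ⟨Y, hY, hY1, hY2⟩ := aux_inv (fun y => ε * w₀ y) (fun y => ε * deriv w₀ y) b b' (ε * C)
    (fun y => (hd y).const_mul ε) (continuous_const.mul hdc) hb hb'
    (fun y => by
      rw [abs_mul, abs_of_pos hε]
      exact mul_le_mul_of_nonneg_left (hC y) hε.le)
    (fun t y => by
      have h1 : |ε * deriv w₀ y * b t| ≤ ε * D * M := by
        rw [abs_mul, abs_mul, abs_of_pos hε]
        exact mul_le_mul (mul_le_mul_of_nonneg_left (hD y) hε.le) (hM t) (abs_nonneg _)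
          (by positivity)
      have h2 := (abs_le.1 h1).1
      have h3 : 0 < ε * D := by positivity
      nlinarith)
  have hwC : ContDiff ℝ 1 fun p : ℝ × ℝ => β p.1 * (ε * w₀ (Y p)) :=
    ((aux_contDiff hβ hβ').comp contDiff_fst).mul
      (contDiff_const.mul ((hw₀.of_le (by simp)).comp hY))
  refine ⟨fun p => β p.1 * (ε * w₀ (Y p)), hwC, fun x => ?_, ?_⟩
  · have := hY1 0 x
    rw [hb0] at this
    simp only [mul_zero, add_zero] at this
    simp [hβ0, this]
  · rintro ⟨t, x⟩ ht
    simp only at ht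
    set w : ℝ × ℝ → ℝ := fun p => β p.1 * (ε * w₀ (Y p)) with hw
    obtain ⟨y, hy⟩ : ∃ y, y = Y (t, x) := ⟨_, rfl⟩
    have hx : x = y + ε * w₀ y * b t := by rw [hy]; exact (hY2 t x).symm
    have hwp : w (t, x) = β t * (ε * w₀ y) := by simp only [hw, hy]
    have hc : HasDerivAt (fun s => (s, y + ε * w₀ y * b s)) ((1:ℝ), ε * w₀ y * b' t) t :=
      (hasDerivAt_id t).prodMk (((hb t).const_mul _).const_add _)
    have hwd : HasFDerivAt w (fderiv ℝ w (t, x)) (t, y + ε * w₀ y * b t) := by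
      rw [← hx]
      exact (hwC.differentiable (by simp) _).hasFDerivAt
    have h1 := hwd.comp_hasDerivAt t hc
    have h2 : HasDerivAt (w ∘ fun s => (s, y + ε * w₀ y * b s)) (β' t * (ε * w₀ y)) t := by
      have : (w ∘ fun s => (s, y + ε * w₀ y * b s)) = fun s => β s * (ε * w₀ y) := by
        funext s
        simp only [hw, Function.comp]
        rw [hY1 s y]
      rw [this]
      exact (hβ t).mul_const _
    have h3 := h1.unique h2
    have h4 : ((1:ℝ), ε * w₀ y * b' t) = (1, 0) + w (t, x) • ((0:ℝ), (1:ℝ)) := by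
      rw [hwp, hbβ t ht]
      ext <;> simp
      ring
    rw [h4, map_add, map_smul, smul_eq_mul, hββ t ht] at h3
    unfold burgersDamped dt1 dx1
    rw [h3, hwp]
    ring
end
end

section
/- If λ > 1 and μ > 0, or if λ = 1 and 0 ≤ μ ≤ 1, then for all sufficiently small ε > 0 every C¹ solution of the damped Burgers problem breaks down in finite time, i.e. T_ε < ∞. -/
noncomputable section
open Real Set

open Filter Topology in
lemma bb_beta (μ lam : ℝ)
    (hcase : (1 < lam ∧ 0 < μ) ∨ (lam = 1 ∧ 0 ≤ μ ∧ μ ≤ 1)) :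
    ∃ β : ℝ → ℝ, ∃ c > 0, β 0 = 1 ∧ ∀ t, 0 ≤ t →
      HasDerivAt β (-(μ / (1 + t) ^ lam) * β t) t ∧ c / (1 + t) ≤ β t := by
  rcases hcase with ⟨hl, hm⟩ | ⟨rfl, hm0, hm1⟩
  · refine ⟨fun t => exp (μ / (lam - 1) * ((1 + t) ^ (1 - lam) - 1)), exp (-(μ / (lam - 1))),
      exp_pos _, by simp, ?_⟩
    intro t ht
    have h1 : 0 < 1 + t := by linarith
    have hl' : 0 < lam - 1 := by linarith
    constructor
    · have h2 : HasDerivAt (fun t : ℝ => 1 + t) 1 t := (hasDerivAt_id t).const_add 1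
      have h3 := (((h2.rpow_const (p := 1 - lam) (Or.inl h1.ne')).sub_const 1).const_mul
        (μ / (lam - 1))).exp
      convert h3 using 1
      have : (1 + t) ^ (1 - lam - 1) = ((1 + t) ^ lam)⁻¹ := by
        rw [← rpow_neg h1.le]; congr 1; ring
      rw [this]
      field_simp
      ring
    · have h4 : 0 < (1 + t) ^ (1 - lam) := rpow_pos_of_pos h1 _
      have h5 : 0 < μ / (lam - 1) := by positivity
      calc exp (-(μ / (lam - 1))) / (1 + t) ≤ exp (-(μ / (lam - 1))) :=
            div_le_self (exp_pos _).le (by linarith)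
        _ ≤ _ := by
            apply exp_le_exp.2
            nlinarith
  · refine ⟨fun t => (1 + t) ^ (-μ), 1, one_pos, by simp, ?_⟩
    intro t ht
    have h1 : 0 < 1 + t := by linarith
    constructor
    · have h2 : HasDerivAt (fun t : ℝ => 1 + t) 1 t := (hasDerivAt_id t).const_add 1
      have h3 := h2.rpow_const (p := -μ) (Or.inl h1.ne')
      convert h3 using 1
      rw [rpow_sub h1, rpow_one]
      field_simp
    · rw [one_div, ← rpow_neg_one]
      exact rpow_le_rpow_of_exponent_le (by linarith) (by linarith)

lemma bb_B (β : ℝ → ℝ) (c : ℝ) (hc : 0 < c) (hβ : ∀ t, 0 ≤ t → ContinuousAt β t)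
    (hlow : ∀ t, 0 ≤ t → c / (1 + t) ≤ β t) :
    ∃ B : ℝ → ℝ, B 0 = 0 ∧ (∀ t, 0 ≤ t → HasDerivAt B (β t) t) ∧
      ∀ y, 0 < y → ∃ T > 0, B T = y := by
  have hb : Continuous (fun s => β (max s 0)) := by
    rw [continuous_iff_continuousAt]
    intro s
    exact ContinuousAt.comp (f := fun s : ℝ => max s 0) (hβ _ (le_max_right _ _)) (by fun_prop)
  have hd : ∀ t, 0 ≤ t → HasDerivAt (fun t => ∫ s in (0:ℝ)..t, β (max s 0)) (β t) t := by
    intro t ht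
    have := hb.integral_hasStrictDerivAt 0 t
    simpa [max_eq_left ht] using this.hasDerivAt
  refine ⟨fun t => ∫ s in (0:ℝ)..t, β (max s 0), by simp, hd, ?_⟩
  intro y hy
  set B := fun t => ∫ s in (0:ℝ)..t, β (max s 0) with hB
  have hB0 : B 0 = 0 := by simp [hB]
  have hmono : MonotoneOn (fun t => B t - c * log (1 + t)) (Ici 0) := by
    have hD : ∀ t, 0 ≤ t → HasDerivAt (fun t => B t - c * log (1 + t))
        (β t - c * (1 / (1 + t))) t := by
      intro t ht
      have h2 : HasDerivAt (fun t : ℝ => 1 + t) 1 t := (hasDerivAt_id t).const_add 1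
      exact (hd t ht).sub ((h2.log (by linarith)).const_mul c)
    apply monotoneOn_of_deriv_nonneg (convex_Ici 0)
    · intro t ht
      exact (hD t ht).continuousAt.continuousWithinAt
    · intro t ht
      exact (hD t (interior_subset ht)).differentiableAt.differentiableWithinAt
    · intro t ht
      have ht' : 0 ≤ t := interior_subset ht
      rw [(hD t ht').deriv]
      have := hlow t ht'
      rw [mul_one_div]; linarith
  have he : 0 ≤ exp (y / c) - 1 := by
    have : 0 < y / c := by positivity
    linarith [add_one_le_exp (y / c)]
  have hge : y ≤ B (exp (y / c) - 1) := by
    have := hmono (mem_Ici.2 le_rfl) (mem_Ici.2 he) he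
    simp only [hB0, add_sub_cancel, log_exp] at this
    have h : c * (y / c) = y := by field_simp
    simp at this
    linarith
  have hcont : ContinuousOn B (Icc 0 (exp (y / c) - 1)) := fun t ht =>
    (hd t ht.1).continuousAt.continuousWithinAt
  obtain ⟨T, hT, hTy⟩ := intermediate_value_Icc he hcont (show y ∈ Icc _ _ from ⟨by rw [hB0]; exact hy.le, hge⟩)
  refine ⟨T, lt_of_le_of_ne hT.1 ?_, hTy⟩
  rintro rfl
  linarith

lemma bb_char (μ lam T : ℝ) (hT : 0 < T) (w : ℝ × ℝ → ℝ) (hw : ContDiff ℝ 1 w)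
    (hpde : ∀ p : ℝ × ℝ, 0 ≤ p.1 → p.1 ≤ T → burgersDamped μ lam w p)
    (β B : ℝ → ℝ) (hβ0 : β 0 = 1) (hB0 : B 0 = 0)
    (hβ : ∀ t, 0 ≤ t → HasDerivAt β (-(μ / (1 + t) ^ lam) * β t) t)
    (hB : ∀ t, 0 ≤ t → HasDerivAt B (β t) t) (x : ℝ) :
    w (T, x + w (0, x) * B T) = w (0, x) * β T := by
  set m := w (0, x) with hm
  set γ : ℝ → ℝ × ℝ := fun t => (t, x + m * B t) with hγ
  have hγd : ∀ t, 0 ≤ t → HasDerivAt γ (1, m * β t) t := fun t ht =>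
    (hasDerivAt_id t).prodMk (((hB t ht).const_mul m).const_add x)
  set k : ℝ → ℝ := fun t => -(μ / (1 + t) ^ lam + dx1 w (γ t)) with hk
  set u : ℝ → ℝ := fun t => w (γ t) - m * β t with hu
  have hud : ∀ t, 0 ≤ t → t ≤ T → HasDerivAt u (k t * u t) t := by
    intro t ht htT
    have h1 := ((hw.differentiable one_ne_zero (γ t)).hasFDerivAt).comp_hasDerivAt t (hγd t ht)
    have h2 := h1.sub ((hβ t ht).const_mul m)
    refine HasDerivAt.congr_deriv (f := u) h2 ?_
    have hp := hpde (γ t) ht htT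
    unfold burgersDamped at hp
    have hl : fderiv ℝ w (γ t) (1, m * β t) = dt1 w (γ t) + m * β t * dx1 w (γ t) := by
      have : ((1, m * β t) : ℝ × ℝ) = (1, 0) + (m * β t) • (0, 1) := by simp
      rw [this, map_add, map_smul]; rfl
    rw [hl]
    simp only [hk, hu]
    have : (γ t).1 = t := rfl
    rw [this] at hp
    linear_combination hp
  have hkc : ContinuousOn k (Icc 0 T) := by
    intro t ht
    have h1 : ContinuousAt (fun p => dx1 w p) (γ t) := by
      have : Continuous (fun p => dx1 w p) := by
        unfold dx1
        exact (hw.continuous_fderiv one_ne_zero).clm_apply continuous_const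
      exact this.continuousAt
    have h2 : ContinuousAt (fun t => dx1 w (γ t)) t :=
      ContinuousAt.comp (f := γ) h1 (hγd t ht.1).continuousAt
    have hpos : 0 < 1 + t := by linarith [ht.1]
    have h3 : ContinuousAt (fun t : ℝ => (1 + t) ^ lam) t :=
      ContinuousAt.rpow_const (by fun_prop) (Or.inl hpos.ne')
    exact ((continuousAt_const.div h3 (rpow_pos_of_pos hpos _).ne').add h2).neg.continuousWithinAt
  obtain ⟨K, hK⟩ := isCompact_Icc.exists_bound_of_continuousOn hkc
  have := norm_le_gronwallBound_of_norm_deriv_right_le (f := u) (f' := fun t => k t * u t)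
    (δ := 0) (K := K) (ε := 0) (a := 0) (b := T)
    (fun t ht => (hud t ht.1 ht.2).continuousAt.continuousWithinAt)
    (fun t ht => (hud t ht.1 ht.2.le).hasDerivWithinAt)
    (by simp [hu, hγ, hB0, hβ0, hm])
    (fun t ht => by
      rw [norm_mul, add_zero]
      exact mul_le_mul_of_nonneg_right (hK t ⟨ht.1, ht.2.le⟩) (norm_nonneg _))
    T ⟨hT.le, le_rfl⟩
  rw [gronwallBound_ε0_δ0] at this
  have h0 : u T = 0 := norm_le_zero_iff.1 this
  exact sub_eq_zero.1 h0

lemma bb_pts (w₀ : ℝ → ℝ) (hw₀c : HasCompactSupport w₀) (hw₀ne : w₀ ≠ 0) :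
    ∃ x₁ x₂, x₁ < x₂ ∧ w₀ x₂ < w₀ x₁ := by
  obtain ⟨c, hc⟩ := Function.ne_iff.1 hw₀ne
  obtain ⟨R, hR⟩ := hw₀c.isCompact.isBounded.subset_closedBall (0:ℝ)
  have hz : ∀ y, R < |y| → w₀ y = 0 := by
    intro y hy
    by_contra h
    have := hR (subset_tsupport _ h)
    simp at this
    linarith
  have h1 : c < |c| + |R| + 1 := by linarith [le_abs_self c, abs_nonneg R]
  have h2 : -(|c| + |R| + 1) < c := by linarith [neg_abs_le c, abs_nonneg R]
  have h3 : R < |(|c| + |R| + 1)| := by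
    rw [abs_of_pos (by positivity)]; linarith [le_abs_self R, abs_nonneg c]
  rcases lt_or_gt_of_ne hc with h | h
  · exact ⟨-(|c| + |R| + 1), c, h2, by
      rw [hz (-(|c| + |R| + 1)) (by rwa [abs_neg])]; exact h⟩
  · exact ⟨c, |c| + |R| + 1, h1, by rw [hz _ h3]; exact h⟩

/-- **Finite lifespan for the damped Burgers equation**: if `λ > 1` and `μ > 0`, or `λ = 1`
and `0 ≤ μ ≤ 1`, then for all sufficiently small `ε > 0` every C¹ solution of
`∂ₜw + w∂ₓw = -(μ/(1+t)^λ)w`, `w(0,x) = ε w₀(x)` breaks down in finite time, i.e.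
`T_ε < ∞`: there is a time `T > 0` beyond which no C¹ solution exists. -/
theorem burgers_blowup
    (μ lam : ℝ) (w₀ : ℝ → ℝ)
    (hw₀ : ContDiff ℝ (⊤ : ℕ∞) w₀) (hw₀c : HasCompactSupport w₀) (hw₀ne : w₀ ≠ 0)
    (hcase : (1 < lam ∧ 0 < μ) ∨ (lam = 1 ∧ 0 ≤ μ ∧ μ ≤ 1)) :
    ∃ ε₀ > 0, ∀ ε : ℝ, 0 < ε → ε ≤ ε₀ →
      ∃ T > 0, ¬ ∃ w : ℝ × ℝ → ℝ,
        ContDiff ℝ 1 w ∧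
        (∀ x : ℝ, w (0, x) = ε * w₀ x) ∧
        (∀ p : ℝ × ℝ, 0 ≤ p.1 → p.1 ≤ T → burgersDamped μ lam w p) := by
  obtain ⟨β, c, hc, hβ0, hβ⟩ := bb_beta μ lam hcase
  obtain ⟨B, hB0, hBd, hBs⟩ := bb_B β c hc (fun t ht => (hβ t ht).1.continuousAt)
    (fun t ht => (hβ t ht).2)
  obtain ⟨x₁, x₂, hx, hwx⟩ := bb_pts w₀ hw₀c hw₀ne
  refine ⟨1, one_pos, fun ε hε _ => ?_⟩
  have hd : 0 < w₀ x₁ - w₀ x₂ := sub_pos.2 hwx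
  obtain ⟨T, hT, hBT⟩ := hBs ((x₂ - x₁) / (ε * (w₀ x₁ - w₀ x₂)))
    (div_pos (sub_pos.2 hx) (mul_pos hε hd))
  refine ⟨T, hT, ?_⟩
  rintro ⟨w, hw, hi, hpde⟩
  have hchar := bb_char μ lam T hT w hw hpde β B hβ0 hB0 (fun t ht => (hβ t ht).1) hBd
  have e1 := hchar x₁
  have e2 := hchar x₂
  rw [hi] at e1 e2
  have hBT' : B T * (ε * (w₀ x₁ - w₀ x₂)) = x₂ - x₁ := by
    rw [hBT]; exact div_mul_cancel₀ _ (mul_pos hε hd).ne'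
  have heq : x₁ + ε * w₀ x₁ * B T = x₂ + ε * w₀ x₂ * B T := by linear_combination hBT'
  rw [heq, e2] at e1
  have hβT : 0 < β T := lt_of_lt_of_le (div_pos hc (by linarith)) (hβ T hT.le).2
  have : 0 < ε * (w₀ x₁ - w₀ x₂) * β T := mul_pos (mul_pos hε hd) hβT
  nlinarith
end
end
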